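/- For ε > 0 define Γ(ε) := inf over integers l ≥ 2 and over all z ∈ ℂ∖{0} with arg z ∈ (−π, π) and Im z < 0 satisfying z·h_l(z) + (l+2)(l−1)ε²·h_l'(z) = 0 of the quantity −Im z (Weber number We = 1). Let ζ₀ ∈ (0, √(2−√2)) be the unique zero in that interval of g₀(ζ) := ∫_ζ^1 √(t^{−2} − 1) dt − (1−ζ²)^{3/2}/(2−ζ²), and set B := 2·(ζ₀²/√(1−ζ₀²))·∫_{ζ₀}^1 √(t^{−2} − 1) dt. Then there exist constants A₀ > 0, C > 0 and ε₀ > 0 such that for all 0 < ε ≤ ε₀: | ε²·e^{B/ε²}·Γ(ε) − A₀ | ≤ C·ε². In particular Γ(ε) = (A_ε/ε²)·exp(−B/ε²) with A_ε = A₀ + O(ε²). -/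

import Mathlib

open Complex

/-- The spherical Hankel function of the first kind of order `l`. -/
noncomputable def sphericalHankel (l : ℕ) (z : ℂ) : ℂ :=
  (-Complex.I) ^ (l + 1) * (Complex.exp (Complex.I * z) / z) *
    ∑ m ∈ Finset.range (l + 1),
      (Complex.I ^ m * (Nat.factorial (l + m) : ℂ)) /
        ((Nat.factorial m : ℂ) * (Nat.factorial (l - m) : ℂ) * (2 * z) ^ m)

/-- The decay rate `Γ(ε)`: the infimum of `−Im z` over all resonance roots `z` of all
modes `l ≥ 2` (Weber number `We = 1`). -/
noncomputable def GammaRate (ε : ℝ) : ℝ :=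
  sInf { y : ℝ | ∃ (l : ℕ) (z : ℂ), 2 ≤ l ∧ z ≠ 0 ∧
    -Real.pi < z.arg ∧ z.arg < Real.pi ∧ z.im < 0 ∧
    z * sphericalHankel l z
        + (((l : ℂ) + 2) * ((l : ℂ) - 1) * (ε : ℂ) ^ 2) * deriv (sphericalHankel l) z = 0 ∧
    y = -z.im }

/-- The leading-order criticality function
`g₀(ζ) = ∫_ζ^1 √(t^{−2}−1) dt − (1−ζ²)^{3/2}/(2−ζ²)`. -/
noncomputable def g0 (ζ : ℝ) : ℝ :=
  (∫ t in ζ..(1 : ℝ), Real.sqrt (1 / t ^ 2 - 1)) - (1 - ζ ^ 2) ^ ((3 : ℝ) / 2) / (2 - ζ ^ 2)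


open Complex
namespace Bub
open Polynomial in
/-- normalised real coefficients -/
noncomputable def cf (l m : ℕ) : ℝ :=
  ∏ j ∈ Finset.range m, (((l:ℝ) - j) * ((l:ℝ) + j + 1) / (2 * ((j:ℝ) + 1)))

lemma cf_zero (l : ℕ) : cf l 0 = 1 := by simp [cf]

lemma cf_succ (l m : ℕ) :
    cf l (m+1) = cf l m * (((l:ℝ) - m) * ((l:ℝ) + m + 1) / (2 * ((m:ℝ) + 1))) := by
  unfold cf; rw [Finset.prod_range_succ]

lemma cf_eq (l m : ℕ) (h : m ≤ l) :
    cf l m = (Nat.factorial (l + m) : ℝ) / (Nat.factorial m * Nat.factorial (l - m) * 2 ^ m) := by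
  induction m with
  | zero => simp [cf_zero, Nat.factorial_ne_zero]
  | succ m ih =>
    rw [cf_succ, ih (by omega)]
    obtain ⟨d, rfl⟩ : ∃ d, l = m + 1 + d := ⟨l - (m+1), by omega⟩
    have e1 : m + 1 + d - m = d + 1 := by omega
    have e2 : m + 1 + d - (m+1) = d := by omega
    have e3 : m + 1 + d + (m + 1) = (m + 1 + d + m) + 1 := by omega
    rw [e1, e2, e3, Nat.factorial_succ (m + 1 + d + m), Nat.factorial_succ m, Nat.factorial_succ d]
    have h1 := Nat.factorial_ne_zero d
    have h2 := Nat.factorial_ne_zero m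
    push_cast
    have h3 : (d.factorial : ℝ) ≠ 0 := by exact_mod_cast h1
    have h4 : (m.factorial : ℝ) ≠ 0 := by exact_mod_cast h2
    have h5 : (m:ℝ) + 1 ≠ 0 := by positivity
    have h6 : (d:ℝ) + 1 ≠ 0 := by positivity
    field_simp
    ring

lemma cf_big (l m : ℕ) (h : l < m) : cf l m = 0 := by
  unfold cf
  apply Finset.prod_eq_zero (i := l) (by simpa using h)
  simp

lemma cf_pos (l m : ℕ) (h : m ≤ l) : 0 < cf l m := by
  rw [cf_eq l m h]; positivity

lemma cf_ladder (l m : ℕ) :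
    ((l:ℝ) + 1 - m) * cf (l+1) m = ((l:ℝ) + 1 + m) * cf l m := by
  induction m with
  | zero => simp [cf_zero]
  | succ m ih =>
    rw [cf_succ, cf_succ]
    have h5 : (m:ℝ) + 1 ≠ 0 := by positivity
    push_cast
    field_simp
    have : ((l:ℝ) + 1 - (m + 1)) * (cf (l+1) m * (l + 1 - m) * (l + 1 + m + 1))
       = ((l:ℝ) + 1 - (m + 1)) * (l + 1 + m + 1) * (((l:ℝ) + 1 - m) * cf (l+1) m) := by ring
    rw [show ((l:ℝ) + 1 - (m + 1)) * cf (l+1) m * (l + 1 - m) * (l + 1 + m + 1) = ((l:ℝ) + 1 - (m + 1)) * (l + 1 + m + 1) * (((l:ℝ) + 1 - m) * cf (l+1) m) by ring, ih]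
    ring

lemma cf_up (l m : ℕ) : cf (l+1) (m+1) = cf l (m+1) + ((l:ℝ) + m + 1) * cf l m := by
  have h := cf_ladder l m
  rw [cf_succ, cf_succ]
  have h5 : (m:ℝ) + 1 ≠ 0 := by positivity
  push_cast
  rw [show cf (l+1) m * (((l:ℝ) + 1 - m) * (l + 1 + m + 1) / (2 * (m + 1)))
    = (((l:ℝ) + 1 - m) * cf (l+1) m) * ((l + 1 + m + 1) / (2 * (m + 1))) by ring, h]
  field_simp
  ring

lemma cf_down (l m : ℕ) : cf l (m+1) = cf (l+1) (m+1) - ((l:ℝ) + 1 - m) * cf (l+1) m := by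
  rw [cf_ladder, cf_up]; ring

open Polynomial

/-- the polynomial `q_l` in `t = 1/z` -/
noncomputable def qp (l : ℕ) : ℂ[X] :=
  ∑ m ∈ Finset.range (l + 1), monomial m (I ^ m * (cf l m : ℂ))

lemma qp_coeff (l m : ℕ) : (qp l).coeff m = I ^ m * (cf l m : ℂ) := by
  unfold qp
  simp only [finsetSum_coeff, coeff_monomial]
  by_cases h : m < l + 1
  · rw [Finset.sum_ite_eq' ]; simp [h]
  · rw [Finset.sum_ite_eq']; simp [h]
    exact cf_big l m (by omega)

lemma qp_ode (l : ℕ) :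
    X ^ 2 * derivative (derivative (qp l)) + C 2 * (X - C I) * derivative (qp l)
      = C ((l:ℂ) * (l + 1)) * qp l := by
  ext m
  have h5 : (m:ℂ) + 1 ≠ 0 := by exact_mod_cast (by positivity : (m:ℝ) + 1 ≠ 0)
  rw [mul_assoc, sub_mul]
  rcases m with _ | _ | m
  · simp [coeff_X_pow_mul', qp_coeff, coeff_derivative, cf_zero, cf_succ]
    linear_combination ((l:ℂ) * (l+1)) * (-1) * I_sq
  · simp only [coeff_add, coeff_C_mul, coeff_sub, coeff_X_pow_mul', coeff_X_mul, coeff_derivative, qp_coeff, cf_zero, cf_succ]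
    norm_num
    ring
  · have h6 : (m:ℂ) + 1 + 1 ≠ 0 := by push_cast at h5; exact_mod_cast h5
    have h7 : (m:ℂ) + 1 + 1 + 1 ≠ 0 := by
      exact_mod_cast (by positivity : (m:ℝ) + 1 + 1 + 1 ≠ 0)
    have e : m + 1 + 1 - 2 = m := by omega
    simp only [coeff_add, coeff_C_mul, coeff_sub, coeff_X_pow_mul', coeff_X_mul, coeff_derivative, qp_coeff, e]
    rw [cf_succ l (m+1+1)]
    push_cast
    rw [pow_succ I (m+1+1)]
    field_simp
    have hI := I_sq
    linear_combination (-1) * (cf l (m+1+1):ℂ) * ((l:ℂ) - (m+1+1)) * (l + (m+1+1) + 1) * hI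

lemma qp_up (l : ℕ) :
    qp (l+1) = qp l + C I * X * (C ((l:ℂ)+1) * qp l + X * derivative (qp l)) := by
  ext m
  rcases m with _ | m
  · simp [mul_assoc, qp_coeff, cf_zero]
  · rw [coeff_add, mul_assoc, coeff_C_mul, coeff_X_mul, coeff_add, coeff_C_mul]
    rcases m with _ | m
    · simp [qp_coeff, cf_up, cf_zero]; ring
    · rw [coeff_X_mul, coeff_derivative, qp_coeff, qp_coeff, qp_coeff, cf_up]
      push_cast
      ring

lemma qp_down (l : ℕ) :
    qp l = qp (l+1) + C I * X * (X * derivative (qp (l+1)) - C ((l:ℂ)+1) * qp (l+1)) := by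
  ext m
  rcases m with _ | m
  · simp [mul_assoc, qp_coeff, cf_zero]
  · rw [coeff_add, mul_assoc, coeff_C_mul, coeff_X_mul, coeff_sub, coeff_C_mul]
    rcases m with _ | m
    · simp [qp_coeff, cf_down l 0, cf_zero]; ring
    · rw [coeff_X_mul, coeff_derivative, qp_coeff, qp_coeff, qp_coeff, cf_down l (m+1)]
      push_cast
      ring

lemma qp_three (l : ℕ) :
    qp (l+2) = qp l + C ((2 * (l:ℂ) + 3) * I) * X * qp (l+1) := by
  have h1 := qp_up (l+1)
  have h2 := qp_down l
  rw [h1]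
  conv_rhs => rw [h2]
  simp only [C_mul, C_add, map_ofNat]
  push_cast
  simp only [C_add, C_1]
  ring

lemma qp_zero : qp 0 = 1 := by
  simp [qp, cf_zero]

lemma qp_eval_zero (l : ℕ) : (qp l).eval 0 = 1 := by
  rw [← coeff_zero_eq_eval_zero, qp_coeff, cf_zero]; simp

lemma qp_natDegree (l : ℕ) : (qp l).natDegree = l := by
  apply le_antisymm
  · unfold qp
    apply natDegree_sum_le_of_forall_le
    intro i hi
    exact (natDegree_monomial_le _).trans (by simp at hi; omega)
  · apply le_natDegree_of_ne_zero
    rw [qp_coeff]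
    have := cf_pos l l le_rfl
    simp [this.ne']

lemma qp_zero_free (l : ℕ) (t : ℂ) (ht : t.im ≤ 0) :
    (qp l).eval t ≠ 0 ∧ 0 < ((qp (l+1)).eval t / (qp l).eval t).re := by
  induction l with
  | zero =>
    constructor
    · simp [qp_zero]
    · rw [qp_up, qp_zero]; simp; linarith
  | succ l ih =>
    obtain ⟨h1, h2⟩ := ih
    have h3 : (qp (l+1)).eval t ≠ 0 := by
      intro h; rw [h] at h2; simp at h2
    refine ⟨h3, ?_⟩
    have e : (qp (l+2)).eval t / (qp (l+1)).eval t
        = ((qp (l+1)).eval t / (qp l).eval t)⁻¹ + (2 * (l:ℂ) + 3) * I * t := by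
      rw [qp_three]; simp only [eval_add, eval_mul, eval_C, eval_X]
      field_simp
    rw [show l + 1 + 1 = l + 2 from rfl, e, add_re, inv_re]
    have p : 0 < normSq ((qp (l+1)).eval t / (qp l).eval t) := by
      rw [normSq_pos]; intro h; rw [h] at h2; simp at h2
    have : ((2 * (l:ℂ) + 3) * I * t).re = (2 * (l:ℝ) + 3) * (- t.im) := by
      simp
    rw [this]
    have : 0 ≤ (2 * (l:ℝ) + 3) * (- t.im) := mul_nonneg (by positivity) (by linarith)
    have := div_pos h2 p
    linarith

end Bub

open Complex
namespace Bub
open Polynomial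

/-- `q_l(-t)` -/
noncomputable def qt (l : ℕ) : ℂ[X] := (qp l).comp (-X)

lemma qt_deriv (l : ℕ) : derivative (qt l) = - (derivative (qp l)).comp (-X) := by
  unfold qt; rw [derivative_comp]; simp

lemma qt_deriv2 (l : ℕ) : derivative (derivative (qt l)) = (derivative (derivative (qp l))).comp (-X) := by
  rw [qt_deriv, derivative_neg, derivative_comp]; simp

lemma qt_ode (l : ℕ) :
    X ^ 2 * derivative (derivative (qt l)) + C 2 * (X + C I) * derivative (qt l)
      = C ((l:ℂ) * (l + 1)) * qt l := by
  have h := congrArg (fun p => p.comp (-X)) (qp_ode l)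
  simp only [add_comp, mul_comp, pow_comp, X_comp, C_comp, sub_comp] at h
  rw [qt_deriv2, qt_deriv]
  unfold qt
  rw [← h]; ring

noncomputable def Mc (l : ℕ) : ℂ[X] := qp l * qt l
noncomputable def Dc (l : ℕ) : ℂ[X] := derivative (qp l) * qt l - qp l * derivative (qt l)
noncomputable def Pc (l : ℕ) : ℂ[X] := derivative (qp l) * derivative (qt l)

lemma wronsk (l : ℕ) : X ^ 2 * Dc l = C (2 * I) * (Mc l - 1) := by
  have h1 := qp_ode l
  have h2 := qt_ode l
  set p := C (2 * I) * Mc l - X ^ 2 * Dc l with hp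
  have hd : derivative p = 0 := by
    rw [hp]; unfold Mc Dc
    simp only [derivative_sub, derivative_mul, derivative_C, derivative_X_pow, derivative_add, C_mul] 
    simp only [map_ofNat, Nat.cast_ofNat] at *
    linear_combination (-1) * qt l * h1 + qp l * h2
  have h0 : p.eval 0 = 2 * I := by
    rw [hp]; unfold Mc Dc qt; simp [eval_comp, qp_eval_zero]
  obtain ⟨c, hc⟩ : ∃ c, p = C c := ⟨_, eq_C_of_derivative_eq_zero hd⟩
  rw [hc] at h0; simp at h0; subst h0
  have h9 : C (2 * I) * Mc l - X ^ 2 * Dc l = C (2 * I) := hp.symm.trans hc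
  linear_combination -h9

lemma Mc_four (l : ℕ) : 4 * Mc l * Pc l = (derivative (Mc l)) ^ 2 - Dc l ^ 2 := by
  unfold Mc Pc Dc; simp only [derivative_mul]; ring

lemma CI_sq : (C I : ℂ[X]) ^ 2 = -1 := by rw [← C_pow, I_sq]; simp

lemma Mc_second (l : ℕ) :
    X ^ 4 * derivative (derivative (Mc l)) + 2 * X ^ 3 * derivative (Mc l)
      - 2 * C ((l:ℂ) * (l+1)) * X ^ 2 * Mc l + 4 * (Mc l - 1) = 2 * X ^ 4 * Pc l := by
  have h1 := qp_ode l
  have h2 := qt_ode l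
  have h3 := wronsk l
  have h4 := CI_sq
  simp only [C_mul, map_ofNat] at h1 h2 h3 ⊢
  have e : derivative (derivative (Mc l)) = derivative (derivative (qp l)) * qt l + 2 * Pc l + qp l * derivative (derivative (qt l)) := by
    unfold Mc Pc; simp only [derivative_mul, derivative_add]; ring
  have e2 : derivative (Mc l) = derivative (qp l) * qt l + qp l * derivative (qt l) := by
    unfold Mc; rw [derivative_mul]
  rw [e, e2]
  have e3 : Dc l = derivative (qp l) * qt l - qp l * derivative (qt l) := rfl
  have e4 : Mc l = qp l * qt l := rfl
  rw [e3] at h3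
  rw [e4] at h3 ⊢
  linear_combination X ^ 2 * qt l * h1 + X ^ 2 * qp l * h2 + 2 * C I * h3 + 4 * (qp l * qt l - 1) * h4

lemma Mc_nonlin (l : ℕ) :
    2 * X ^ 4 * Mc l * derivative (derivative (Mc l)) + 4 * X ^ 3 * Mc l * derivative (Mc l)
      - 4 * C ((l:ℂ) * (l+1)) * X ^ 2 * Mc l ^ 2 + 4 * Mc l ^ 2 - 4
      - X ^ 4 * derivative (Mc l) ^ 2 = 0 := by
  have h1 := Mc_second l
  have h2 := wronsk l
  have h3 := Mc_four l
  have h4 := CI_sq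
  simp only [C_mul, map_ofNat] at h1 h2 h3 ⊢
  linear_combination 2 * Mc l * h1 + X ^ 4 * h3 - (X ^ 2 * Dc l + 2 * C I * (Mc l - 1)) * h2 - 4 * (Mc l - 1) ^ 2 * h4

lemma Pc_deriv (l : ℕ) :
    X ^ 2 * derivative (Pc l) = C ((l:ℂ) * (l+1)) * derivative (Mc l) - 4 * X * Pc l := by
  have h1 := qp_ode l
  have h2 := qt_ode l
  unfold Mc Pc
  simp only [derivative_mul]
  simp only [C_mul, map_ofNat] at h1 h2 ⊢
  linear_combination derivative (qt l) * h1 + derivative (qp l) * h2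

lemma Mc_third (l : ℕ) :
    X ^ 4 * derivative (derivative (derivative (Mc l))) + 6 * X ^ 3 * derivative (derivative (Mc l))
     + 6 * X ^ 2 * derivative (Mc l) - 4 * C ((l:ℂ) * (l+1)) * X ^ 2 * derivative (Mc l)
     - 4 * C ((l:ℂ) * (l+1)) * X * Mc l + 4 * derivative (Mc l) = 0 := by
  have h1 := congrArg derivative (Mc_second l)
  have h2 := Pc_deriv l
  simp only [derivative_add, derivative_sub, derivative_mul, derivative_X_pow, derivative_C, derivative_ofNat, derivative_one] at h1
  simp only [Nat.cast_ofNat, map_ofNat] at h1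
  linear_combination h1 + 2 * X ^ 2 * h2

lemma Mc_coeff_one (l : ℕ) : (Mc l).coeff 1 = 0 := by
  have h := congrArg (fun p => p.eval 0) (Mc_third l)
  simp at h
  rw [← coeff_zero_eq_eval_zero, coeff_derivative] at h
  simpa using h

lemma Mc_coeff_rec (l j : ℕ) : 4 * ((j:ℂ) + 2) * (Mc l).coeff (j+2)
    = ((j:ℂ)+1) * (4 * ((l:ℂ) * (l+1)) - j * (j+2)) * (Mc l).coeff j := by
  have h := congrArg (fun p => p.coeff (j+1)) (Mc_third l)
  have e4 : (4 : ℂ[X]) = C 4 := rfl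
  have e6 : (6 : ℂ[X]) = C 6 := rfl
  rw [e4, e6] at h
  simp only [coeff_add, coeff_sub, mul_assoc, coeff_C_mul, coeff_X_pow_mul', coeff_X_mul, coeff_zero, coeff_derivative] at h
  rcases j with _ | _ | _ | j
  · norm_num at h
    norm_num
    linear_combination h
  · norm_num at h
    norm_num
    linear_combination h
  · norm_num at h
    norm_num
    linear_combination h
  · have a1 : j + 1 + 1 + 1 + 1 - 4 = j := by omega
    have a2 : j + 1 + 1 + 1 + 1 - 3 = j + 1 := by omega
    have a3 : j + 1 + 1 + 1 + 1 - 2 = j + 1 + 1 := by omega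
    have b1 : 4 ≤ j + 1 + 1 + 1 + 1 := by omega
    have b2 : 3 ≤ j + 1 + 1 + 1 + 1 := by omega
    have b3 : 2 ≤ j + 1 + 1 + 1 + 1 := by omega
    simp only [a1, a2, a3, b1, b2, b3, if_true] at h
    push_cast at h ⊢
    rw [show j + 1 + 1 + 1 + 1 + 1 = j + 1 + 1 + 1 + 2 from rfl] at h
    linear_combination h

/-- even coefficients -/
noncomputable def nc (l k : ℕ) : ℝ :=
  ∏ j ∈ Finset.range k, ((2 * (j:ℝ) + 1) * (((l:ℝ) - j) * (l + j + 1)) / (2 * ((j:ℝ) + 1)))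

lemma nc_zero (l : ℕ) : nc l 0 = 1 := by simp [nc]

lemma nc_succ (l k : ℕ) : nc l (k+1) = nc l k * ((2 * (k:ℝ) + 1) * (((l:ℝ) - k) * (l + k + 1)) / (2 * ((k:ℝ) + 1))) := by
  unfold nc; rw [Finset.prod_range_succ]

lemma nc_pos (l k : ℕ) (h : k ≤ l) : 0 < nc l k := by
  unfold nc
  apply Finset.prod_pos
  intro j hj
  simp at hj
  have : (j:ℝ) < l := by exact_mod_cast (by omega : j < l)
  have : (0:ℝ) < l - j := by linarith
  positivity

lemma nc_big (l k : ℕ) (h : l < k) : nc l k = 0 := by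
  unfold nc
  apply Finset.prod_eq_zero (i := l) (by simpa using h)
  simp

lemma nc_le (l k : ℕ) : nc l (k+1) ≤ (l:ℝ) * (l+1) * nc l k := by
  by_cases h : k ≤ l
  · rw [nc_succ, mul_comm]
    apply mul_le_mul_of_nonneg_right _ (nc_pos l k h).le
    have h1 : (k:ℝ) ≤ l := by exact_mod_cast h
    rw [div_le_iff₀ (by positivity)]
    have h0 : (0:ℝ) ≤ k := by positivity
    nlinarith [mul_nonneg h0 h0, mul_nonneg (sub_nonneg.2 h1) h0, mul_nonneg (mul_nonneg (sub_nonneg.2 h1) h0) h0, mul_nonneg h0 (mul_nonneg h0 h0)]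
  · rw [nc_big l k (by omega), nc_big l (k+1) (by omega)]; simp

lemma Mc_coeff_odd (l k : ℕ) : (Mc l).coeff (2 * k + 1) = 0 := by
  induction k with
  | zero => exact Mc_coeff_one l
  | succ k ih =>
    have h := Mc_coeff_rec l (2 * k + 1)
    rw [ih, mul_zero] at h
    have : (4 * (((2 * k + 1 : ℕ) : ℂ) + 2)) ≠ 0 := by
      have : (4 * (((2 * k + 1 : ℕ) : ℝ) + 2)) ≠ 0 := by positivity
      exact_mod_cast this
    exact (mul_eq_zero.1 h).resolve_left this

lemma Mc_coeff_even (l k : ℕ) : (Mc l).coeff (2 * k) = (nc l k : ℂ) := by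
  induction k with
  | zero => simp [coeff_zero_eq_eval_zero, Mc, qt, eval_comp, qp_eval_zero, nc_zero]
  | succ k ih =>
    have h := Mc_coeff_rec l (2 * k)
    rw [ih] at h
    have h1 : (4 * (((2 * k : ℕ) : ℂ) + 2)) ≠ 0 := by
      have : (4 * (((2 * k : ℕ) : ℝ) + 2)) ≠ 0 := by positivity
      exact_mod_cast this
    rw [show 2 * (k+1) = 2 * k + 2 by ring, nc_succ]
    have h2 : (k:ℂ) + 1 ≠ 0 := by
      have : (k:ℝ) + 1 ≠ 0 := by positivity
      exact_mod_cast this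
    apply mul_left_cancel₀ h1
    rw [h]
    push_cast
    field_simp
    ring

/-- real version of M -/
noncomputable def Mr (l : ℕ) : ℝ[X] := ∑ k ∈ Finset.range (l+1), monomial (2*k) (nc l k)

lemma Mr_map (l : ℕ) : (Mr l).map (algebraMap ℝ ℂ) = Mc l := by
  ext j
  rw [coeff_map]
  unfold Mr
  simp only [finsetSum_coeff, coeff_monomial]
  rcases Nat.even_or_odd' j with ⟨k, rfl | rfl⟩
  · rw [Mc_coeff_even]
    simp
    intro h; exact (nc_big l k (by omega)).symm
  · rw [Mc_coeff_odd]
    rw [Finset.sum_eq_zero]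
    · simp
    · intro i _; rw [if_neg (by omega)]

lemma Mr_nonlin (l : ℕ) :
    2 * X ^ 4 * Mr l * derivative (derivative (Mr l)) + 4 * X ^ 3 * Mr l * derivative (Mr l)
      - 4 * C ((l:ℝ) * (l+1)) * X ^ 2 * Mr l ^ 2 + 4 * Mr l ^ 2 - 4
      - X ^ 4 * derivative (Mr l) ^ 2 = 0 := by
  apply map_injective (algebraMap ℝ ℂ) (algebraMap ℝ ℂ).injective
  have := Mc_nonlin l
  rw [← Mr_map] at this
  simp only [Polynomial.map_add, Polynomial.map_sub, Polynomial.map_mul, Polynomial.map_pow, map_X, map_C, Polynomial.map_ofNat, Polynomial.map_zero, derivative_map] at this ⊢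
  convert this using 6
  simp

end Bub

open Complex
namespace Bub
open Polynomial

noncomputable def nu (l : ℕ) : ℝ := (l:ℝ) + 1/2
noncomputable def Nf (l : ℕ) (x : ℝ) : ℝ := (Mr l).eval x⁻¹
noncomputable def Wf (l : ℕ) (x : ℝ) : ℝ := 1/2 + x⁻¹ * (derivative (Mr l)).eval x⁻¹ / (2 * Nf l x)
noncomputable def wf (l : ℕ) (x : ℝ) : ℝ := x / Nf l x

lemma nu_pos (l : ℕ) : 0 < nu l := by unfold nu; positivity

lemma Mr_eval (l : ℕ) (t : ℝ) : (Mr l).eval t = ∑ k ∈ Finset.range (l+1), nc l k * t ^ (2*k) := by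
  simp [Mr, eval_finsetSum, eval_monomial]

lemma Mr_d_eval (l : ℕ) (t : ℝ) : t * (derivative (Mr l)).eval t
    = ∑ k ∈ Finset.range (l+1), (2 * (k:ℝ)) * (nc l k * t ^ (2*k)) := by
  simp only [Mr, derivative_sum, eval_finsetSum, derivative_monomial, eval_monomial, Finset.mul_sum]
  apply Finset.sum_congr rfl
  intro k _
  rcases k with _ | k
  · simp
  · rw [show 2 * (k+1) - 1 = 2 * k + 1 by omega]; push_cast; ring

lemma Mr_d2_eval (l : ℕ) (t : ℝ) :
    t * (derivative (Mr l)).eval t + t ^ 2 * (derivative (derivative (Mr l))).eval t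
    = ∑ k ∈ Finset.range (l+1), (2 * (k:ℝ)) ^ 2 * (nc l k * t ^ (2*k)) := by
  simp only [Mr, derivative_sum, eval_finsetSum, derivative_monomial, eval_monomial, Finset.mul_sum, ← Finset.sum_add_distrib]
  apply Finset.sum_congr rfl
  intro k _
  rcases k with _ | k
  · simp
  · rw [show 2 * (k+1) - 1 = 2 * k + 1 by omega, show 2 * k + 1 - 1 = 2 * k by omega]; push_cast; ring

lemma nc_term_nonneg (l k : ℕ) (t : ℝ) (hk : k ∈ Finset.range (l+1)) : 0 ≤ nc l k * t ^ (2*k) := by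
  have := nc_pos l k (by simp at hk; omega)
  rw [pow_mul]; positivity

lemma Mr_one_le (l : ℕ) (t : ℝ) : 1 ≤ (Mr l).eval t := by
  rw [Mr_eval]
  have := Finset.single_le_sum (fun k hk => nc_term_nonneg l k t hk) (show 0 ∈ Finset.range (l+1) by simp)
  simpa [nc_zero] using this

lemma Nf_one_le (l : ℕ) (x : ℝ) : 1 ≤ Nf l x := Mr_one_le l _
lemma Nf_pos (l : ℕ) (x : ℝ) : 0 < Nf l x := lt_of_lt_of_le one_pos (Nf_one_le l x)

lemma wf_pos (l : ℕ) {x : ℝ} (hx : 0 < x) : 0 < wf l x := div_pos hx (Nf_pos l x)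
lemma wf_le (l : ℕ) {x : ℝ} (hx : 0 < x) : wf l x ≤ x := div_le_self hx.le (Nf_one_le l x)

lemma Wf_ge (l : ℕ) (x : ℝ) : 1/2 ≤ Wf l x := by
  unfold Wf
  have h := Nf_pos l x
  rw [Mr_d_eval]
  have : 0 ≤ ∑ k ∈ Finset.range (l+1), (2 * (k:ℝ)) * (nc l k * x⁻¹ ^ (2*k)) :=
    Finset.sum_nonneg fun k hk => mul_nonneg (by positivity) (nc_term_nonneg l k _ hk)
  have := div_nonneg this (by positivity : 0 ≤ 2 * Nf l x)
  linarith

lemma Wf_le (l : ℕ) (x : ℝ) : Wf l x ≤ nu l := by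
  unfold Wf nu
  have h := Nf_pos l x
  rw [Mr_d_eval]
  have : ∑ k ∈ Finset.range (l+1), (2 * (k:ℝ)) * (nc l k * x⁻¹ ^ (2*k)) ≤ 2 * l * Nf l x := by
    unfold Nf
    rw [Mr_eval, Finset.mul_sum]
    apply Finset.sum_le_sum
    intro k hk
    apply mul_le_mul_of_nonneg_right _ (nc_term_nonneg l k _ hk)
    have : (k:ℝ) ≤ l := by exact_mod_cast (by simp at hk; omega)
    linarith
  have : (∑ k ∈ Finset.range (l+1), (2 * (k:ℝ)) * (nc l k * x⁻¹ ^ (2*k))) / (2 * Nf l x) ≤ l := by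
    rw [div_le_iff₀ (by positivity)]; linarith
  linarith

lemma Nf_hasDeriv (l : ℕ) {x : ℝ} (hx : 0 < x) :
    HasDerivAt (Nf l) (-(2 * Wf l x - 1) * Nf l x / x) x := by
  have h := ((Mr l).hasDerivAt x⁻¹).comp x (hasDerivAt_inv hx.ne')
  have hN := (Nf_pos l x).ne'
  refine HasDerivAt.congr_deriv (f := Nf l) h ?_
  unfold Wf
  have := hx.ne'
  field_simp
  ring

lemma wf_hasDeriv (l : ℕ) {x : ℝ} (hx : 0 < x) :
    HasDerivAt (wf l) (2 * Wf l x * wf l x / x) x := by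
  have hN := (Nf_pos l x).ne'
  have h := (hasDerivAt_id x).div (Nf_hasDeriv l hx) hN
  refine HasDerivAt.congr_deriv (f := wf l) h ?_
  unfold wf
  have := hx.ne'
  simp
  field_simp
  ring

lemma Mr_nonlin_eval (l : ℕ) (t : ℝ) :
    2 * t ^ 4 * (Mr l).eval t * (derivative (derivative (Mr l))).eval t
      + 4 * t ^ 3 * (Mr l).eval t * (derivative (Mr l)).eval t
      - 4 * ((l:ℝ) * (l+1)) * t ^ 2 * (Mr l).eval t ^ 2 + 4 * (Mr l).eval t ^ 2 - 4
      - t ^ 4 * (derivative (Mr l)).eval t ^ 2 = 0 := by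
  have := congrArg (fun p => p.eval t) (Mr_nonlin l)
  simpa using this

lemma Wf_hasDeriv_aux (l : ℕ) {x : ℝ} (hx : 0 < x) :
    HasDerivAt (Wf l) ((-(x⁻¹ * (derivative (Mr l)).eval x⁻¹ + x⁻¹ ^ 2 * (derivative (derivative (Mr l))).eval x⁻¹) / (2 * Nf l x) + (x⁻¹ * (derivative (Mr l)).eval x⁻¹) ^ 2 / (2 * Nf l x ^ 2)) / x) x := by
  have hN := (Nf_pos l x).ne'
  have h1 := ((derivative (Mr l)).hasDerivAt x⁻¹).comp x (hasDerivAt_inv hx.ne')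
  have h2 := (((hasDerivAt_inv hx.ne').mul h1).div ((Nf_hasDeriv l hx).const_mul 2) (by positivity)).const_add (1/2)
  refine HasDerivAt.congr_deriv (f := Wf l) h2 ?_
  unfold Wf
  have := hx.ne'
  simp
  field_simp
  ring

lemma Wf_hasDeriv (l : ℕ) {x : ℝ} (hx : 0 < x) :
    HasDerivAt (Wf l) ((Wf l x ^ 2 - wf l x ^ 2 - (nu l ^ 2 - x ^ 2)) / x) x := by
  have hN := (Nf_pos l x).ne'
  convert Wf_hasDeriv_aux l hx using 1
  have h := Mr_nonlin_eval l x⁻¹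
  have e : (Mr l).eval x⁻¹ = Nf l x := rfl
  rw [e] at h
  unfold Wf wf nu
  have := hx.ne'
  field_simp
  field_simp at h
  linear_combination h

lemma Wf_deriv_nonpos (l : ℕ) {x : ℝ} (hx : 0 < x) :
    (Wf l x ^ 2 - wf l x ^ 2 - (nu l ^ 2 - x ^ 2)) / x ≤ 0 := by
  have hN := (Nf_pos l x)
  rw [(Wf_hasDeriv l hx).unique (Wf_hasDeriv_aux l hx)]
  apply div_nonpos_of_nonpos_of_nonneg _ hx.le
  rw [Mr_d2_eval, Mr_d_eval]
  set S0 := Nf l x with hS0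
  have hS : S0 = ∑ k ∈ Finset.range (l+1), nc l k * x⁻¹ ^ (2*k) := by rw [hS0]; exact Mr_eval _ _
  set S1 := ∑ k ∈ Finset.range (l+1), (2 * (k:ℝ)) * (nc l k * x⁻¹ ^ (2*k)) with hS1
  set S2 := ∑ k ∈ Finset.range (l+1), (2 * (k:ℝ)) ^ 2 * (nc l k * x⁻¹ ^ (2*k)) with hS2
  have hcs : S1 ^ 2 ≤ S2 * S0 := by
    rw [hS, hS1, hS2]
    apply Finset.sum_sq_le_sum_mul_sum_of_sq_le_mul
    · intro k hk; exact mul_nonneg (by positivity) (nc_term_nonneg l k _ hk)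
    · intro k hk; exact nc_term_nonneg l k _ hk
    · intro k hk; exact le_of_eq (by ring)
  have : S1 ^ 2 / (2 * S0 ^ 2) ≤ S2 / (2 * S0) := by
    rw [div_le_div_iff₀ (by positivity) (by positivity)]
    nlinarith
  rw [neg_div]; linarith

lemma Wf_sq_le (l : ℕ) {x : ℝ} (hx : 0 < x) : Wf l x ^ 2 - wf l x ^ 2 ≤ nu l ^ 2 - x ^ 2 := by
  have := Wf_deriv_nonpos l hx
  rw [div_le_iff₀ hx] at this
  linarith

lemma Wf_anti (l : ℕ) : AntitoneOn (Wf l) (Set.Ioi 0) := by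
  apply antitoneOn_of_deriv_nonpos (convex_Ioi 0)
  · intro x hx; exact (Wf_hasDeriv l hx).continuousAt.continuousWithinAt
  · intro x hx; rw [interior_Ioi] at hx; exact (Wf_hasDeriv l hx).differentiableAt.differentiableWithinAt
  · intro x hx; rw [interior_Ioi] at hx; rw [(Wf_hasDeriv l hx).deriv]; exact Wf_deriv_nonpos l hx

lemma Nf_anti (l : ℕ) : AntitoneOn (Nf l) (Set.Ioi 0) := by
  apply antitoneOn_of_deriv_nonpos (convex_Ioi 0)
  · intro x hx; exact (Nf_hasDeriv l hx).continuousAt.continuousWithinAt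
  · intro x hx; rw [interior_Ioi] at hx; exact (Nf_hasDeriv l hx).differentiableAt.differentiableWithinAt
  · intro x hx; rw [interior_Ioi] at hx; rw [(Nf_hasDeriv l hx).deriv]
    have h1 := Wf_ge l x
    have h2 := Nf_pos l x
    apply div_nonpos_of_nonpos_of_nonneg _ (le_of_lt hx)
    nlinarith

lemma nc_le_pow (l k : ℕ) : nc l k ≤ ((l:ℝ) * (l+1)) ^ k := by
  induction k with
  | zero => simp [nc_zero]
  | succ k ih =>
    refine (nc_le l k).trans ?_
    rw [pow_succ, mul_comm]
    exact mul_le_mul_of_nonneg_right ih (by positivity)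

lemma Nf_le_of_nu_le (l : ℕ) {x : ℝ} (hx : nu l ≤ x) : Nf l x ≤ l + 1 := by
  have h0 := nu_pos l
  have hx0 : 0 < x := h0.trans_le hx
  unfold Nf; rw [Mr_eval]
  have : ∀ k ∈ Finset.range (l+1), nc l k * x⁻¹ ^ (2*k) ≤ 1 := by
    intro k _
    calc nc l k * x⁻¹ ^ (2*k) ≤ ((l:ℝ) * (l+1)) ^ k * x⁻¹ ^ (2*k) := by
          gcongr; exact nc_le_pow l k
      _ = (((l:ℝ) * (l+1)) / x ^ 2) ^ k := by rw [div_pow, ← pow_mul, inv_pow]; ring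
      _ ≤ 1 := by
          apply pow_le_one₀ (by positivity)
          rw [div_le_one (by positivity)]
          unfold nu at hx h0
          nlinarith
  calc _ ≤ ∑ k ∈ Finset.range (l+1), (1:ℝ) := Finset.sum_le_sum this
    _ = _ := by simp

lemma Nf_le_of_le_nu (l : ℕ) {x : ℝ} (hx0 : 0 < x) (hx : x ≤ nu l) :
    Nf l x ≤ (l + 1) * (nu l / x) ^ (2 * l) := by
  have h0 := nu_pos l
  unfold Nf; rw [Mr_eval]
  have h1 : 1 ≤ nu l / x := by rw [le_div_iff₀ hx0]; linarith
  have : ∀ k ∈ Finset.range (l+1), nc l k * x⁻¹ ^ (2*k) ≤ (nu l / x) ^ (2 * l) := by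
    intro k hk
    calc nc l k * x⁻¹ ^ (2*k) ≤ ((l:ℝ) * (l+1)) ^ k * x⁻¹ ^ (2*k) := by
          gcongr; exact nc_le_pow l k
      _ ≤ (nu l ^ 2) ^ k * x⁻¹ ^ (2*k) := by
          gcongr; unfold nu; nlinarith
      _ = (nu l / x) ^ (2 * k) := by rw [div_pow, ← pow_mul, inv_pow]; ring
      _ ≤ _ := by
          apply pow_le_pow_right₀ h1
          simp at hk; omega
  calc _ ≤ ∑ k ∈ Finset.range (l+1), (nu l / x) ^ (2 * l) := Finset.sum_le_sum this
    _ = _ := by simp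

/-- `N(x) ≤ (l+1) (ν/x)^(2 W(x))` -/
lemma Nf_le_rpow (l : ℕ) {x : ℝ} (hx0 : 0 < x) (hx : x ≤ nu l) :
    Nf l x ≤ (l + 1) * (nu l / x) ^ (2 * Wf l x) := by
  have h0 := nu_pos l
  -- log N(r) + 2 W(x) log r is nondecreasing on [x, ν]
  have hmono : MonotoneOn (fun r => Real.log (Nf l r) + 2 * Wf l x * Real.log r) (Set.Icc x (nu l)) := by
    have hd : ∀ r, x ≤ r → HasDerivAt (fun r => Real.log (Nf l r) + 2 * Wf l x * Real.log r)
        ((-(2 * Wf l r - 1) * Nf l r / r) / Nf l r + 2 * Wf l x * r⁻¹) r := by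
      intro r hr
      have hr0 : 0 < r := hx0.trans_le hr
      exact ((Nf_hasDeriv l hr0).log (Nf_pos l r).ne').add ((Real.hasDerivAt_log hr0.ne').const_mul _)
    apply monotoneOn_of_deriv_nonneg (convex_Icc _ _)
    · intro r hr; exact (hd r hr.1).continuousAt.continuousWithinAt
    · intro r hr; rw [interior_Icc] at hr; exact (hd r hr.1.le).differentiableAt.differentiableWithinAt
    · intro r hr; rw [interior_Icc] at hr; rw [(hd r hr.1.le).deriv]
      have hr0 : 0 < r := hx0.trans hr.1
      have hN := (Nf_pos l r).ne'
      have := Wf_anti l (Set.mem_Ioi.2 hx0) (Set.mem_Ioi.2 hr0) hr.1.le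
      have e : (-(2 * Wf l r - 1) * Nf l r / r) / Nf l r + 2 * Wf l x * r⁻¹ = (2 * (Wf l x - Wf l r) + 1) / r := by
        field_simp; ring
      rw [e]
      apply div_nonneg _ hr0.le
      linarith
  have h := hmono (Set.left_mem_Icc.2 hx) (Set.right_mem_Icc.2 hx) hx
  simp only at h
  have h2 : Real.log (Nf l (nu l)) ≤ Real.log (l + 1) :=
    Real.log_le_log (Nf_pos _ _) (Nf_le_of_nu_le l le_rfl)
  rw [← Real.log_le_log_iff (Nf_pos _ _) (by positivity), Real.log_mul (by positivity) (by positivity),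
    Real.log_rpow (by positivity), Real.log_div h0.ne' hx0.ne']
  linarith
end Bub

open Complex
namespace Bub
open Polynomial

lemma qp_eval (l : ℕ) (t : ℂ) : (qp l).eval t = ∑ m ∈ Finset.range (l+1), I ^ m * (cf l m : ℂ) * t ^ m := by
  simp [qp, eval_finsetSum, eval_monomial]

lemma hankel_eq (l : ℕ) (z : ℂ) : sphericalHankel l z
    = (-I) ^ (l+1) * (exp (I * z) / z) * (qp l).eval z⁻¹ := by
  unfold sphericalHankel
  rw [qp_eval]
  congr 1
  apply Finset.sum_congr rfl
  intro m hm
  rw [cf_eq l m (by simp at hm; omega)]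
  push_cast
  rw [mul_pow, inv_pow]
  simp only [div_eq_mul_inv, mul_inv]
  ring

lemma hankel_hasDeriv (l : ℕ) {z : ℂ} (hz : z ≠ 0) : HasDerivAt (sphericalHankel l)
    ((-I) ^ (l+1) * (exp (I * z) / z) * ((I - z⁻¹) * (qp l).eval z⁻¹ - z⁻¹ ^ 2 * (derivative (qp l)).eval z⁻¹)) z := by
  have e : sphericalHankel l = fun z => (-I) ^ (l+1) * (exp (I * z) / z) * (qp l).eval z⁻¹ := by
    ext z; exact hankel_eq l z
  rw [e]
  have h1 := ((qp l).hasDerivAt z⁻¹).comp z (hasDerivAt_inv hz)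
  have h2 : HasDerivAt (fun z => exp (I * z)) (exp (I * z) * (I * 1)) z := ((hasDerivAt_id z).const_mul I).cexp
  have h3 := ((h2.div (hasDerivAt_id z) hz).const_mul ((-I) ^ (l+1))).mul h1
  refine HasDerivAt.congr_deriv h3 ?_
  simp
  field_simp
  ring

/-- log-derivative of the Hankel function -/
noncomputable def Rc (l : ℕ) (z : ℂ) : ℂ :=
  I - z⁻¹ - z⁻¹ ^ 2 * (derivative (qp l)).eval z⁻¹ / (qp l).eval z⁻¹

lemma wronsk_eval (l : ℕ) (t : ℂ) :
    t ^ 2 * ((derivative (qp l)).eval t * (qt l).eval t - (qp l).eval t * (derivative (qt l)).eval t)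
     = 2 * I * ((qp l).eval t * (qt l).eval t - 1) := by
  have := congrArg (fun p => p.eval t) (wronsk l)
  simpa [Dc, Mc] using this

lemma qp_simple (l : ℕ) (t : ℂ) (h0 : (qp l).eval t = 0) : t ^ 2 * (derivative (qp l)).eval t ≠ 0 := by
  intro h
  have h1 := wronsk_eval l t
  rw [h0] at h1
  have : t ^ 2 * ((derivative (qp l)).eval t * (qt l).eval t) = 0 := by rw [← mul_assoc, h, zero_mul]
  simp [this] at h1

/-- root equation -/
def IsRt (l : ℕ) (Q : ℝ) (z : ℂ) : Prop := (qp l).eval z⁻¹ ≠ 0 ∧ Rc l z = - z / Q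

lemma root_iff (l : ℕ) {Q : ℝ} (hQ : 0 < Q) {z : ℂ} (hz : z ≠ 0) :
    z * sphericalHankel l z + (Q:ℂ) * deriv (sphericalHankel l) z = 0 ↔ IsRt l Q z := by
  have hQ' : (Q:ℂ) ≠ 0 := by exact_mod_cast hQ.ne'
  have hE : (-I) ^ (l+1) * (exp (I * z) / z) ≠ 0 := by
    simp [hz, exp_ne_zero]
  rw [(hankel_hasDeriv l hz).deriv, hankel_eq]
  have e : z * ((-I) ^ (l + 1) * (cexp (I * z) / z) * eval z⁻¹ (qp l)) +
      ↑Q * ((-I) ^ (l + 1) * (cexp (I * z) / z) * ((I - z⁻¹) * eval z⁻¹ (qp l) - z⁻¹ ^ 2 * eval z⁻¹ (derivative (qp l))))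
      = ((-I) ^ (l+1) * (exp (I * z) / z)) * (z * eval z⁻¹ (qp l) + Q * ((I - z⁻¹) * eval z⁻¹ (qp l) - z⁻¹ ^ 2 * eval z⁻¹ (derivative (qp l)))) := by ring
  rw [e, mul_eq_zero, or_iff_right hE]
  constructor
  · intro h
    have hq : (qp l).eval z⁻¹ ≠ 0 := by
      intro h0
      have := qp_simple l z⁻¹ h0
      rw [h0] at h
      simp only [mul_zero, zero_sub, zero_add, mul_neg, neg_eq_zero, mul_eq_zero, hQ', false_or] at h
      apply this
      simpa using h
    refine ⟨hq, ?_⟩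
    unfold Rc
    rw [eq_div_iff hQ', ← sub_eq_zero]
    rw [← mul_left_inj' hq, zero_mul, ← h]
    rw [sub_mul, mul_comm _ (Q:ℂ), mul_assoc, sub_mul, div_mul_cancel₀ _ hq]
    ring
  · rintro ⟨hq, h⟩
    unfold Rc at h
    rw [eq_div_iff hQ', ← sub_eq_zero] at h
    rw [← mul_left_inj' hq, zero_mul] at h
    rw [sub_mul, mul_comm _ (Q:ℂ), mul_assoc, sub_mul, div_mul_cancel₀ _ hq] at h
    rw [← h]; ring

lemma qt_eval (l : ℕ) (t : ℂ) : (qt l).eval t = (starRingEnd ℂ) ((qp l).eval ((starRingEnd ℂ) t)) := by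
  unfold qt
  rw [eval_comp, qp_eval, qp_eval, map_sum]
  apply Finset.sum_congr rfl
  intro m _
  simp only [map_mul, map_pow, conj_I, conj_ofReal, eval_neg, eval_X, conj_conj]
  rw [neg_pow, neg_pow I]; ring

lemma evmap (p : ℝ[X]) (t : ℝ) : (p.map (algebraMap ℝ ℂ)).eval (t:ℂ) = ((p.eval t : ℝ) : ℂ) := by
  rw [eval_map]; exact eval₂_at_apply (algebraMap ℝ ℂ) t

lemma qp_real_normSq (l : ℕ) (t : ℝ) : (qp l).eval (t:ℂ) * (qt l).eval (t:ℂ) = (((Mr l).eval t : ℝ) : ℂ) := by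
  have : (((Mr l).eval t : ℝ) : ℂ) = (Mc l).eval (t:ℂ) := by
    rw [← Mr_map, evmap]
  rw [this, Mc, eval_mul]

lemma qp_real_ne (l : ℕ) (t : ℝ) : (qp l).eval (t:ℂ) ≠ 0 := (qp_zero_free l t (by simp)).1

lemma Rc_real (l : ℕ) {x : ℝ} (hx : x ≠ 0) :
    Rc l x = ((-(Wf l x + 1/2) / x : ℝ) : ℂ) + ((1 / Nf l x : ℝ) : ℂ) * I := by
  have hq := qp_real_ne l x⁻¹
  have hM := qp_real_normSq l x⁻¹
  have hN : (Nf l x : ℂ) ≠ 0 := by exact_mod_cast (Nf_pos l x).ne'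
  have e0 : (((Mr l).eval x⁻¹ : ℝ) : ℂ) = (Nf l x : ℂ) := rfl
  rw [e0] at hM
  have hw := wronsk_eval l ((x⁻¹ : ℝ) : ℂ)
  have hM' : (derivative (qp l)).eval ((x⁻¹ : ℝ) : ℂ) * (qt l).eval ((x⁻¹ : ℝ) : ℂ) + (qp l).eval ((x⁻¹ : ℝ) : ℂ) * (derivative (qt l)).eval ((x⁻¹ : ℝ) : ℂ)
      = (((derivative (Mr l)).eval x⁻¹ : ℝ) : ℂ) := by
    have h1 : (((derivative (Mr l)).eval x⁻¹ : ℝ) : ℂ) = (derivative (Mc l)).eval ((x⁻¹ : ℝ) : ℂ) := by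
      rw [← Mr_map, derivative_map, evmap]
    rw [h1, Mc, derivative_mul, eval_add, eval_mul, eval_mul]
  unfold Rc Wf
  rw [← ofReal_inv]
  set t : ℂ := ((x⁻¹ : ℝ) : ℂ) with ht
  have hxc : (x:ℂ) ≠ 0 := by exact_mod_cast hx
  have htx : t * x = 1 := by rw [ht]; push_cast; field_simp
  have ht' : t = 1 / x := by field_simp; exact htx
  have key : t ^ 2 * (derivative (qp l)).eval t / (qp l).eval t
     = t ^ 2 * (((derivative (Mr l)).eval x⁻¹ : ℝ) : ℂ) / (2 * Nf l x) + I * (Nf l x - 1) / Nf l x := by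
    have hqt : (qt l).eval t ≠ 0 := by
      intro h; rw [h, mul_zero] at hM; exact hN hM.symm
    rw [← hM', ← hM]
    rw [← hM] at hN
    field_simp
    rw [← sub_eq_zero]
    linear_combination (1) * hw
  rw [key]
  push_cast
  rw [ht']
  field_simp
  ring
end Bub

open Complex
namespace Bub
open Polynomial

lemma exists_rho (l : ℕ) : ∃ ρ : Fin l → ℂ, (∀ j, (ρ j).im < 0) ∧
    ∀ z : ℂ, z ≠ 0 → (qp l).eval z⁻¹ ≠ 0 → (∀ j, z ≠ ρ j) ∧
      Rc l z = I - (l + 1) / z + ∑ j, 1 / (z - ρ j) := by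
  have hs : (qp l).Splits := IsAlgClosed.splits _
  have hcard : Multiset.card (qp l).roots = l := by
    rw [← hs.natDegree_eq_card_roots, qp_natDegree]
  set L := (qp l).roots.toList with hL
  have hLl : L.length = l := by rw [hL, Multiset.length_toList, hcard]
  have hroot : ∀ i : Fin L.length, (qp l).eval (L.get i) = 0 := by
    intro i
    have : L.get i ∈ (qp l).roots := by
      rw [← Multiset.mem_toList]; exact List.get_mem _ _
    exact (mem_roots'.1 this).2
  let τ : Fin l → ℂ := fun j => L.get (Fin.cast hLl.symm j)
  have hτ : ∀ j, (qp l).eval (τ j) = 0 := fun j => hroot _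
  have hτim : ∀ j, 0 < (τ j).im := by
    intro j
    by_contra h
    exact (qp_zero_free l (τ j) (not_lt.1 h)).1 (hτ j)
  have hτ0 : ∀ j, τ j ≠ 0 := by
    intro j h; have := hτim j; rw [h] at this; simp at this
  refine ⟨fun j => (τ j)⁻¹, ?_, ?_⟩
  · intro j
    rw [inv_im]
    apply div_neg_of_neg_of_pos
    · linarith [hτim j]
    · exact normSq_pos.2 (hτ0 j)
  · intro z hz hq
    have hne : ∀ j, z ≠ (τ j)⁻¹ := by
      intro j h
      apply hq; rw [h, inv_inv]; exact hτ j
    refine ⟨hne, ?_⟩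
    have h1 := hs.eval_derivative_div_eval_of_ne_zero hq
    have h2 : ((qp l).roots.map fun a => 1 / (z⁻¹ - a)).sum = ∑ j, 1 / (z⁻¹ - τ j) := by
      have : (qp l).roots = (L : Multiset ℂ) := by rw [hL, Multiset.coe_toList]
      rw [this, Multiset.map_coe, Multiset.sum_coe]
      rw [← Fin.sum_univ_getElem]
      apply Fintype.sum_equiv (finCongr (by simp [hLl]))
      intro i
      simp [τ]
    rw [h2] at h1
    unfold Rc
    rw [mul_div_assoc, h1, Finset.mul_sum]
    have h3 : ∀ j, z⁻¹ ^ 2 * (1 / (z⁻¹ - τ j)) = 1 / z - 1 / (z - (τ j)⁻¹) := by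
      intro j
      have a := hτ0 j
      have b : z - (τ j)⁻¹ ≠ 0 := sub_ne_zero.2 (hne j)
      have c : z * τ j - 1 ≠ 0 := by
        intro h; apply b; field_simp; rw [mul_zero]; exact h
      have d : 1 - z * τ j ≠ 0 := by
        intro h; apply c; linear_combination -h
      have e : z⁻¹ - τ j = (1 - z * τ j) / z := by field_simp
      have f : z - (τ j)⁻¹ = (z * τ j - 1) / τ j := by field_simp
      rw [e, f]
      field_simp
      ring
    simp only [h3]
    rw [Finset.sum_sub_distrib]
    simp
    field_simp
    ring

/-- the good set of poles -/
structure Poles (l : ℕ) (ρ : Fin l → ℂ) : Prop where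
  im_le : ∀ j, (ρ j).im ≤ -1
  eq : ∀ z : ℂ, z ≠ 0 → (qp l).eval z⁻¹ ≠ 0 → (∀ j, z ≠ ρ j) ∧
      Rc l z = I - (l + 1) / z + ∑ j, 1 / (z - ρ j)
  sum_le : ∀ x : ℝ, x ≠ 0 → ∑ j, 1 / ‖(x:ℂ) - ρ j‖ ^ 2 ≤ 1

lemma exists_poles (l : ℕ) : ∃ ρ : Fin l → ℂ, Poles l ρ := by
  obtain ⟨ρ, h1, h2⟩ := exists_rho l
  have hsum : ∀ x : ℝ, x ≠ 0 → ∑ j, (-(ρ j).im) / ‖(x:ℂ) - ρ j‖ ^ 2 ≤ 1 := by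
    intro x hx
    have hxc : (x:ℂ) ≠ 0 := by exact_mod_cast hx
    have h := (h2 x hxc (by rw [← ofReal_inv]; exact qp_real_ne l _)).2
    rw [Rc_real l hx] at h
    have h3 := congrArg Complex.im h
    simp only [add_im, ofReal_im, mul_im, ofReal_re, I_im, I_re, sub_im, im_sum] at h3
    have h4 : (((l:ℂ) + 1) / x).im = 0 := by
      rw [show ((l:ℂ) + 1) / x = ((((l:ℝ)+1) / x : ℝ) : ℂ) by push_cast; ring]; exact ofReal_im _
    have h5 : ∀ j, (1 / ((x:ℂ) - ρ j)).im = - ((-(ρ j).im) / ‖(x:ℂ) - ρ j‖ ^ 2) := by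
      intro j
      rw [one_div, inv_im, ← normSq_eq_norm_sq]; simp; ring
    rw [h4] at h3
    simp only [h5, Finset.sum_neg_distrib] at h3
    have := Nf_pos l x
    have : 0 < 1 / Nf l x := by positivity
    linarith
  have hb : ∀ j, (ρ j).im ≤ -1 := by
    intro j
    have hj : ∀ x : ℝ, x ≠ 0 → -(ρ j).im ≤ (x - (ρ j).re) ^ 2 + (ρ j).im ^ 2 := by
      intro x hx
      have h := hsum x hx
      have h3 : (-(ρ j).im) / ‖(x:ℂ) - ρ j‖ ^ 2 ≤ 1 := by
        refine (Finset.single_le_sum (f := fun j => (-(ρ j).im) / ‖(x:ℂ) - ρ j‖ ^ 2) ?_ (Finset.mem_univ j)).trans h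
        intro i _
        exact div_nonneg (by linarith [h1 i]) (by positivity)
      have h4 : ‖(x:ℂ) - ρ j‖ ^ 2 = (x - (ρ j).re) ^ 2 + (ρ j).im ^ 2 := by
        rw [← normSq_eq_norm_sq, normSq_apply]; simp; ring
      rw [h4, div_le_one] at h3
      · exact h3
      · have := h1 j; nlinarith [sq_nonneg (x - (ρ j).re)]
    by_contra hc
    push Not at hc
    have hn := h1 j
    by_cases ha : (ρ j).re = 0
    · set b := -(ρ j).im with hb
      have hb1 : b < 1 := by linarith
      have hb0 : 0 < b := by linarith
      have hp : 0 < (b - b ^ 2) / 2 := by nlinarith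
      have := hj (Real.sqrt ((b - b^2)/2)) (Real.sqrt_pos.2 hp).ne'
      rw [ha, sub_zero, Real.sq_sqrt hp.le] at this
      have e : (ρ j).im ^ 2 = b ^ 2 := by rw [hb]; ring
      rw [e] at this
      linarith
    · have := hj _ ha
      nlinarith
  refine ⟨ρ, hb, h2, ?_⟩
  intro x hx
  refine le_trans (Finset.sum_le_sum ?_) (hsum x hx)
  intro j _
  apply div_le_div_of_nonneg_right _ (by positivity)
  linarith [hb j]

lemma Poles.ge_one {l : ℕ} {ρ : Fin l → ℂ} (h : Poles l ρ) (x : ℝ) (j : Fin l) : 1 ≤ ‖(x:ℂ) - ρ j‖ := by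
  have := abs_im_le_norm ((x:ℂ) - ρ j)
  simp at this
  have h2 := h.im_le j
  have := neg_abs_le (ρ j).im
  linarith [abs_of_nonpos (by linarith : (ρ j).im ≤ 0)]

/-- first order perturbation -/
lemma Rc_first (l : ℕ) {x y : ℝ} (hx : 0 < x) (hy : |y| ≤ 1/2)
    (hq : (qp l).eval ((x:ℂ) - y * I)⁻¹ ≠ 0) :
    ‖Rc l ((x:ℂ) - y * I) - Rc l x‖ ≤ |y| * ((l + 1) / x ^ 2 + 2) := by
  obtain ⟨ρ, h⟩ := exists_poles l
  set z : ℂ := (x:ℂ) - y * I with hz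
  have hzre : z.re = x := by simp [hz]
  have hz0 : z ≠ 0 := by intro h0; rw [h0] at hzre; simp at hzre; linarith
  have hxc : (x:ℂ) ≠ 0 := by exact_mod_cast hx.ne'
  have hzx : x ≤ ‖z‖ := by have := re_le_norm z; rwa [hzre] at this
  have hd : ‖z - x‖ = |y| := by rw [hz]; simp
  obtain ⟨hne, e1⟩ := h.eq z hz0 hq
  obtain ⟨hne2, e2⟩ := h.eq x hxc (by rw [← ofReal_inv]; exact qp_real_ne l _)
  have e : Rc l z - Rc l x = (l + 1) * (z - x) / (x * z) + ∑ j, (x - z) / ((z - ρ j) * (x - ρ j)) := by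
    rw [e1, e2]
    have : ∀ j, (x - z) / ((z - ρ j) * (x - ρ j)) = 1 / (z - ρ j) - 1 / (x - ρ j) := by
      intro j
      have a : z - ρ j ≠ 0 := sub_ne_zero.2 (hne j)
      have b : (x:ℂ) - ρ j ≠ 0 := sub_ne_zero.2 (hne2 j)
      field_simp; ring
    simp only [this, Finset.sum_sub_distrib]
    field_simp
    ring
  rw [e, mul_add]
  refine (norm_add_le _ _).trans (add_le_add ?_ ?_)
  · rw [norm_div, norm_mul, norm_mul, hd]
    have : ‖(l:ℂ) + 1‖ = l + 1 := by
      rw [show (l:ℂ) + 1 = ((l+1 : ℕ) : ℂ) by push_cast; ring, Complex.norm_natCast]; push_cast; ring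
    rw [this, norm_real, Real.norm_of_nonneg hx.le, ← mul_div_assoc, mul_comm ((l:ℝ)+1)]
    apply div_le_div_of_nonneg_left (by positivity) (by positivity)
    nlinarith
  · refine (norm_sum_le _ _).trans ?_
    calc ∑ j, ‖((x:ℂ) - z) / ((z - ρ j) * (x - ρ j))‖ ≤ ∑ j, |y| * 2 * (1 / ‖(x:ℂ) - ρ j‖ ^ 2) := by
          apply Finset.sum_le_sum
          intro j _
          have h1 := h.ge_one x j
          rw [norm_div, norm_mul, norm_sub_rev (x:ℂ) z, hd]
          have h2 : ‖(x:ℂ) - ρ j‖ / 2 ≤ ‖z - ρ j‖ := by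
            have := norm_sub_norm_le ((x:ℂ) - ρ j) (z - ρ j)
            rw [show (x:ℂ) - ρ j - (z - ρ j) = x - z by ring, norm_sub_rev (x:ℂ) z, hd] at this
            linarith
          have h3 : 0 < ‖z - ρ j‖ := by linarith
          rw [mul_one_div, div_le_div_iff₀ (by positivity) (by positivity)]
          have : 0 ≤ |y| := abs_nonneg y
          have := mul_nonneg this (by linarith : 0 ≤ ‖(x:ℂ) - ρ j‖)
          nlinarith
      _ = |y| * 2 * ∑ j, (1 / ‖(x:ℂ) - ρ j‖ ^ 2) := by rw [Finset.mul_sum]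
      _ ≤ |y| * 2 * 1 := by gcongr; exact h.sum_le x hx.ne'
      _ = _ := by ring

/-- second order perturbation, imaginary part -/
lemma Rc_second (l : ℕ) {x y : ℝ} (hx : 0 < x) (hy : |y| ≤ 1/2)
    (hq : (qp l).eval ((x:ℂ) - y * I)⁻¹ ≠ 0) :
    |(Rc l ((x:ℂ) - y * I)).im - 1 / Nf l x + y * (((Wf l x + 1/2) - (Wf l x ^ 2 - wf l x ^ 2 - (nu l ^ 2 - x ^ 2))) / x ^ 2)|
      ≤ y ^ 2 * ((l + 1) / x ^ 3 + 2) := by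
  obtain ⟨ρ, h⟩ := exists_poles l
  set z : ℂ := (x:ℂ) - y * I with hz
  have hzre : z.re = x := by simp [hz]
  have hz0 : z ≠ 0 := by intro h0; rw [h0] at hzre; simp at hzre; linarith
  have hxc : (x:ℂ) ≠ 0 := by exact_mod_cast hx.ne'
  have hzx : x ≤ ‖z‖ := by have := re_le_norm z; rwa [hzre] at this
  have hd : ‖z - x‖ = |y| := by rw [hz]; simp
  obtain ⟨hne, e1⟩ := h.eq z hz0 hq
  obtain ⟨hne2, e2⟩ := h.eq x hxc (by rw [← ofReal_inv]; exact qp_real_ne l _)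
  set R1 : ℂ := (l + 1) / (x:ℂ) ^ 2 - ∑ j, 1 / ((x:ℂ) - ρ j) ^ 2 with hR1
  -- derivative along the real line
  have hder1 : HasDerivAt (fun r : ℝ => Rc l r) R1 x := by
    have hA : HasDerivAt (fun w : ℂ => I - (l + 1) / w + ∑ j, 1 / (w - ρ j)) R1 (x:ℂ) := by
      have hs : HasDerivAt (fun w : ℂ => ∑ j, 1 / (w - ρ j)) (∑ j, -(1 / ((x:ℂ) - ρ j) ^ 2)) (x:ℂ) := by
        apply HasDerivAt.fun_sum
        intro j _
        have b : (x:ℂ) - ρ j ≠ 0 := sub_ne_zero.2 (hne2 j)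
        have := ((hasDerivAt_id (x:ℂ)).sub_const (ρ j)).inv b
        simp only [one_div]
        refine HasDerivAt.congr_deriv this ?_
        simp; field_simp
      have h3 := (((hasDerivAt_inv hxc).const_mul ((l:ℂ) + 1)).const_sub I).add hs
      refine HasDerivAt.congr_deriv h3 ?_
      rw [hR1, Finset.sum_neg_distrib]; field_simp; ring
    have hB := hA.comp_ofReal
    refine hB.congr_of_eventuallyEq ?_
    filter_upwards [lt_mem_nhds hx] with r hr
    exact (h.eq r (by exact_mod_cast hr.ne') (by rw [← ofReal_inv]; exact qp_real_ne l _)).2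
  have hre : R1.re = ((Wf l x + 1/2) - (Wf l x ^ 2 - wf l x ^ 2 - (nu l ^ 2 - x ^ 2))) / x ^ 2 := by
    have h1 : HasDerivAt (fun r : ℝ => (Rc l r).re) R1.re x := by
      have := Complex.reCLM.hasFDerivAt.comp_hasDerivAt x hder1
      exact this
    have h2 : HasDerivAt (fun r : ℝ => -(Wf l r + 1/2) / r) (((Wf l x + 1/2) - (Wf l x ^ 2 - wf l x ^ 2 - (nu l ^ 2 - x ^ 2))) / x ^ 2) x := by
      have := (((Wf_hasDeriv l hx).add_const (1/2)).neg).div (hasDerivAt_id x) hx.ne'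
      refine HasDerivAt.congr_deriv this ?_
      have := hx.ne'
      simp
      field_simp
      ring
    refine h1.unique (h2.congr_of_eventuallyEq ?_)
    filter_upwards [lt_mem_nhds hx] with r hr
    rw [Rc_real l hr.ne']; simp
  have e : Rc l z - Rc l x - (z - x) * R1 = -((l + 1) * (z - x) ^ 2 / (x ^ 2 * z)) + ∑ j, (z - x) ^ 2 / ((z - ρ j) * (x - ρ j) ^ 2) := by
    rw [e1, e2, hR1]
    have : ∀ j, (z - x) ^ 2 / ((z - ρ j) * (x - ρ j) ^ 2) = 1 / (z - ρ j) - 1 / (x - ρ j) + (z - x) * (1 / ((x:ℂ) - ρ j) ^ 2) := by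
      intro j
      have a : z - ρ j ≠ 0 := sub_ne_zero.2 (hne j)
      have b : (x:ℂ) - ρ j ≠ 0 := sub_ne_zero.2 (hne2 j)
      field_simp; ring
    simp only [this, Finset.sum_sub_distrib, Finset.sum_add_distrib, ← Finset.mul_sum]
    field_simp
    ring
  have hyy : |y| ^ 2 = y ^ 2 := sq_abs y
  have hbound : ‖Rc l z - Rc l x - (z - x) * R1‖ ≤ y ^ 2 * ((l + 1) / x ^ 3 + 2) := by
    rw [e, mul_add]
    refine (norm_add_le _ _).trans (add_le_add ?_ ?_)
    · rw [norm_neg, norm_div, norm_mul, norm_mul, norm_pow, norm_pow, hd, hyy]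
      have : ‖(l:ℂ) + 1‖ = l + 1 := by
        rw [show (l:ℂ) + 1 = ((l+1 : ℕ) : ℂ) by push_cast; ring, Complex.norm_natCast]; push_cast; ring
      rw [this, norm_real, Real.norm_of_nonneg hx.le, ← mul_div_assoc, mul_comm ((l:ℝ)+1)]
      apply div_le_div_of_nonneg_left (by positivity) (by positivity)
      have : 0 < x ^ 2 := by positivity
      nlinarith
    · refine (norm_sum_le _ _).trans ?_
      calc ∑ j, ‖(z - x) ^ 2 / ((z - ρ j) * (x - ρ j) ^ 2)‖ ≤ ∑ j, y ^ 2 * 2 * (1 / ‖(x:ℂ) - ρ j‖ ^ 2) := by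
            apply Finset.sum_le_sum
            intro j _
            have h1 := h.ge_one x j
            rw [norm_div, norm_mul, norm_pow, norm_pow, hd, hyy]
            have h2 : ‖(x:ℂ) - ρ j‖ / 2 ≤ ‖z - ρ j‖ := by
              have := norm_sub_norm_le ((x:ℂ) - ρ j) (z - ρ j)
              rw [show (x:ℂ) - ρ j - (z - ρ j) = x - z by ring, norm_sub_rev (x:ℂ) z, hd] at this
              linarith
            have h3 : 1 / 2 ≤ ‖z - ρ j‖ := by linarith
            rw [mul_one_div, div_le_div_iff₀ (by positivity) (by positivity)]
            have : 0 ≤ y ^ 2 * ‖(x:ℂ) - ρ j‖ ^ 2 := by positivity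
            nlinarith
        _ = y ^ 2 * 2 * ∑ j, (1 / ‖(x:ℂ) - ρ j‖ ^ 2) := by rw [Finset.mul_sum]
        _ ≤ y ^ 2 * 2 * 1 := by gcongr; exact h.sum_le x hx.ne'
        _ = _ := by ring
  have him := (abs_im_le_norm _).trans hbound
  have e3 : (Rc l z - Rc l x - (z - x) * R1).im = (Rc l z).im - 1 / Nf l x + y * R1.re := by
    rw [Rc_real l hx.ne']
    simp [hz]
  rw [e3, hre] at him
  exact him

end Bub

open Complex
namespace Bub
open Polynomial

lemma exp_beats (C β : ℝ) (hβ : 0 < β) (n : ℕ) : ∃ ε₀ > 0, ε₀ ≤ 1 ∧ ∀ ε : ℝ, 0 < ε → ε ≤ ε₀ →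
    C / ε ^ n ≤ Real.exp (β / ε ^ 2) := by
  set D := |C| + 1 with hD
  have hD0 : 0 < D := by positivity
  set k := n + 1 with hk
  set d := β ^ k / (k.factorial * D) with hd
  have hd0 : 0 < d := by positivity
  refine ⟨min 1 d, by positivity, min_le_left _ _, ?_⟩
  intro ε h0 h1
  have e1 : ε ≤ 1 := h1.trans (min_le_left _ _)
  have e2 : ε ≤ d := h1.trans (min_le_right _ _)
  have h2 := Real.pow_div_factorial_le_exp (β / ε ^ 2) (by positivity) k
  refine le_trans ?_ h2
  rw [div_pow, div_div, div_le_div_iff₀ (by positivity) (by positivity)]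
  have e3 : ε ≤ β ^ k / (k.factorial * D) := e2
  rw [le_div_iff₀ (by positivity)] at e3
  have e4 : C ≤ D := by rw [hD]; linarith [le_abs_self C]
  have e5 : (ε ^ 2) ^ k ≤ ε ^ n * ε := by
    rw [← pow_succ, ← pow_mul]
    apply pow_le_pow_of_le_one h0.le e1; omega
  calc C * ((ε ^ 2) ^ k * k.factorial) ≤ D * ((ε ^ 2) ^ k * k.factorial) := by gcongr
    _ ≤ D * ((ε ^ n * ε) * k.factorial) := by gcongr
    _ = ε ^ n * (ε * (k.factorial * D)) := by ring
    _ ≤ ε ^ n * β ^ k := by gcongr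
    _ = _ := by ring

lemma qt_map (l : ℕ) : qt l = (qp l).map (starRingEnd ℂ) := by
  apply Polynomial.funext
  intro t
  rw [qt_eval]
  conv_rhs => rw [← conj_conj t]
  rw [eval_map, eval₂_at_apply]

lemma qt_d_eval (l : ℕ) (t : ℂ) : (derivative (qt l)).eval t = (starRingEnd ℂ) ((derivative (qp l)).eval ((starRingEnd ℂ) t)) := by
  rw [qt_map, derivative_map]
  conv_lhs => rw [← conj_conj t]
  rw [eval_map, eval₂_at_apply]

lemma qp_neg_conj (l : ℕ) (t : ℂ) : (qp l).eval (-(starRingEnd ℂ) t) = (starRingEnd ℂ) ((qp l).eval t) := by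
  have h := qt_eval l ((starRingEnd ℂ) t)
  rw [conj_conj] at h
  rw [← h, qt, eval_comp]; simp

lemma qp_d_neg_conj (l : ℕ) (t : ℂ) : (derivative (qp l)).eval (-(starRingEnd ℂ) t) = - (starRingEnd ℂ) ((derivative (qp l)).eval t) := by
  have h := qt_d_eval l ((starRingEnd ℂ) t)
  rw [conj_conj] at h
  rw [← h, qt_deriv, eval_neg, eval_comp]; simp

lemma IsRt_symm {l : ℕ} {Q : ℝ} {z : ℂ} (h : IsRt l Q z) : IsRt l Q (-(starRingEnd ℂ) z) := by
  obtain ⟨h1, h2⟩ := h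
  have e : (-(starRingEnd ℂ) z)⁻¹ = -(starRingEnd ℂ) z⁻¹ := by rw [map_inv₀, inv_neg]
  refine ⟨?_, ?_⟩
  · rw [e, qp_neg_conj]; simpa using h1
  · have h3 := congrArg (starRingEnd ℂ) h2
    unfold Rc at h3 ⊢
    rw [e, qp_neg_conj, qp_d_neg_conj]
    simp only [map_sub, map_div₀, map_mul, map_pow, map_neg, conj_I, conj_ofReal] at h3
    rw [neg_div] at h3
    linear_combination -h3

lemma root_norm {l : ℕ} (hl : 2 ≤ l) {Q : ℝ} (hQ : 0 < Q) {z : ℂ} (hz : z ≠ 0) (h : IsRt l Q z) (h1 : ‖z‖ < 1) :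
    Q ≤ ‖z‖ ^ 2 := by
  obtain ⟨ρ, hρ⟩ := exists_poles l
  obtain ⟨hne, he⟩ := hρ.eq z hz h.1
  rw [h.2] at he
  have hQ' : (Q:ℂ) ≠ 0 := by exact_mod_cast hQ.ne'
  have hb : ∀ j, 1 ≤ ‖ρ j‖ := by
    intro j
    have := hρ.ge_one 0 j
    simpa using this
  have e : z ^ 2 / Q = 1 - I * z + ∑ j, ρ j / (ρ j - z) := by
    have e1 : ∀ j, ρ j / (ρ j - z) = 1 - z * (1 / (z - ρ j)) := by
      intro j
      have a : z - ρ j ≠ 0 := sub_ne_zero.2 (hne j)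
      have b : ρ j - z ≠ 0 := sub_ne_zero.2 (hne j).symm
      field_simp; ring
    simp only [e1, Finset.sum_sub_distrib, ← Finset.mul_sum]
    have e2 : ∑ j, 1 / (z - ρ j) = - z / Q - I + (l+1) / z := by rw [he]; ring
    rw [e2]; simp; field_simp; ring
  have h2 : ∀ j, 1/2 ≤ (ρ j / (ρ j - z)).re := by
    intro j
    have hb := hb j
    have a : ρ j ≠ 0 := by intro h0; rw [h0] at hb; simp at hb; linarith
    rw [div_re, ← add_div, le_div_iff₀ (normSq_pos.2 (sub_ne_zero.2 (hne j).symm))]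
    have h3 : normSq z ≤ normSq (ρ j) := by
      rw [normSq_eq_norm_sq, normSq_eq_norm_sq]; gcongr; linarith
    rw [normSq_apply, normSq_apply] at h3
    rw [normSq_apply]
    simp only [sub_re, sub_im]
    nlinarith
  have h3 := congrArg Complex.re e
  have h4 : (l:ℝ) * (1/2) ≤ ∑ j, (ρ j / (ρ j - z)).re := by
    calc (l:ℝ) * (1/2) = ∑ j : Fin l, (1/2:ℝ) := by simp
      _ ≤ _ := Finset.sum_le_sum fun j _ => h2 j
  have h5 : (z ^ 2 / Q).re ≤ ‖z‖ ^ 2 / Q := by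
    refine (re_le_norm _).trans ?_
    rw [norm_div, norm_pow, norm_real, Real.norm_of_nonneg hQ.le]
  simp only [add_re, sub_re, one_re, re_sum, mul_re, I_re, I_im] at h3
  have h6 : |z.im| ≤ ‖z‖ := abs_im_le_norm z
  have h7 := neg_abs_le z.im
  have h8 : (2:ℝ) ≤ l := by exact_mod_cast hl
  have : 1 ≤ ‖z‖ ^ 2 / Q := by linarith
  rwa [le_div_iff₀ hQ, one_mul] at this

/-- first order info from a root -/
lemma root_first {l : ℕ} {Q x y : ℝ} (hQ : 0 < Q) (hx : 0 < x) (hy : |y| ≤ 1/2)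
    (h : IsRt l Q ((x:ℂ) - y * I)) :
    |x / Q - (Wf l x + 1/2) / x| ≤ |y| * ((l + 1) / x ^ 2 + 2) ∧
    |1 / Nf l x - y / Q| ≤ |y| * ((l + 1) / x ^ 2 + 2) := by
  have h1 := Rc_first l hx hy h.1
  rw [h.2, Rc_real l hx.ne'] at h1
  have hQ' : (Q:ℂ) ≠ 0 := by exact_mod_cast hQ.ne'
  have e : -((x:ℂ) - y * I) / Q = ((-x / Q : ℝ) : ℂ) + ((y / Q : ℝ):ℂ) * I := by push_cast; field_simp; ring
  rw [e] at h1
  constructor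
  · have := (abs_re_le_norm _).trans h1
    have e2 : ((((-x / Q : ℝ) : ℂ) + ((y / Q : ℝ):ℂ) * I) - (((-(Wf l x + 1/2) / x : ℝ) : ℂ) + ((1 / Nf l x : ℝ) : ℂ) * I)).re
       = -(x / Q - (Wf l x + 1/2) / x) := by
      simp only [sub_re, add_re, mul_re, ofReal_re, ofReal_im, I_re, I_im]; ring
    rw [e2, abs_neg] at this
    exact this
  · have := (abs_im_le_norm _).trans h1
    simp at this
    rw [abs_sub_comm] at this
    simpa using this

lemma root_second {l : ℕ} {Q x y : ℝ} (hQ : 0 < Q) (hx : 0 < x) (hy : |y| ≤ 1/2)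
    (h : IsRt l Q ((x:ℂ) - y * I)) :
    |y * (1 / Q + ((Wf l x + 1/2) - (Wf l x ^ 2 - wf l x ^ 2 - (nu l ^ 2 - x ^ 2))) / x ^ 2) - 1 / Nf l x|
      ≤ y ^ 2 * ((l + 1) / x ^ 3 + 2) := by
  have h1 := Rc_second l hx hy h.1
  have e : (-((x:ℂ) - y * I) / Q).im = y / Q := by
    have e : -((x:ℂ) - y * I) / Q = ((-x / Q : ℝ) : ℂ) + ((y / Q : ℝ):ℂ) * I := by
      have hQ' : (Q:ℂ) ≠ 0 := by exact_mod_cast hQ.ne'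
      push_cast; field_simp; ring
    rw [e]; simp
  rw [h.2, e] at h1
  convert h1 using 2
  ring

lemma Wf_ge_tenth (l : ℕ) (hl : 2 ≤ l) {x : ℝ} (hx : 0 < x) (hx2 : x ≤ nu l / 4) : nu l / 10 ≤ Wf l x := by
  by_contra hc
  push Not at hc
  have hl' : (2:ℝ) ≤ l := by exact_mod_cast hl
  have hnu : 5/2 ≤ nu l := by unfold nu; linarith
  have hd : ∀ r ∈ Set.Icc x (2*x), HasDerivAt (Wf l) ((Wf l r ^ 2 - wf l r ^ 2 - (nu l ^ 2 - r ^ 2)) / r) r :=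
    fun r hr => Wf_hasDeriv l (hx.trans_le hr.1)
  have h := exists_hasDerivAt_eq_slope (Wf l) (fun r => (Wf l r ^ 2 - wf l r ^ 2 - (nu l ^ 2 - r ^ 2)) / r)
    (show x < 2*x by linarith)
    (fun r hr => (hd r hr).continuousAt.continuousWithinAt) (fun r hr => hd r ⟨hr.1.le, hr.2.le⟩)
  obtain ⟨r, hr, he⟩ := h
  have hr0 : 0 < r := hx.trans hr.1
  have hW := Wf_anti l (Set.mem_Ioi.2 hx) (Set.mem_Ioi.2 hr0) hr.1.le
  have hW0 := Wf_ge l r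
  have hW2 := Wf_ge l (2*x)
  rw [show 2 * x - x = x by ring, div_eq_div_iff hr0.ne' hx.ne'] at he
  have h1 : Wf l r ^ 2 - wf l r ^ 2 - (nu l ^ 2 - r ^ 2) ≤ -(7/10) * nu l ^ 2 := by
    have a : Wf l r ^ 2 ≤ (nu l / 10) ^ 2 := by
      apply pow_le_pow_left₀ (by linarith) (by linarith)
    have b : r ^ 2 ≤ (nu l / 2) ^ 2 := by
      apply pow_le_pow_left₀ hr0.le; linarith [hr.2]
    nlinarith [sq_nonneg (wf l r)]
  have h2 : (Wf l (2*x) - Wf l x) * r ≥ -(nu l / 10) * (2 * x) := by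
    have : -(nu l/10) ≤ Wf l (2*x) - Wf l x := by linarith
    calc (Wf l (2*x) - Wf l x) * r ≥ -(nu l/10) * r := by nlinarith
      _ ≥ _ := by nlinarith [hr.2]
  rw [← he] at h2
  have h3 := mul_le_mul_of_nonneg_right h1 hx.le
  have : nu l * x * (7/10 * nu l - 1/5) ≤ 0 := by nlinarith
  have : 0 < nu l * x * (7/10 * nu l - 1/5) := by
    apply mul_pos (mul_pos (by linarith) hx); linarith
  linarith

lemma Qpos_aux {l : ℕ} (hl : 2 ≤ l) {ε : ℝ} (hε : 0 < ε) : 4 * ε ^ 2 ≤ ((l:ℝ) + 2) * (l - 1) * ε ^ 2 ∧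
   (16/25) * nu l ^ 2 * ε ^ 2 ≤ ((l:ℝ) + 2) * (l - 1) * ε ^ 2 ∧ ((l:ℝ) + 2) * (l - 1) * ε ^ 2 ≤ nu l ^ 2 * ε ^ 2
   ∧ ((l:ℝ) + 2) * (l - 1) = nu l ^ 2 - 9/4 := by
  have hl' : (2:ℝ) ≤ l := by exact_mod_cast hl
  unfold nu
  have : 0 ≤ ε ^ 2 := by positivity
  refine ⟨?_, ?_, ?_, by ring⟩
  · apply mul_le_mul_of_nonneg_right _ this; nlinarith
  · apply mul_le_mul_of_nonneg_right _ this; nlinarith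
  · apply mul_le_mul_of_nonneg_right _ this; nlinarith

/-- the parameter Q -/
noncomputable def Qf (l : ℕ) (ε : ℝ) : ℝ := ((l:ℝ) + 2) * (l - 1) * ε ^ 2

end Bub

open Complex
namespace Bub
open Polynomial

lemma Qf_pos {l : ℕ} (hl : 2 ≤ l) {ε : ℝ} (hε : 0 < ε) : 0 < Qf l ε := by
  have := (Qpos_aux hl hε).1
  unfold Qf
  have : 0 < 4 * ε ^ 2 := by positivity
  linarith

lemma nu_ge {l : ℕ} (hl : 2 ≤ l) : 5/2 ≤ nu l := by
  have hl' : (2:ℝ) ≤ l := by exact_mod_cast hl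
  unfold nu; linarith

lemma root_x_ge {l : ℕ} (hl : 2 ≤ l) {ε x y : ℝ} (hε : 0 < ε) (hε2 : ε ≤ 1/2) (hx : 0 ≤ x) (hy0 : 0 < y) (hy : y ≤ ε / 2)
    (h : IsRt l (Qf l ε) ((x:ℂ) - y * I)) : ε ≤ x := by
  set z : ℂ := (x:ℂ) - y * I with hz
  have hz0 : z ≠ 0 := by
    intro h0
    have := congrArg Complex.im h0
    simp [hz] at this; linarith
  have hn : ‖z‖ ≤ x + y := by
    rw [hz]; refine (norm_sub_le _ _).trans ?_
    simp [abs_of_nonneg hx, abs_of_pos hy0]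
  by_cases h1 : ‖z‖ < 1
  · have h2 := root_norm hl (Qf_pos hl hε) hz0 h h1
    have h3 := (Qpos_aux hl hε).1
    have h4 : (2 * ε) ^ 2 ≤ ‖z‖ ^ 2 := by unfold Qf at h2; nlinarith
    have h5 := abs_le_of_sq_le_sq' h4 (norm_nonneg _)
    linarith [h5.2]
  · linarith

set_option maxHeartbeats 1000000 in
lemma caseA (β : ℝ) (hβ : 0 < β) : ∃ ζ1 > 0, ζ1 ≤ 1/4 ∧ ∃ ε₀ > 0, ε₀ ≤ 1/2 ∧ ∀ ε : ℝ, 0 < ε → ε ≤ ε₀ →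
    ∀ l : ℕ, 2 ≤ l → ∀ x y : ℝ, 0 ≤ x → x ≤ ζ1 * nu l → 0 < y → IsRt l (Qf l ε) ((x:ℂ) - y * I) →
      Real.exp (-β / ε ^ 2) ≤ y := by
  obtain ⟨e1, he1, he1', H1⟩ := exp_beats 200 β hβ 1
  obtain ⟨e2, he2, he2', H2⟩ := exp_beats 28 (β/2) (by linarith) 6
  refine ⟨min (1/4) (β/128), by positivity, min_le_left _ _, min (1/2) (min e1 e2), by positivity, min_le_left _ _, ?_⟩
  intro ε hε hεle l hl x y hx0 hxle hy0 h
  set ζ1 := min (1/4) (β/128) with hζ1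
  have hζ10 : 0 < ζ1 := by positivity
  have hzeta_a : ζ1 ≤ 1/4 := min_le_left _ _
  have hzeta_b : ζ1 ≤ β/128 := min_le_right _ _
  have hε2 : ε ≤ 1/2 := hεle.trans (min_le_left _ _)
  have hεe1 : ε ≤ e1 := hεle.trans ((min_le_right _ _).trans (min_le_left _ _))
  have hεe2 : ε ≤ e2 := hεle.trans ((min_le_right _ _).trans (min_le_right _ _))
  by_contra hc
  push Not at hc
  have hexp : Real.exp (-β / ε ^ 2) = (Real.exp (β / ε ^ 2))⁻¹ := by rw [← Real.exp_neg]; ring_nf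
  have hy : y ≤ ε / 200 := by
    have h1 := H1 ε hε hεe1
    rw [pow_one] at h1
    rw [hexp] at hc
    refine hc.le.trans ?_
    rw [inv_le_comm₀ (Real.exp_pos _) (by positivity), inv_div]
    exact h1
  have hQ := Qf_pos hl hε
  obtain ⟨q1, q2, q3, q4⟩ := Qpos_aux hl hε
  change _ ≤ Qf l ε at q1 q2
  have hxε := root_x_ge hl hε hε2 hx0 hy0 (by linarith) h
  have hx : 0 < x := by linarith
  have hν := nu_ge hl
  have hyabs : |y| = y := abs_of_pos hy0
  obtain ⟨r1, r2⟩ := root_first hQ hx (by rw [hyabs]; linarith) h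
  rw [hyabs] at r1 r2
  have hx4 : x ≤ nu l / 4 := by
    have := mul_le_mul_of_nonneg_right hzeta_a (nu_pos l).le
    linarith
  have hW := Wf_ge_tenth l hl hx hx4
  have hl1 : (l:ℝ) + 1 ≤ 6/5 * nu l := by unfold nu at hν ⊢; linarith
  -- lower bound x^2/Q
  have hA : nu l / 20 ≤ x ^ 2 / Qf l ε := by
    have h1 := (abs_le.1 r1).1
    have h2 := mul_le_mul_of_nonneg_left h1 hx.le
    have e : x * (x / Qf l ε - (Wf l x + 1 / 2) / x) = x ^ 2 / Qf l ε - (Wf l x + 1/2) := by field_simp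
    have e' : x * -(y * ((l + 1) / x ^ 2 + 2)) = -((y / x) * (l + 1) + 2 * x * y) := by field_simp
    rw [e, e'] at h2
    have h3 : y / x ≤ 1/200 := by rw [div_le_iff₀ hx]; linarith
    have h4 : (y / x) * (l + 1) ≤ 1/200 * (6/5 * nu l) := by
      apply mul_le_mul h3 hl1 (by positivity) (by positivity)
    have h5 : 2 * x * y ≤ 2 * (nu l / 4) * (1/200) := by
      apply mul_le_mul (by linarith) (by linarith) hy0.le (by linarith)
    linarith
  have hζ : ∃ ζ, x = ζ * nu l := ⟨x / nu l, by field_simp⟩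
  obtain ⟨ζ, hζ⟩ := hζ
  have hζ0 : 0 < ζ := by
    by_contra hh; push Not at hh; nlinarith only [hh, hζ, hx, hν]
  have hζle : ζ ≤ ζ1 := by
    rw [hζ] at hxle; exact le_of_mul_le_mul_right hxle (by linarith)
  have hB : nu l ≤ 32 * ζ ^ 2 / ε ^ 2 := by
    rw [le_div_iff₀ hQ] at hA
    rw [le_div_iff₀ (by positivity)]
    rw [hζ] at hA
    have h1 : nu l / 20 * ((16/25) * nu l ^ 2 * ε ^ 2) ≤ (ζ * nu l) ^ 2 := by
      refine le_trans ?_ hA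
      gcongr
    have h2 : nu l ^ 2 * (nu l * ε ^ 2) ≤ nu l ^ 2 * (32 * ζ ^ 2) := by nlinarith only [h1, sq_nonneg (ζ * nu l)]
    exact le_of_mul_le_mul_left h2 (by positivity)
  have hBε : nu l ≤ 2 / ε ^ 2 := by
    refine hB.trans ?_
    have hz2 : ζ ^ 2 ≤ (1/4) ^ 2 := pow_le_pow_left₀ hζ0.le (hζle.trans hzeta_a) 2
    gcongr; linarith
  have hN := Nf_le_of_le_nu l hx (by linarith)
  have hpow : (nu l / x) ^ (2 * l) ≤ Real.exp (β / 2 / ε ^ 2) := by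
    have e : nu l / x = 1 / ζ := by rw [hζ]; field_simp
    rw [e]
    have h1 : 0 < 1 / ζ := by positivity
    rw [← Real.exp_log h1, ← Real.exp_nat_mul]
    apply Real.exp_le_exp.2
    have h2 : Real.log (1/ζ) ≤ 1 / ζ := (Real.log_le_sub_one_of_pos h1).trans (by linarith)
    have h3 : ((2 * l : ℕ) : ℝ) ≤ 2 * nu l := by unfold nu; push_cast; linarith
    calc ((2 * l : ℕ) : ℝ) * Real.log (1/ζ) ≤ ((2 * l : ℕ) : ℝ) * (1/ζ) := by gcongr
      _ ≤ (2 * (32 * ζ ^ 2 / ε ^ 2)) * (1/ζ) := by gcongr; linarith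
      _ = 64 * ζ / ε ^ 2 := by field_simp; ring
      _ ≤ β / 2 / ε ^ 2 := by gcongr; linarith
  have hN2 : Nf l x ≤ 4 / ε ^ 2 * Real.exp (β / 2 / ε ^ 2) := by
    refine hN.trans (mul_le_mul ?_ hpow (by positivity) (by positivity))
    calc (l:ℝ) + 1 ≤ 2 * nu l := by linarith
      _ ≤ 2 * (2 / ε ^ 2) := by linarith
      _ = _ := by ring
  have hNpos := Nf_pos l x
  have hK : (l + 1) / x ^ 2 + 2 + 1 / Qf l ε ≤ 7 / ε ^ 4 := by
    have a : ((l:ℝ) + 1) / x ^ 2 ≤ (4 / ε ^ 2) / ε ^ 2 := by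
      apply div_le_div₀ (by positivity) _ (by positivity) (by gcongr)
      calc (l:ℝ) + 1 ≤ 2 * nu l := by linarith
        _ ≤ 2 * (2 / ε ^ 2) := by linarith
        _ = _ := by ring
    have b : 1 / Qf l ε ≤ 1 / (4 * ε ^ 2) := by gcongr
    have hεsq : ε ^ 2 ≤ 1/4 := by nlinarith only [hε2, hε]
    have c : 2 + 1 / (4 * ε ^ 2) ≤ 3 / ε ^ 4 := by
      rw [show 2 + 1 / (4 * ε ^ 2) = (2 * ε ^ 4 + ε ^ 2 / 4) / ε ^ 4 by field_simp]
      gcongr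
      nlinarith only [sq_nonneg (ε ^ 2), hεsq, sq_nonneg ε]
    have d : 7 / ε ^ 4 = (4 / ε ^ 2) / ε ^ 2 + 3 / ε ^ 4 := by field_simp; norm_num
    linarith
  have hfin : 1 / Nf l x ≤ y * (7 / ε ^ 4) := by
    have h1 := (abs_le.1 r2).2
    have h2 : y * ((l + 1) / x ^ 2 + 2) + y / Qf l ε = y * ((l + 1) / x ^ 2 + 2 + 1 / Qf l ε) := by ring
    have h3 := mul_le_mul_of_nonneg_left hK hy0.le
    linarith
  have h2 := H2 ε hε hεe2
  have hEE : Real.exp (β / ε ^ 2) = Real.exp (β / 2 / ε ^ 2) * Real.exp (β / 2 / ε ^ 2) := by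
    rw [← Real.exp_add]; ring_nf
  set E := Real.exp (β / 2 / ε ^ 2) with hE
  have hEpos : 0 < E := Real.exp_pos _
  rw [div_le_iff₀ hNpos] at hfin
  have h5 : y * (7 / ε ^ 4) * Nf l x ≤ y * (7 / ε ^ 4) * (4 / ε ^ 2 * E) := by gcongr
  have h6 : y * (7 / ε ^ 4) * (4 / ε ^ 2 * E) = y * E * (28 / ε ^ 6) := by field_simp; norm_num
  have h7 : y * E * (28 / ε ^ 6) ≤ y * E * E := by gcongr
  rw [hexp, hEE] at hc
  have h8 : y * (E * E) < 1 := by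
    rw [lt_inv_comm₀ hy0 (by positivity)] at hc
    rw [lt_inv_comm₀ (by positivity) hy0] at hc
    calc y * (E * E) < (E*E)⁻¹ * (E * E) := by gcongr
      _ = 1 := inv_mul_cancel₀ (by positivity)
  have h9 : y * E * E = y * (E * E) := by ring
  linarith
end Bub

open Complex
namespace Bub
open Polynomial

lemma le_of_deriv {f f' : ℝ → ℝ} {a b : ℝ} (hab : a ≤ b) (hd : ∀ t ∈ Set.Icc a b, HasDerivAt f (f' t) t)
    (h0 : ∀ t ∈ Set.Icc a b, 0 ≤ f' t) : f a ≤ f b := by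
  have : MonotoneOn f (Set.Icc a b) := by
    apply monotoneOn_of_deriv_nonneg (convex_Icc _ _)
    · intro t ht; exact (hd t ht).continuousAt.continuousWithinAt
    · intro t ht; exact (hd t (interior_subset ht)).differentiableAt.differentiableWithinAt
    · intro t ht; rw [(hd t (interior_subset ht)).deriv]; exact h0 t (interior_subset ht)
  exact this (Set.left_mem_Icc.2 hab) (Set.right_mem_Icc.2 hab) hab

noncomputable def uc (l : ℕ) (z : ℂ) : ℂ := exp (I * z) * (qp l).eval z⁻¹
noncomputable def vc (l : ℕ) (z : ℂ) : ℂ := exp (I * z) * (I * (qp l).eval z⁻¹ - z⁻¹ ^ 2 * (derivative (qp l)).eval z⁻¹)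

lemma uc_hasDeriv (l : ℕ) {z : ℂ} (hz : z ≠ 0) : HasDerivAt (uc l) (vc l z) z := by
  have h1 := ((qp l).hasDerivAt z⁻¹).comp z (hasDerivAt_inv hz)
  have h2 : HasDerivAt (fun z => exp (I * z)) (exp (I * z) * (I * 1)) z := ((hasDerivAt_id z).const_mul I).cexp
  refine HasDerivAt.congr_deriv (h2.mul h1) ?_
  unfold vc
  simp
  field_simp
  ring

lemma vc_hasDeriv (l : ℕ) {z : ℂ} (hz : z ≠ 0) :
    HasDerivAt (vc l) (-(1 - ((l:ℂ) * (l+1)) / z ^ 2) * uc l z) z := by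
  have h1 := ((qp l).hasDerivAt z⁻¹).comp z (hasDerivAt_inv hz)
  have h3 := ((derivative (qp l)).hasDerivAt z⁻¹).comp z (hasDerivAt_inv hz)
  have h2 : HasDerivAt (fun z => exp (I * z)) (exp (I * z) * (I * 1)) z := ((hasDerivAt_id z).const_mul I).cexp
  have h4 := ((hasDerivAt_inv hz).pow 2).mul h3
  refine HasDerivAt.congr_deriv (h2.mul ((h1.const_mul I).sub h4)) ?_
  have ho := congrArg (fun p => p.eval z⁻¹) (qp_ode l)
  simp only [eval_add, eval_mul, eval_pow, eval_X, eval_C, eval_sub] at ho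
  unfold uc
  simp
  set a := eval z⁻¹ (qp l)
  set b := eval z⁻¹ (derivative (qp l))
  set c := eval z⁻¹ (derivative (derivative (qp l)))
  have e : c = z ^ 2 * ((l:ℂ) * (l+1) * a - 2 * (z⁻¹ - I) * b) := by
    rw [← ho]; field_simp; ring
  rw [e]
  have := I_sq
  field_simp
  ring_nf
  rw [this]; ring

set_option maxHeartbeats 2000000 in
lemma sturm {l : ℕ} {Q x y D : ℝ} (hQ : 0 < Q) (hx : 0 < x) (hy : 0 < y)
    (h : IsRt l Q ((x:ℂ) - y * I)) (hD0 : 0 ≤ D) (hD : (l:ℝ) * (l+1) / x ^ 2 - 1 ≤ D)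
    (hs : y ^ 2 * (1 / x ^ 2 + 1 / Q + D) ≤ 1/4) :
    1 ≤ 2 * Nf l x * y * (1 / x ^ 2 + 1 / Q + D) ∧
    Wf l x - 1/2 ≤ 2 * ((l:ℝ) * (l+1) * y ^ 2 / x ^ 2 + x ^ 2 / Q) := by
  set zf : ℝ → ℂ := fun θ => (x:ℂ) - θ * I with hzf
  have hzre : ∀ θ, (zf θ).re = x := by intro θ; simp [hzf]
  have hzim : ∀ θ, (zf θ).im = -θ := by intro θ; simp [hzf]
  have hz0 : ∀ θ, zf θ ≠ 0 := by
    intro θ h0; have := hzre θ; rw [h0] at this; simp at this; linarith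
  have hzd : ∀ θ, HasDerivAt zf (-I) θ := by
    intro θ
    have : HasDerivAt (fun θ : ℝ => (θ:ℂ)) 1 θ := (hasDerivAt_id θ).ofReal_comp
    have h2 := (this.mul_const I).const_sub (x:ℂ)
    refine HasDerivAt.congr_deriv h2 ?_
    simp
  set U : ℝ → ℂ := fun θ => uc l (zf θ) with hU
  set V : ℝ → ℂ := fun θ => vc l (zf θ) with hV
  set lam : ℝ := (l:ℝ) * (l+1) with hlam
  have hlam0 : 0 ≤ lam := by positivity
  have hUd : ∀ θ, HasDerivAt U (vc l (zf θ) * (-I)) θ := fun θ => (uc_hasDeriv l (hz0 θ)).comp θ (hzd θ)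
  have hVd : ∀ θ, HasDerivAt V (-(1 - ((l:ℂ) * (l+1)) / (zf θ) ^ 2) * uc l (zf θ) * (-I)) θ :=
    fun θ => (vc_hasDeriv l (hz0 θ)).comp θ (hzd θ)
  set cr : ℝ → ℝ := fun θ => 1 - lam * (x ^ 2 - θ ^ 2) / (x ^ 2 + θ ^ 2) ^ 2 with hcr
  set ci : ℝ → ℝ := fun θ => - (lam * (2 * x * θ) / (x ^ 2 + θ ^ 2) ^ 2) with hci
  have hc : ∀ θ, (1 - ((l:ℂ) * (l+1)) / (zf θ) ^ 2) = (cr θ : ℂ) + (ci θ : ℂ) * I := by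
    intro θ
    have h1 : ((x:ℂ) ^ 2 + (θ:ℂ) ^ 2) = (x - θ * I) * (x + θ * I) := by
      linear_combination (θ:ℂ)^2 * I_sq
    have h2 : (x:ℂ) - θ * I ≠ 0 := hz0 θ
    have h3 : (x:ℂ) + θ * I ≠ 0 := by
      have := hz0 (-θ); simp only [hzf] at this; push_cast at this; simpa using this
    simp only [hzf, hcr, hci, hlam]
    push_cast
    rw [h1]
    field_simp
    ring_nf
    simp only [I_sq]
    ring
  have hUre : ∀ θ, HasDerivAt (fun θ => (U θ).re) ((V θ).im) θ := by
    intro θ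
    have := Complex.reCLM.hasFDerivAt.comp_hasDerivAt θ (hUd θ)
    refine HasDerivAt.congr_deriv this ?_
    simp [hV]
  have hUim : ∀ θ, HasDerivAt (fun θ => (U θ).im) (-(V θ).re) θ := by
    intro θ
    have := Complex.imCLM.hasFDerivAt.comp_hasDerivAt θ (hUd θ)
    refine HasDerivAt.congr_deriv this ?_
    simp [hV]
  have hVre : ∀ θ, HasDerivAt (fun θ => (V θ).re) (-(cr θ * (U θ).im + ci θ * (U θ).re)) θ := by
    intro θ
    have := Complex.reCLM.hasFDerivAt.comp_hasDerivAt θ (hVd θ)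
    refine HasDerivAt.congr_deriv this ?_
    rw [hc]
    simp [hU]; ring
  have hVim : ∀ θ, HasDerivAt (fun θ => (V θ).im) (cr θ * (U θ).re - ci θ * (U θ).im) θ := by
    intro θ
    have := Complex.imCLM.hasFDerivAt.comp_hasDerivAt θ (hVd θ)
    refine HasDerivAt.congr_deriv this ?_
    rw [hc]
    simp [hU]; ring
  set n : ℝ → ℝ := fun θ => (U θ).re ^ 2 + (U θ).im ^ 2 with hn
  set J : ℝ → ℝ := fun θ => (V θ).im * (U θ).re - (V θ).re * (U θ).im with hJ
  set H : ℝ → ℝ := fun θ => (V θ).re * (U θ).re + (V θ).im * (U θ).im with hH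
  have hnd : ∀ θ, HasDerivAt n (2 * J θ) θ := by
    intro θ
    refine HasDerivAt.congr_deriv (((hUre θ).pow 2).add ((hUim θ).pow 2)) ?_
    simp [hJ]; ring
  have hJd : ∀ θ, HasDerivAt J (cr θ * n θ + ((V θ).re ^ 2 + (V θ).im ^ 2)) θ := by
    intro θ
    refine HasDerivAt.congr_deriv (((hVim θ).mul (hUre θ)).sub ((hVre θ).mul (hUim θ))) ?_
    simp [hn]; ring
  have hHd : ∀ θ, HasDerivAt H (- ci θ * n θ) θ := by
    intro θ
    refine HasDerivAt.congr_deriv (((hVre θ).mul (hUre θ)).add ((hVim θ).mul (hUim θ))) ?_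
    simp [hn]; ring
  have hn0 : ∀ θ, 0 ≤ n θ := fun θ => by simp only [hn]; positivity
  -- boundary values: V/U
  have hVU : ∀ θ r i, (qp l).eval (zf θ)⁻¹ ≠ 0 → Rc l (zf θ) + (zf θ)⁻¹ = (r:ℝ) + (i:ℝ) * I → J θ = n θ * i ∧ H θ = n θ * r := by
    intro θ r i hq he
    have : V θ = U θ * (r + i * I) := by
      rw [← he]
      simp only [hU, hV]
      unfold uc vc Rc
      have hz1 := hz0 θ
      generalize (qp l).eval (zf θ)⁻¹ = a at hq ⊢
      generalize (derivative (qp l)).eval (zf θ)⁻¹ = b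
      field_simp
      ring
    simp only [hJ, hH, hn, this]
    simp
    constructor <;> ring
  have hzy : Rc l (zf y) + (zf y)⁻¹ = ((x / (x^2 + y^2) - x / Q : ℝ) : ℂ) + ((y * (1 / (x^2+y^2) + 1 / Q) : ℝ):ℂ) * I := by
    have h2 : (x:ℂ) - y * I ≠ 0 := hz0 y
    have h3 : (x:ℂ) + y * I ≠ 0 := by
      have := hz0 (-y); simp only [hzf] at this; push_cast at this; simpa using this
    have h1 : ((x:ℂ) ^ 2 + (y:ℂ) ^ 2) = (x - y * I) * (x + y * I) := by
      linear_combination (y:ℂ)^2 * I_sq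
    have hQ' : (Q:ℂ) ≠ 0 := by exact_mod_cast hQ.ne'
    simp only [hzf]
    rw [h.2]
    push_cast
    rw [h1]
    field_simp
    ring
  obtain ⟨hJy, hHy⟩ := hVU y _ _ h.1 hzy
  have hzx : Rc l (zf 0) + (zf 0)⁻¹ = (((1/2 - Wf l x) / x : ℝ) : ℂ) + ((1 / Nf l x : ℝ):ℂ) * I := by
    have e : zf 0 = (x:ℂ) := by simp [hzf]
    have hxc : (x:ℂ) ≠ 0 := by exact_mod_cast hx.ne'
    rw [e, Rc_real l hx.ne']
    push_cast
    field_simp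
    ring
  have hq0 : (qp l).eval (zf 0)⁻¹ ≠ 0 := by
    have e : zf 0 = (x:ℂ) := by simp [hzf]
    rw [e, ← ofReal_inv]; exact qp_real_ne l _
  obtain ⟨hJ0, hH0⟩ := hVU 0 _ _ hq0 hzx
  have hN := Nf_pos l x
  have hn00 : n 0 = Nf l x := by
    have e : zf 0 = (x:ℂ) := by simp [hzf]
    have e1 : n 0 = normSq (uc l x) := by simp only [hn, hU, e, normSq_apply]; ring
    rw [e1]; unfold uc
    rw [normSq_mul]
    have e2 : normSq (exp (I * x)) = 1 := by
      rw [normSq_eq_norm_sq, mul_comm, norm_exp_ofReal_mul_I]; norm_num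
    have e3 := qp_real_normSq l x⁻¹
    rw [qt_eval, conj_ofReal, mul_conj] at e3
    rw [e2, one_mul, ← ofReal_inv]
    exact_mod_cast e3
  rw [hn00] at hJ0 hH0
  have hJ0' : J 0 = 1 := by rw [hJ0]; field_simp
  -- max
  obtain ⟨θm, hθm, hmax⟩ := (isCompact_Icc (a := (0:ℝ)) (b := y)).exists_isMaxOn (Set.nonempty_Icc.2 hy.le)
    (f := n) (fun θ _ => (hnd θ).continuousAt.continuousWithinAt)
  set m := n θm with hm
  have hnm : ∀ θ ∈ Set.Icc (0:ℝ) y, n θ ≤ m := fun θ hθ => hmax hθ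
  have hm0 : 0 ≤ m := hn0 _
  set a := 1 / x ^ 2 + 1 / Q with ha
  have ha0 : 0 < a := by positivity
  have hJym : J y ≤ m * (y * a) := by
    rw [hJy]
    apply mul_le_mul (hnm y (Set.right_mem_Icc.2 hy.le)) _ (by positivity) hm0
    apply mul_le_mul_of_nonneg_left _ hy.le
    have : 1 / (x^2+y^2) ≤ 1 / x^2 := one_div_le_one_div_of_le (by positivity) (by nlinarith only [sq_nonneg y])
    linarith only [this, ha]
  have hcrD : ∀ θ, -D ≤ cr θ := by
    intro θ
    simp only [hcr]
    have : lam * (x ^ 2 - θ ^ 2) / (x ^ 2 + θ ^ 2) ^ 2 ≤ lam / x ^ 2 := by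
      rw [div_le_div_iff₀ (by positivity) (by positivity), mul_assoc]
      apply mul_le_mul_of_nonneg_left _ hlam0
      nlinarith [sq_nonneg (x*θ), sq_nonneg (θ^2)]
    linarith
  have hJθ : ∀ θ ∈ Set.Icc (0:ℝ) y, J θ + D * m * θ ≤ J y + D * m * y := by
    intro θ hθ
    apply le_of_deriv (f := fun θ => J θ + D * m * θ) (f' := fun θ => cr θ * n θ + ((V θ).re ^ 2 + (V θ).im ^ 2) + D * m * 1) hθ.2
    · intro t _; exact (hJd t).add ((hasDerivAt_id t).const_mul _)
    · intro t ht
      have h1 := hcrD t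
      have h2 := hnm t ⟨hθ.1.trans ht.1, ht.2⟩
      have h3 := hn0 t
      have h4 : -D * n t ≤ cr t * n t := mul_le_mul_of_nonneg_right h1 h3
      have h5 : D * n t ≤ D * m := mul_le_mul_of_nonneg_left h2 hD0
      have h6 : 0 ≤ (V t).re ^ 2 + (V t).im ^ 2 := by positivity
      linarith
  set K := m * y * (a + D) with hK
  have hK0 : 0 ≤ K := by positivity
  have hJK : ∀ θ ∈ Set.Icc (0:ℝ) y, J θ ≤ K := by
    intro θ hθ
    have h1 := hJθ θ hθ
    have h2 : 0 ≤ D * m * θ := mul_nonneg (mul_nonneg hD0 hm0) hθ.1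
    have h3 : K = m * (y * a) + D * m * y := by rw [hK]; ring
    linarith
  have hmN : m ≤ Nf l x + 2 * K * y := by
    have := le_of_deriv (f := fun θ => 2 * K * θ - n θ) (f' := fun θ => 2 * K * 1 - 2 * J θ) hθm.1
      (fun t _ => ((hasDerivAt_id t).const_mul _).sub (hnd t))
      (fun t ht => by
        have := hJK t ⟨ht.1, ht.2.trans hθm.2⟩
        linarith)
    rw [hn00] at this
    have h2 : 2 * K * θm ≤ 2 * K * y := by gcongr; exact hθm.2
    linarith
  have hm2 : m ≤ 2 * Nf l x := by
    have : 2 * K * y = 2 * m * (y ^ 2 * (a + D)) := by rw [hK]; ring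
    have h3 : m * (y ^ 2 * (a + D)) ≤ m * (1/4) := mul_le_mul_of_nonneg_left hs hm0
    linarith
  constructor
  · have h1 := hJK 0 (Set.left_mem_Icc.2 hy.le)
    rw [hJ0'] at h1
    have h2 : K ≤ 2 * Nf l x * y * (a + D) := by
      rw [hK]; gcongr
    exact h1.trans h2
  · have h1 := le_of_deriv (f := fun θ => m * lam / x ^ 3 * θ ^ 2 - H θ) (f' := fun θ => m * lam / x ^ 3 * (2 * θ) - (- ci θ * n θ)) hy.le
      (fun t _ => by
        have := ((hasDerivAt_id t).pow 2).const_mul (m * lam / x ^ 3)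
        refine HasDerivAt.congr_deriv (this.sub (hHd t)) ?_
        simp)
      (fun t ht => by
        have e1 : -ci t ≤ lam * (2 * t) / x ^ 3 := by
          simp only [hci, neg_neg]
          have : lam * (2 * x * t) / (x ^ 2 + t ^ 2) ^ 2 ≤ lam * (2 * x * t) / (x ^ 2) ^ 2 := by
            have := ht.1
            gcongr
            nlinarith only [sq_nonneg t]
          refine this.trans (le_of_eq ?_)
          field_simp
        have e0 : 0 ≤ lam * (2 * t) / x ^ 3 := by have := ht.1; positivity
        have e2 : -ci t * n t ≤ lam * (2 * t) / x ^ 3 * m := mul_le_mul e1 (hnm t ht) (hn0 t) e0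
        have e3 : lam * (2 * t) / x ^ 3 * m = m * lam / x ^ 3 * (2 * t) := by ring
        linarith only [e2, e3])
    simp only [hH0, hHy] at h1
    have h2 : n y * (x / (x^2+y^2) - x / Q) ≥ - (m * (x / Q)) := by
      have e1 : 0 ≤ n y * (x / (x^2+y^2)) := mul_nonneg (hn0 y) (by positivity)
      have e2 : n y * (x / Q) ≤ m * (x / Q) := by
        gcongr; exact hnm y (Set.right_mem_Icc.2 hy.le)
      rw [mul_sub]; linarith
    have h3 : Nf l x * ((Wf l x - 1/2) / x) ≤ m * (lam / x ^ 3 * y ^ 2 + x / Q) := by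
      have e1 : Nf l x * ((1/2 - Wf l x) / x) = - (Nf l x * ((Wf l x - 1/2) / x)) := by ring
      have e2 : m * (lam / x ^ 3 * y ^ 2 + x / Q) = m * lam / x ^ 3 * y ^ 2 + m * (x / Q) := by ring
      rw [e1] at h1
      linarith
    have h4 : m * (lam / x ^ 3 * y ^ 2 + x / Q) ≤ 2 * Nf l x * (lam / x ^ 3 * y ^ 2 + x / Q) := by gcongr
    have h5 : (Wf l x - 1/2) / x ≤ 2 * (lam / x ^ 3 * y ^ 2 + x / Q) := by
      have : Nf l x * ((Wf l x - 1/2) / x) ≤ Nf l x * (2 * (lam / x ^ 3 * y ^ 2 + x / Q)) := by linarith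
      exact le_of_mul_le_mul_left this hN
    rw [div_le_iff₀ hx] at h5
    refine h5.trans (le_of_eq ?_)
    field_simp

end Bub

open Complex
namespace Bub
open Polynomial

lemma s_bound {l : ℕ} {x g : ℝ} (hl : 2 ≤ l) (hx : 0 < x) (hxν : x ≤ nu l) (hg : 1 ≤ g) (hW : Wf l x ≤ g) :
    nu l ^ 2 - x ^ 2 ≤ 4 * g ^ 2 * nu l := by
  have hν := nu_ge hl
  by_contra hc
  push Not at hc
  have h4 : 4 * g ^ 2 ≤ nu l ^ 2 - x ^ 2 := by nlinarith only [hc, hν, sq_nonneg g]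
  set S := nu l ^ 2 - x ^ 2 with hS
  set x' := Real.sqrt ((x ^ 2 + nu l ^ 2) / 2) with hx'
  have hsq : x' ^ 2 = (x ^ 2 + nu l ^ 2) / 2 := Real.sq_sqrt (by positivity)
  have hxx' : x ≤ x' := by
    apply Real.le_sqrt_of_sq_le; nlinarith only [hxν, hx]
  have hx'ν : x' ≤ nu l := by
    apply Real.sqrt_le_iff.2; constructor
    · linarith
    · nlinarith only [hxν, hx]
  have key := le_of_deriv (f := fun r => - Wf l r - S / (4 * nu l) * r)
    (f' := fun r => - ((Wf l r ^ 2 - wf l r ^ 2 - (nu l ^ 2 - r ^ 2)) / r) - S / (4 * nu l) * 1) hxx'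
    (fun t ht => (Wf_hasDeriv l (hx.trans_le ht.1)).neg.sub ((hasDerivAt_id t).const_mul _))
    (fun t ht => by
      have ht0 : 0 < t := hx.trans_le ht.1
      have h1 : Wf l t ≤ g := (Wf_anti l hx ht0 ht.1).trans hW
      have h2 := Wf_ge l t
      have h3 : Wf l t ^ 2 ≤ g ^ 2 := pow_le_pow_left₀ (by linarith) h1 2
      have h5 : t ^ 2 ≤ x' ^ 2 := pow_le_pow_left₀ ht0.le ht.2 2
      have h6 : S / 4 ≤ -(Wf l t ^ 2 - wf l t ^ 2 - (nu l ^ 2 - t ^ 2)) := by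
        nlinarith only [h3, h5, hsq, hS, h4, sq_nonneg (wf l t)]
      have h7 : S / 4 / nu l ≤ -(Wf l t ^ 2 - wf l t ^ 2 - (nu l ^ 2 - t ^ 2)) / t := by
        have hS0 : 0 ≤ S := by nlinarith only [h4, sq_nonneg g]
        apply div_le_div₀ (by linarith) h6 ht0 (ht.2.trans hx'ν)
      have e : S / (4 * nu l) = S / 4 / nu l := by field_simp
      rw [e, mul_one, ← neg_div]; linarith)
  have hWx' := Wf_ge l x'
  have h8 : S / (4 * nu l) * (x' - x) ≤ g := by
    have : S / (4 * nu l) * (x' - x) = S / (4 * nu l) * x' - S / (4 * nu l) * x := by ring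
    linarith only [this, key, hWx', hW]
  have h9 : S / (4 * nu l) ≤ x' - x := by
    rw [div_le_iff₀ (by linarith)]
    nlinarith only [hsq, hS, hxx', hx'ν, hxν]
  have h10 : g ^ 2 < S / (4 * nu l) := by rw [lt_div_iff₀ (by linarith)]; linarith
  have h11 : g ≤ g ^ 2 := by nlinarith only [hg]
  have h12 : g < S / (4 * nu l) := by linarith
  have h13 : S / (4 * nu l) * 1 ≤ S / (4 * nu l) * (x' - x) :=
    mul_le_mul_of_nonneg_left (by linarith) (by linarith)
  linarith

set_option maxHeartbeats 1000000 in
lemma caseC (β : ℝ) (hβ : 0 < β) : ∃ ζ2, 1/2 ≤ ζ2 ∧ ζ2 < 1 ∧ ∃ ε₀ > 0, ε₀ ≤ 1/2 ∧ ∀ ε : ℝ, 0 < ε → ε ≤ ε₀ →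
    ∀ l : ℕ, 2 ≤ l → ∀ x y : ℝ, ζ2 * nu l ≤ x → 0 < y → IsRt l (Qf l ε) ((x:ℂ) - y * I) →
      Real.exp (-β / ε ^ 2) ≤ y := by
  obtain ⟨e1, he1, he1', H1⟩ := exp_beats 200 β hβ 2
  obtain ⟨e2, he2, he2', H2⟩ := exp_beats 1624 (β/2) (by linarith) 4
  refine ⟨max (1/2) (Real.exp (-(β/20))), le_max_left _ _, max_lt (by norm_num) (by
    rw [Real.exp_lt_one_iff]; linarith), min (1/2) (min e1 e2), by positivity, min_le_left _ _, ?_⟩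
  intro ε hε hεle l hl x y hxge hy0 h
  set ζ2 := max (1/2) (Real.exp (-(β/20))) with hζ2
  have hζ20 : 1/2 ≤ ζ2 := le_max_left _ _
  have hzeta_c : Real.exp (-(β/20)) ≤ ζ2 := le_max_right _ _
  have hε2 : ε ≤ 1/2 := hεle.trans (min_le_left _ _)
  have hεe1 : ε ≤ e1 := hεle.trans ((min_le_right _ _).trans (min_le_left _ _))
  have hεe2 : ε ≤ e2 := hεle.trans ((min_le_right _ _).trans (min_le_right _ _))
  by_contra hc
  push Not at hc
  have hexp : Real.exp (-β / ε ^ 2) = (Real.exp (β / ε ^ 2))⁻¹ := by rw [← Real.exp_neg]; ring_nf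
  have hy : y ≤ ε ^ 2 / 200 := by
    have h1 := H1 ε hε hεe1
    rw [hexp] at hc
    refine hc.le.trans ?_
    rw [inv_le_comm₀ (Real.exp_pos _) (by positivity), inv_div]
    exact h1
  have hQ := Qf_pos hl hε
  obtain ⟨q1, q2, q3, q4⟩ := Qpos_aux hl hε
  change _ ≤ Qf l ε at q1 q2
  have hν := nu_ge hl
  have hν0 := nu_pos l
  have hxν2 : nu l / 2 ≤ x := by nlinarith only [hxge, hζ20, hν0]
  have hx : 0 < x := by linarith
  have hεsq : ε ^ 2 ≤ 1/4 := by nlinarith only [hε2, hε]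
  have hεsq0 : 0 < ε ^ 2 := by positivity
  have hy1 : y ≤ 1/800 := by linarith
  have ha : 1 / x ^ 2 + 1 / Qf l ε ≤ 3 / (nu l ^ 2 * ε ^ 2) := by
    have h1 : 1 / x ^ 2 ≤ 1 / (nu l ^ 2 * ε ^ 2) := by
      apply one_div_le_one_div_of_le (by positivity)
      have : (nu l / 2) ^ 2 ≤ x ^ 2 := pow_le_pow_left₀ (by positivity) hxν2 2
      nlinarith only [this, hεsq, sq_nonneg (nu l)]
    have h2 : 1 / Qf l ε ≤ 1 / ((16/25) * nu l ^ 2 * ε ^ 2) := one_div_le_one_div_of_le (by positivity) q2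
    have h3 : 1 / ((16/25) * nu l ^ 2 * ε ^ 2) = (25/16) * (1 / (nu l ^ 2 * ε ^ 2)) := by field_simp
    have h4 : 3 / (nu l ^ 2 * ε ^ 2) = 3 * (1 / (nu l ^ 2 * ε ^ 2)) := by ring
    have h5 : 0 < 1 / (nu l ^ 2 * ε ^ 2) := by positivity
    linarith
  have hν2 : 25/4 ≤ nu l ^ 2 := by nlinarith only [hν]
  have hy2a : y ^ 2 * (3 / (nu l ^ 2 * ε ^ 2)) ≤ 1/8 := by
    rw [← mul_div_assoc, div_le_iff₀ (by positivity)]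
    have h1 : y ^ 2 ≤ (ε ^ 2 / 200) * (1/800) := by nlinarith only [hy, hy1, hy0]
    nlinarith only [h1, hν2, hεsq0]
  have hlam : (l:ℝ) * (l+1) = nu l ^ 2 - 1/4 := by unfold nu; ring
  have hl1 : (l:ℝ) + 1 ≤ 2 * nu l := by unfold nu; have : (0:ℝ) ≤ l := by positivity
                                        linarith
  have hNpos := Nf_pos l x
  by_cases hxn : nu l ≤ x
  · have hx2 : nu l ^ 2 ≤ x ^ 2 := pow_le_pow_left₀ hν0.le hxn 2
    obtain ⟨s1, -⟩ := sturm (D := 0) hQ hx hy0 h le_rfl (by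
      rw [hlam, sub_nonpos, div_le_one (by positivity)]; linarith) (by
      rw [add_zero]
      have := mul_le_mul_of_nonneg_left ha (sq_nonneg y)
      linarith)
    rw [add_zero] at s1
    have hN := Nf_le_of_nu_le l hxn
    have h1 : 2 * Nf l x * y * (1 / x ^ 2 + 1 / Qf l ε) ≤ 2 * (2 * nu l) * y * (3 / (nu l ^ 2 * ε ^ 2)) := by
      have : 0 ≤ 1 / x ^ 2 + 1 / Qf l ε := by positivity
      gcongr; linarith
    have h2 : 2 * (2 * nu l) * y * (3 / (nu l ^ 2 * ε ^ 2)) = 12 * y / (nu l * ε ^ 2) := by field_simp; ring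
    rw [h2] at h1
    have h3 := s1.trans h1
    rw [le_div_iff₀ (by positivity)] at h3
    nlinarith only [h3, hy, hν, hεsq0]
  · push Not at hxn
    have hx2 : x ^ 2 ≤ nu l ^ 2 := pow_le_pow_left₀ hx.le hxn.le 2
    have hx2' : nu l ^ 2 / 4 ≤ x ^ 2 := by
      have : (nu l / 2) ^ 2 ≤ x ^ 2 := pow_le_pow_left₀ (by positivity) hxν2 2
      linarith
    have hD4 : (nu l ^ 2 - x ^ 2) / x ^ 2 ≤ 4 * (nu l ^ 2 - x ^ 2) / nu l ^ 2 := by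
      rw [div_le_div_iff₀ (by positivity) (by positivity)]
      nlinarith only [hx2, hx2']
    have hD44 : 4 * (nu l ^ 2 - x ^ 2) / nu l ^ 2 ≤ 4 := by
      rw [div_le_iff₀ (by positivity)]; nlinarith only [hx]
    obtain ⟨s1, s2⟩ := sturm (D := (nu l ^ 2 - x ^ 2) / x ^ 2) hQ hx hy0 h
      (div_nonneg (by linarith) (by positivity)) (by
        rw [hlam, sub_div, sub_div, div_self (by positivity)]
        have : 0 ≤ 1/4 / x ^ 2 := by positivity
        linarith) (by
        have h1 := mul_le_mul_of_nonneg_left ha (sq_nonneg y)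
        have h2 := mul_le_mul_of_nonneg_left (hD4.trans hD44) (sq_nonneg y)
        have h3 : y ^ 2 * 4 ≤ 1/8 := by nlinarith only [hy1, hy0]
        rw [mul_add]
        linarith)
    have hWg : Wf l x ≤ 5 / ε ^ 2 := by
      have h1 : (l:ℝ) * (l+1) * y ^ 2 / x ^ 2 ≤ 4 * y ^ 2 := by
        rw [div_le_iff₀ (by positivity), hlam]
        nlinarith only [hx2', sq_nonneg y]
      have h2 : x ^ 2 / Qf l ε ≤ (25/16) / ε ^ 2 := by
        rw [div_le_div_iff₀ hQ hεsq0]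
        nlinarith only [q2, hx2, hεsq0]
      have h3 : 4 ≤ 1 / ε ^ 2 := by rw [le_div_iff₀ hεsq0]; linarith
      have h4 : (25/16) / ε ^ 2 = (25/16) * (1 / ε ^ 2) := by ring
      have h5 : 5 / ε ^ 2 = 5 * (1 / ε ^ 2) := by ring
      have h6 : y ^ 2 ≤ 1 := by nlinarith only [hy1, hy0]
      nlinarith only [h1, h2, h3, h4, h5, s2, hy1, hy0]
    have hg1 : 1 ≤ 5 / ε ^ 2 := by rw [le_div_iff₀ hεsq0]; linarith
    have hs := s_bound hl hx hxn.le hg1 hWg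
    have hN := Nf_le_rpow l hx hxn.le
    have hpow : (nu l / x) ^ (2 * Wf l x) ≤ Real.exp (β / 2 / ε ^ 2) := by
      have hb : nu l / x ≤ Real.exp (β/20) := by
        rw [div_le_iff₀ hx]
        have h1 : Real.exp (-(β/20)) * nu l ≤ x := le_trans (by gcongr) hxge
        rw [Real.exp_neg] at h1
        have := Real.exp_pos (β/20)
        rwa [inv_mul_le_iff₀ this] at h1
      have hW0 := Wf_ge l x
      calc (nu l / x) ^ (2 * Wf l x) ≤ (Real.exp (β/20)) ^ (2 * Wf l x) :=
            Real.rpow_le_rpow (by positivity) hb (by linarith)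
        _ = Real.exp (β/20 * (2 * Wf l x)) := by rw [← Real.exp_mul]
        _ ≤ Real.exp (β / 2 / ε ^ 2) := by
          apply Real.exp_le_exp.2
          have : β / 20 * (2 * Wf l x) ≤ β / 20 * (2 * (5 / ε ^ 2)) := by gcongr
          refine this.trans (le_of_eq ?_)
          field_simp; norm_num
    set E := Real.exp (β / 2 / ε ^ 2) with hE
    have hEpos : 0 < E := Real.exp_pos _
    have hN2 : Nf l x ≤ 2 * nu l * E := hN.trans (mul_le_mul hl1 hpow (by positivity) (by positivity))
    have hfac : 1 / x ^ 2 + 1 / Qf l ε + (nu l ^ 2 - x ^ 2) / x ^ 2 ≤ (406 / ε ^ 4) / nu l := by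
      have h1 : 3 / (nu l ^ 2 * ε ^ 2) ≤ (6 / ε ^ 4) / nu l := by
        rw [div_div, div_le_div_iff₀ (by positivity) (by positivity)]
        have : 3 * (ε ^ 4 * nu l) = (nu l * ε ^ 2) * (3 * ε ^ 2) := by ring
        have h' : 6 * (nu l ^ 2 * ε ^ 2) = (nu l * ε ^ 2) * (6 * nu l) := by ring
        rw [this, h']
        apply mul_le_mul_of_nonneg_left _ (by positivity)
        linarith
      have h2 : 4 * (nu l ^ 2 - x ^ 2) / nu l ^ 2 ≤ 4 * (4 * (5 / ε ^ 2) ^ 2 * nu l) / nu l ^ 2 := by gcongr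
      have h3 : 4 * (4 * (5 / ε ^ 2) ^ 2 * nu l) / nu l ^ 2 = (400 / ε ^ 4) / nu l := by field_simp; norm_num
      have h4 : (406 / ε ^ 4) / nu l = (6 / ε ^ 4) / nu l + (400 / ε ^ 4) / nu l := by ring
      linarith
    have hf0 : 0 ≤ 1 / x ^ 2 + 1 / Qf l ε + (nu l ^ 2 - x ^ 2) / x ^ 2 := by
      have : 0 ≤ (nu l ^ 2 - x ^ 2) / x ^ 2 := div_nonneg (by linarith) (by positivity)
      positivity
    have hfin : 1 ≤ 2 * (2 * nu l * E) * y * ((406 / ε ^ 4) / nu l) := by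
      refine s1.trans ?_
      gcongr
    have h6 : 2 * (2 * nu l * E) * y * ((406 / ε ^ 4) / nu l) = y * E * (1624 / ε ^ 4) := by field_simp; norm_num
    have h2 := H2 ε hε hεe2
    have h7 : y * E * (1624 / ε ^ 4) ≤ y * E * E := by gcongr
    have hEE : Real.exp (β / ε ^ 2) = E * E := by
      rw [hE, ← Real.exp_add]; ring_nf
    rw [hexp, hEE] at hc
    have h8 : y * (E * E) < 1 := by
      calc y * (E * E) < (E*E)⁻¹ * (E * E) := by gcongr
        _ = 1 := inv_mul_cancel₀ (by positivity)
    have h9 : y * E * E = y * (E * E) := by ring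
    linarith
end Bub

open Complex
namespace Bub
open Polynomial

noncomputable def sf (l : ℕ) (x : ℝ) : ℝ := Real.sqrt (nu l ^ 2 - x ^ 2)
noncomputable def Af (l : ℕ) (x : ℝ) : ℝ := sf l x - x ^ 2 / (2 * sf l x ^ 2)
noncomputable def kap (l : ℕ) (x : ℝ) : ℝ := x ^ 2 / sf l x ^ 2 + (5/4) * (x ^ 4 / sf l x ^ 4)

lemma sf_sq {l : ℕ} {x : ℝ} (hx : 0 ≤ x) (hxν : x ≤ nu l) : sf l x ^ 2 = nu l ^ 2 - x ^ 2 :=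
  Real.sq_sqrt (by nlinarith)

lemma sf_pos {l : ℕ} {x : ℝ} (hx : 0 ≤ x) (hxν : x < nu l) : 0 < sf l x :=
  Real.sqrt_pos.2 (by nlinarith)

lemma sf_le {l : ℕ} (x : ℝ) : sf l x ≤ nu l := by
  unfold sf; rw [Real.sqrt_le_left (nu_pos l).le]; nlinarith [sq_nonneg x]

lemma sf_hasDeriv {l : ℕ} {x : ℝ} (hx : 0 ≤ x) (hxν : x < nu l) :
    HasDerivAt (sf l) (- x / sf l x) x := by
  have h0 : nu l ^ 2 - x ^ 2 ≠ 0 := by nlinarith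
  have h := (((hasDerivAt_id x).pow 2).const_sub (nu l ^ 2)).sqrt h0
  refine HasDerivAt.congr_deriv h ?_
  have := (sf_pos hx hxν).ne'
  unfold sf at this ⊢
  simp
  field_simp

lemma Af_hasDeriv {l : ℕ} {x : ℝ} (hx : 0 < x) (hxν : x < nu l) :
    HasDerivAt (Af l) ((Af l x ^ 2 - sf l x ^ 2 - kap l x) / x) x := by
  have hs := sf_hasDeriv hx.le hxν
  have hs0 := (sf_pos hx.le hxν).ne'
  have h := hs.sub (((hasDerivAt_id x).pow 2).div ((hs.pow 2).const_mul 2) (show 2 * sf l x ^ 2 ≠ 0 by positivity))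
  refine HasDerivAt.congr_deriv h ?_
  unfold Af kap
  simp
  field_simp
  ring

lemma pow4_exp (a : ℝ) (ha : 0 < a) : ∃ C > 0, ∀ v : ℝ, 0 ≤ v → v ^ 4 * Real.exp (-(a * v)) ≤ C := by
  refine ⟨24 / a ^ 4, by positivity, fun v hv => ?_⟩
  have h := Real.pow_div_factorial_le_exp (a * v) (by positivity) 4
  rw [Real.exp_neg, mul_inv_le_iff₀ (Real.exp_pos _)]
  have e : ((Nat.factorial 4 : ℕ) : ℝ) = 24 := by norm_num [Nat.factorial]
  rw [e] at h
  calc v ^ 4 = 24 / a ^ 4 * ((a * v) ^ 4 / 24) := by field_simp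
    _ ≤ _ := by gcongr

set_option maxHeartbeats 1000000 in
lemma Y_step {l : ℕ} {K p x x1 : ℝ} (hx : 0 < x) (hxx : x ≤ x1) (hx1 : x1 < nu l)
    (hp : 8 ≤ p)
    (hA : ∀ t, x ≤ t → t ≤ x1 → p ≤ Af l t) (hκ : ∀ t, x ≤ t → t ≤ x1 → kap l t ≤ K * t ^ 2) (hA1 : Af l x1 ≤ nu l) :
    (Wf l x - Af l x) ^ 2 + wf l x ^ 2 ≤ 2 * K ^ 2 / p ^ 2 * x ^ 4 + (2 * nu l ^ 2) * Real.exp (-(p * (Real.log x1 - Real.log x))) := by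
  set Y : ℝ → ℝ := fun t => (Wf l t - Af l t) ^ 2 + wf l t ^ 2 with hY
  set β := 2 * K ^ 2 / p ^ 2 with hβ
  have hβ0 : 0 ≤ β := by positivity
  have hd : ∀ t ∈ Set.Icc x x1, HasDerivAt Y ((2 * (Wf l t + Af l t) * Y t + 2 * (Wf l t - Af l t) * kap l t) / t) t := by
    intro t ht
    have ht0 : 0 < t := hx.trans_le ht.1
    have htν : t < nu l := ht.2.trans_lt hx1
    have h := (((Wf_hasDeriv l ht0).sub (Af_hasDeriv ht0 htν)).pow 2).add ((wf_hasDeriv l ht0).pow 2)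
    refine HasDerivAt.congr_deriv h ?_
    have hs := sf_sq ht0.le htν.le
    simp only [hY]
    rw [← hs]
    simp
    field_simp
    ring
  have hd2 : ∀ t ∈ Set.Icc x x1, HasDerivAt (fun t => (Y t - β * t ^ 4) * Real.exp (-(p * Real.log t)))
      ((((2 * (Wf l t + Af l t) * Y t + 2 * (Wf l t - Af l t) * kap l t)) - 4 * β * t ^ 4 - p * (Y t - β * t ^ 4)) / t * Real.exp (-(p * Real.log t))) t := by
    intro t ht
    have ht0 : 0 < t := hx.trans_le ht.1
    have h1 := (hd t ht).sub (((hasDerivAt_id t).pow 4).const_mul β)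
    have h2 := (((Real.hasDerivAt_log ht0.ne').const_mul p).neg).exp
    refine HasDerivAt.congr_deriv (h1.mul h2) ?_
    simp
    field_simp
    ring
  have key := le_of_deriv hxx hd2 (by
    intro t ht
    have ht0 : 0 < t := hx.trans_le ht.1
    apply mul_nonneg _ (Real.exp_pos _).le
    apply div_nonneg _ ht0.le
    have hW := Wf_ge l t
    have hAt := hA t ht.1 ht.2
    have hκt := hκ t ht.1 ht.2
    have hκ0 : 0 ≤ kap l t := by unfold kap; positivity
    have hY0 : 0 ≤ Y t := by simp only [hY]; positivity
    have hYE : (Wf l t - Af l t) ^ 2 ≤ Y t := by simp only [hY]; nlinarith only [sq_nonneg (wf l t)]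
    have h1 : 2 * p * Y t ≤ 2 * (Wf l t + Af l t) * Y t := by
      apply mul_le_mul_of_nonneg_right _ hY0; linarith
    set E := Wf l t - Af l t with hE
    have h2 : -(p * E ^ 2) - kap l t ^ 2 / p ≤ 2 * E * kap l t := by
      have : 0 ≤ (p * E + kap l t) ^ 2 / p := by positivity
      have e : (p * E + kap l t) ^ 2 / p = p * E ^ 2 + 2 * E * kap l t + kap l t ^ 2 / p := by field_simp; ring
      linarith
    have h3 : p * E ^ 2 ≤ p * Y t := by gcongr
    have h4 : kap l t ^ 2 / p ≤ (K * t ^ 2) ^ 2 / p := by gcongr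
    have h5 : (K * t ^ 2) ^ 2 / p = β * t ^ 4 * (p / 2) := by rw [hβ]; field_simp
    have h6 : 0 ≤ β * t ^ 4 * (p / 2 - 4) := by
      have : 0 ≤ p / 2 - 4 := by linarith
      positivity
    nlinarith only [h1, h2, h3, h4, h5, h6])
  have hA1' := hA x1 hxx le_rfl
  have hx10 : 0 < x1 := hx.trans_le hxx
  have hY1 : Y x1 - β * x1 ^ 4 ≤ 2 * nu l ^ 2 := by
    have h1 := Wf_le l x1
    have h2 := Wf_ge l x1
    have h3 := wf_le l hx10
    have h4 := wf_pos l hx10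
    have h5 : 0 ≤ β * x1 ^ 4 := by positivity
    have h6 : wf l x1 ^ 2 ≤ nu l ^ 2 := pow_le_pow_left₀ h4.le (by linarith) 2
    have h7 : (Wf l x1 - Af l x1) ^ 2 ≤ nu l ^ 2 := sq_le_sq' (by linarith) (by linarith)
    simp only [hY]; linarith
  have h9 : (Y x - β * x ^ 4) ≤ 2 * nu l ^ 2 * Real.exp (-(p * (Real.log x1 - Real.log x))) := by
    have h1 := Real.exp_pos (-(p * Real.log x))
    have h2 : (Y x - β * x ^ 4) * Real.exp (-(p * Real.log x)) ≤ 2 * nu l ^ 2 * Real.exp (-(p * Real.log x1)) :=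
      key.trans (mul_le_mul_of_nonneg_right hY1 (Real.exp_pos _).le)
    have e : Real.exp (-(p * Real.log x1)) = Real.exp (-(p * (Real.log x1 - Real.log x))) * Real.exp (-(p * Real.log x)) := by
      rw [← Real.exp_add]; ring_nf
    rw [e, ← mul_assoc] at h2
    exact le_of_mul_le_mul_right h2 h1
  have : Y x = (Wf l x - Af l x) ^ 2 + wf l x ^ 2 := rfl
  linarith

set_option maxHeartbeats 1000000 in
lemma asym (ζ2 : ℝ) (h0 : 0 < ζ2) (h1 : ζ2 < 1) : ∃ C > 0, ∃ n0 > 0, ∀ l : ℕ, n0 ≤ nu l → ∀ x : ℝ, 0 < x → x ≤ ζ2 * nu l →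
    |Wf l x - Af l x| ≤ C * x ^ 2 / nu l ^ 3 ∧ wf l x ≤ C * x ^ 2 / nu l ^ 3 := by
  set ζ3 := (1 + ζ2) / 2 with hζ3
  have h3 : ζ3 < 1 := by linarith
  have h23 : ζ2 < ζ3 := by linarith
  have h30 : 0 < ζ3 := by linarith
  set c := Real.sqrt (1 - ζ3 ^ 2) with hc
  have hc0 : 0 < c := Real.sqrt_pos.2 (by nlinarith)
  have hcsq : c ^ 2 = 1 - ζ3 ^ 2 := Real.sq_sqrt (by nlinarith)
  set a := (c / 2) * Real.log (ζ3 / ζ2) with ha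
  have hlog : 0 < Real.log (ζ3 / ζ2) := Real.log_pos (by rw [lt_div_iff₀ h0]; linarith)
  have ha0 : 0 < a := by positivity
  obtain ⟨C1, hC1, H1⟩ := pow4_exp a ha0
  set K := (1 / c ^ 2) * (1 + 5 / (4 * c ^ 2)) with hK
  have hK0 : 0 < K := by positivity
  set C2 := 2 * K ^ 2 / (c/2) ^ 2 + 2 * C1 * Real.exp (4 * Real.log (ζ3 / ζ2)) / ζ2 ^ 4 with hC2
  have hC20 : 0 < C2 := by positivity
  refine ⟨Real.sqrt C2, Real.sqrt_pos.2 hC20, max (16 / c) (1 / c ^ 3), by positivity, ?_⟩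
  intro l hl x hx hxle
  set ν := nu l with hν
  have hν0 : 0 < ν := nu_pos l
  have hν1 : 16 / c ≤ ν := (le_max_left _ _).trans hl
  have hν2 : 1 / c ^ 3 ≤ ν := (le_max_right _ _).trans hl
  set x1 := ζ3 * ν with hx1
  have hx1ν : x1 < ν := by nlinarith
  have hxx1 : x ≤ x1 := by nlinarith
  have hs : ∀ t, x ≤ t → t ≤ x1 → c * ν ≤ sf l t := by
    intro t ht ht1
    have ht0 : 0 < t := hx.trans_le ht
    apply Real.le_sqrt_of_sq_le
    have : t ^ 2 ≤ x1 ^ 2 := pow_le_pow_left₀ ht0.le ht1 2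
    rw [mul_pow, hcsq]
    rw [hx1, mul_pow] at this
    linarith
  have hp : 8 ≤ c / 2 * ν := by
    rw [div_le_iff₀ hc0] at hν1; linarith
  have key := Y_step (l := l) (K := K / ν ^ 2) (p := c / 2 * ν) hx hxx1 hx1ν hp (by
    intro t ht ht1
    have h1 := hs t ht ht1
    have ht0 : 0 < t := hx.trans_le ht
    have htν : t ≤ ν := by linarith
    unfold Af
    have h2 : t ^ 2 / (2 * sf l t ^ 2) ≤ ν ^ 2 / (2 * (c * ν) ^ 2) := by gcongr
    have h3 : ν ^ 2 / (2 * (c * ν) ^ 2) = 1 / (2 * c ^ 2) := by field_simp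
    have h4 : 1 / (2 * c ^ 2) ≤ c / 2 * ν := by
      rw [div_le_iff₀ (by positivity)] at hν2 ⊢
      linarith
    linarith) (by
    intro t ht ht1
    have h1 := hs t ht ht1
    have ht0 : 0 < t := hx.trans_le ht
    have htν : t ≤ ν := by linarith
    unfold kap
    have h2 : t ^ 2 / sf l t ^ 2 ≤ t ^ 2 / (c * ν) ^ 2 := by gcongr
    have h3 : t ^ 4 / sf l t ^ 4 ≤ t ^ 2 * ν ^ 2 / (c * ν) ^ 4 := by
      rw [show t ^ 4 = t ^ 2 * t ^ 2 by ring]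
      gcongr
    have e : K / ν ^ 2 * t ^ 2 = t ^ 2 / (c * ν) ^ 2 + (5/4) * (t ^ 2 * ν ^ 2 / (c * ν) ^ 4) := by
      rw [hK]; field_simp
    rw [e]; linarith) (by
    unfold Af
    have := sf_le (l := l) x1
    have h : 0 ≤ x1 ^ 2 / (2 * sf l x1 ^ 2) := by positivity
    linarith)
  have hE : Real.exp (-(c / 2 * ν * (Real.log x1 - Real.log x)))
      ≤ (x / (ζ2 * ν)) ^ 4 * (Real.exp (4 * Real.log (ζ3 / ζ2)) * Real.exp (-(a * ν))) := by
    have e1 : (x / (ζ2 * ν)) ^ 4 = Real.exp (4 * Real.log (x / (ζ2 * ν))) := by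
      rw [show (4:ℝ) * Real.log (x / (ζ2 * ν)) = ((4:ℕ):ℝ) * Real.log (x / (ζ2 * ν)) by norm_num, Real.exp_nat_mul, Real.exp_log (by positivity)]
    rw [e1, ← Real.exp_add, ← Real.exp_add]
    apply Real.exp_le_exp.2
    have e2 : Real.log x1 - Real.log x = Real.log (ζ3 / ζ2) - Real.log (x / (ζ2 * ν)) := by
      rw [hx1, Real.log_div h30.ne' h0.ne', Real.log_div hx.ne' (by positivity), Real.log_mul h30.ne' hν0.ne', Real.log_mul h0.ne' hν0.ne']; ring
    rw [e2, ha]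
    have h5 : Real.log (x / (ζ2 * ν)) ≤ 0 := Real.log_nonpos (by positivity) (by rw [div_le_one (by positivity)]; exact hxle)
    nlinarith only [hp, h5, hlog]
  have h6 := H1 ν hν0.le
  have hY : (Wf l x - Af l x) ^ 2 + wf l x ^ 2 ≤ C2 * x ^ 4 / ν ^ 6 := by
    refine key.trans ?_
    have e1 : 2 * (K / ν ^ 2) ^ 2 / (c / 2 * ν) ^ 2 * x ^ 4 = (2 * K ^ 2 / (c/2) ^ 2) * x ^ 4 / ν ^ 6 := by field_simp
    set G := Real.exp (4 * Real.log (ζ3 / ζ2)) with hG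
    have hG0 : 0 < G := Real.exp_pos _
    have e2 : 2 * ν ^ 2 * Real.exp (-(c / 2 * ν * (Real.log x1 - Real.log x))) ≤ (2 * C1 * G / ζ2 ^ 4) * x ^ 4 / ν ^ 6 := by
      calc _ ≤ 2 * ν ^ 2 * ((x / (ζ2 * ν)) ^ 4 * (G * Real.exp (-(a * ν)))) := by gcongr
        _ = (2 * (ν ^ 4 * Real.exp (-(a * ν))) * G / ζ2 ^ 4) * x ^ 4 / ν ^ 6 := by field_simp
        _ ≤ _ := by gcongr
    rw [e1]
    have e3 : C2 * x ^ 4 / ν ^ 6 = (2 * K ^ 2 / (c/2) ^ 2) * x ^ 4 / ν ^ 6 + (2 * C1 * G / ζ2 ^ 4) * x ^ 4 / ν ^ 6 := by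
      rw [hC2]; ring
    linarith
  have eS : C2 * x ^ 4 / ν ^ 6 = (Real.sqrt C2 * x ^ 2 / ν ^ 3) ^ 2 := by
    rw [div_pow, mul_pow, Real.sq_sqrt hC20.le]; ring_nf
  rw [eS] at hY
  have hpos : 0 ≤ Real.sqrt C2 * x ^ 2 / ν ^ 3 := by positivity
  constructor
  · apply abs_le_of_sq_le_sq _ hpos
    nlinarith only [hY, sq_nonneg (wf l x)]
  · apply le_of_abs_le
    apply abs_le_of_sq_le_sq _ hpos
    nlinarith only [hY, sq_nonneg (Wf l x - Af l x)]
end Bub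

open Complex
namespace Bub
open Polynomial

lemma prod_even_odd (l : ℕ) : (∏ j ∈ Finset.range (2*l), ((j:ℝ)+1)) = (∏ j ∈ Finset.range l, (2*(j:ℝ)+1)) * (∏ j ∈ Finset.range l, (2*((j:ℝ)+1))) := by
  induction l with
  | zero => simp
  | succ l ih =>
    rw [show 2*(l+1) = 2*l+1+1 by ring, Finset.prod_range_succ, Finset.prod_range_succ, ih, Finset.prod_range_succ, Finset.prod_range_succ]
    push_cast; ring

lemma nc_diag (l : ℕ) : nc l l = (∏ j ∈ Finset.range l, (2*(j:ℝ)+1)) ^ 2 := by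
  have h1 : (∏ j ∈ Finset.range l, ((l:ℝ)-j)) = ∏ j ∈ Finset.range l, ((j:ℝ)+1) := by
    rw [← Finset.prod_range_reflect]
    apply Finset.prod_congr rfl
    intro j hj
    have : j < l := by simpa using hj
    rw [Nat.sub_sub, Nat.cast_sub (by omega)]; push_cast; ring
  have h2 : (∏ j ∈ Finset.range (2*l), ((j:ℝ)+1)) = (∏ j ∈ Finset.range l, ((j:ℝ)+1)) * ∏ j ∈ Finset.range l, ((l:ℝ)+j+1) := by
    rw [two_mul, Finset.prod_range_add]; push_cast; rfl
  rw [prod_even_odd] at h2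
  have h3 : nc l l = (∏ j ∈ Finset.range l, (2*(j:ℝ)+1)) * (∏ j ∈ Finset.range l, ((l:ℝ)-j)) * (∏ j ∈ Finset.range l, ((l:ℝ)+j+1)) / (∏ j ∈ Finset.range l, (2*((j:ℝ)+1))) := by
    rw [← Finset.prod_mul_distrib, ← Finset.prod_mul_distrib, ← Finset.prod_div_distrib]
    unfold nc
    apply Finset.prod_congr rfl
    intro j _; ring
  have h4 : 0 < ∏ j ∈ Finset.range l, (2*((j:ℝ)+1)) := Finset.prod_pos (fun j _ => by positivity)
  rw [h3, h1, mul_assoc, ← h2]; field_simp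

noncomputable def dl (l : ℕ) : ℝ := 2 * nu l * Real.log (2 * nu l) - 2 * nu l - Real.log (nu l) - Real.log (nc l l)

lemma log_upper {u : ℝ} (hu : 0 ≤ u) : Real.log (1 + u) ≤ u - u ^ 2 / 2 + u ^ 3 / 3 := by
  have := le_of_deriv (f := fun u => u - u ^ 2 / 2 + u ^ 3 / 3 - Real.log (1 + u)) (f' := fun u => 1 - u + u ^ 2 - 1 / (1 + u)) hu
    (fun t ht => by
      have h : (1:ℝ) + t ≠ 0 := by linarith [ht.1]
      have h1 := (((hasDerivAt_id t).sub (((hasDerivAt_id t).pow 2).div_const 2)).add (((hasDerivAt_id t).pow 3).div_const 3)).sub (((hasDerivAt_id t).const_add 1).log h)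
      refine HasDerivAt.congr_deriv h1 ?_
      simp)
    (fun t ht => by
      have h : 0 < (1:ℝ) + t := by linarith [ht.1]
      have e : 1 - t + t ^ 2 - 1 / (1 + t) = t ^ 3 / (1 + t) := by field_simp; ring
      rw [e]; have := ht.1; positivity)
  simp at this
  linarith

lemma nu_succ (l : ℕ) : nu (l+1) = nu l + 1 := by unfold nu; push_cast; ring

lemma dl_step (l : ℕ) : dl (l+1) - dl l = (2 * nu l + 1) * Real.log (1 + 1 / nu l) - 2 := by
  have h0 := nu_pos l
  have h1 : nc (l+1) (l+1) = nc l l * (2 * nu l) ^ 2 := by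
    rw [nc_diag, nc_diag, Finset.prod_range_succ, mul_pow]; unfold nu; ring_nf
  have h2 := nc_pos l l le_rfl
  unfold dl
  rw [h1, nu_succ, Real.log_mul h2.ne' (by positivity), Real.log_pow, show 1 + 1 / nu l = (nu l + 1) / nu l by field_simp,
    Real.log_div (by positivity) h0.ne', Real.log_mul (by norm_num) (by positivity), Real.log_mul (by norm_num) (by positivity)]
  push_cast; ring

lemma dl_mono (l : ℕ) : dl l ≤ dl (l+1) := by
  have h := dl_step l
  have h0 := nu_pos l
  have h1 := Real.le_log_one_add_of_nonneg (x := 1 / nu l) (by positivity)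
  have e : 2 * (1 / nu l) / (1 / nu l + 2) = 2 / (2 * nu l + 1) := by field_simp; ring
  rw [e, div_le_iff₀ (by positivity)] at h1
  linarith

lemma dl_anti (l : ℕ) (hl : 1 ≤ l) : dl (l+1) + 1 / ((l:ℝ)+1) ≤ dl l + 1 / (l:ℝ) := by
  have h := dl_step l
  have h0 := nu_pos l
  have hl0 : (1:ℝ) ≤ l := by exact_mod_cast hl
  have hν : 1 ≤ nu l := by unfold nu; linarith
  have h1 := log_upper (u := 1 / nu l) (by positivity)
  have h2 : (2 * nu l + 1) * Real.log (1 + 1 / nu l) ≤ (2 * nu l + 1) * (1 / nu l - (1 / nu l) ^ 2 / 2 + (1 / nu l) ^ 3 / 3) := by gcongr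
  have h3 : (2 * nu l + 1) * (1 / nu l - (1 / nu l) ^ 2 / 2 + (1 / nu l) ^ 3 / 3) = 2 + (1/6 + (1/3) * (1 / nu l)) * (1 / nu l ^ 2) := by field_simp; ring
  have h4 : 1 / nu l ≤ 1 := by rw [div_le_one h0]; exact hν
  have h5 : (1/6 + (1/3) * (1 / nu l)) * (1 / nu l ^ 2) ≤ 1 * (1 / nu l ^ 2) := by gcongr; linarith
  have h6 : 1 / nu l ^ 2 ≤ 1 / ((l:ℝ) * (l+1)) := by
    apply one_div_le_one_div_of_le (by positivity)
    unfold nu; nlinarith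
  have h7 : 1 / ((l:ℝ) * (l+1)) = 1 / l - 1 / ((l:ℝ)+1) := by field_simp; ring
  linarith

lemma exists_dinf : ∃ d : ℝ, ∀ l : ℕ, 1 ≤ l → dl l ≤ d ∧ d ≤ dl l + 1 / (l:ℝ) := by
  have hm : Monotone dl := monotone_nat_of_le_succ dl_mono
  have ha : ∀ l : ℕ, 1 ≤ l → ∀ k, dl (l + k) + 1 / ((l + k : ℕ):ℝ) ≤ dl l + 1 / (l:ℝ) := by
    intro l hl k
    induction k with
    | zero => simp
    | succ k ih =>
      have := dl_anti (l+k) (by omega)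
      refine le_trans ?_ ih
      rw [← add_assoc]
      push_cast at this ⊢
      exact this
  have hb : ∀ l : ℕ, 1 ≤ l → ∀ m, dl m ≤ dl l + 1 / (l:ℝ) := by
    intro l hl m
    have h1 := hm (show m ≤ l + m by omega)
    have h2 := ha l hl m
    have h3 : 0 ≤ 1 / ((l + m : ℕ):ℝ) := by positivity
    linarith
  refine ⟨sSup (Set.range dl), fun l hl => ⟨?_, ?_⟩⟩
  · exact le_csSup ⟨dl 1 + 1 / ((1:ℕ):ℝ), by rintro _ ⟨m, rfl⟩; exact hb 1 le_rfl m⟩ ⟨l, rfl⟩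
  · apply csSup_le (Set.range_nonempty _)
    rintro _ ⟨m, rfl⟩; exact hb l hl m

noncomputable def dinf : ℝ := Classical.choose exists_dinf
lemma dinf_spec (l : ℕ) (hl : 1 ≤ l) : dl l ≤ dinf ∧ dinf ≤ dl l + 1 / (l:ℝ) := Classical.choose_spec exists_dinf l hl

noncomputable def Ff (l : ℕ) (x : ℝ) : ℝ := ∑ k ∈ Finset.range (l+1), nc l k * x ^ (2*(l-k))

lemma Ff_eq (l : ℕ) {x : ℝ} (hx : 0 < x) : Ff l x = Nf l x * x ^ (2*l) := by
  unfold Ff Nf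
  rw [Mr_eval, Finset.sum_mul]
  apply Finset.sum_congr rfl
  intro k hk
  have hk' : k ≤ l := by simp at hk; omega
  have : x ^ (2*l) = x ^ (2*k) * x ^ (2*(l-k)) := by rw [← pow_add]; congr 1; omega
  rw [this, inv_pow]; field_simp

lemma Ff_zero (l : ℕ) : Ff l 0 = nc l l := by
  unfold Ff
  rw [Finset.sum_range_succ]
  have : ∑ k ∈ Finset.range l, nc l k * (0:ℝ) ^ (2*(l-k)) = 0 := by
    apply Finset.sum_eq_zero
    intro k hk
    have : k < l := by simpa using hk
    rw [zero_pow (by omega), mul_zero]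
  rw [this]; simp

lemma Ff_cont (l : ℕ) : Continuous (Ff l) := by unfold Ff; fun_prop

lemma Ff_pos (l : ℕ) {x : ℝ} (hx : 0 ≤ x) : 0 < Ff l x := by
  rcases hx.eq_or_lt with h | h
  · rw [← h, Ff_zero]; exact nc_pos l l le_rfl
  · rw [Ff_eq l h]; have := Nf_pos l x; positivity

noncomputable def Tf (l : ℕ) (x : ℝ) : ℝ := 2 * nu l * Real.log (nu l + sf l x) - 2 * sf l x - Real.log (sf l x) - Real.log (Ff l x)

lemma Tf_zero (l : ℕ) : Tf l 0 = dl l := by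
  have : sf l 0 = nu l := by unfold sf; simp [Real.sqrt_sq (nu_pos l).le]
  unfold Tf dl; rw [this, Ff_zero]; ring_nf

lemma log_wf (l : ℕ) {x : ℝ} (hx : 0 < x) : Real.log (wf l x) = 2 * nu l * Real.log x - Real.log (Ff l x) := by
  have hN := Nf_pos l x
  unfold wf
  rw [Ff_eq l hx, Real.log_div hx.ne' hN.ne', Real.log_mul hN.ne' (by positivity), Real.log_pow]
  unfold nu; push_cast; ring

lemma Tf_hasDeriv (l : ℕ) {x : ℝ} (hx : 0 < x) (hxν : x < nu l) : HasDerivAt (Tf l) (2 * (Wf l x - Af l x) / x) x := by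
  have hs := sf_hasDeriv hx.le hxν
  have hs0 := (sf_pos hx.le hxν)
  have hν := nu_pos l
  have hw := wf_pos l hx
  have h := (((hs.const_add (nu l)).log (by positivity)).const_mul (2 * nu l)).sub (hs.const_mul 2) |>.sub (hs.log hs0.ne') |>.add
    (((wf_hasDeriv l hx).log hw.ne').sub ((Real.hasDerivAt_log hx.ne').const_mul (2 * nu l)))
  have he : Tf l =ᶠ[nhds x] (fun x => 2 * nu l * Real.log (nu l + sf l x) - 2 * sf l x - Real.log (sf l x) + (Real.log (wf l x) - 2 * nu l * Real.log x)) := by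
    filter_upwards [lt_mem_nhds hx] with t ht
    rw [log_wf l ht]; unfold Tf; ring
  refine (HasDerivAt.congr_deriv h ?_).congr_of_eventuallyEq he
  have hsq := sf_sq hx.le hxν.le
  unfold Af
  set s := sf l x
  have h2 : x ^ 2 = nu l ^ 2 - s ^ 2 := by linarith
  have h3 : nu l + s ≠ 0 := by positivity
  field_simp
  linear_combination (2 * s * nu l + 2 * s ^ 2 - 2 * s * nu l) * h2

lemma Tf_cont (l : ℕ) {ζ2 : ℝ} (h1 : ζ2 < 1) : ContinuousOn (Tf l) (Set.Icc 0 (ζ2 * nu l)) := by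
  have hν := nu_pos l
  have hs : Continuous (sf l) := by unfold sf; fun_prop
  have hs0 : ∀ x ∈ Set.Icc 0 (ζ2 * nu l), sf l x ≠ 0 := fun x hx => (sf_pos hx.1 (by nlinarith [hx.2])).ne'
  have hs1 : ∀ x ∈ Set.Icc 0 (ζ2 * nu l), nu l + sf l x ≠ 0 := fun x hx => by
    have : 0 ≤ sf l x := Real.sqrt_nonneg _
    positivity
  have hF : ∀ x ∈ Set.Icc 0 (ζ2 * nu l), Ff l x ≠ 0 := fun x hx => (Ff_pos l hx.1).ne'
  unfold Tf
  exact (((continuousOn_const.mul ((continuousOn_const.add hs.continuousOn).log hs1)).sub (continuousOn_const.mul hs.continuousOn)).sub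
    (hs.continuousOn.log hs0)).sub ((Ff_cont l).continuousOn.log hF)

lemma T_asym (ζ2 : ℝ) (h0 : 0 < ζ2) (h1 : ζ2 < 1) : ∃ C > 0, ∃ n0 > 0, ∀ l : ℕ, n0 ≤ nu l → ∀ x : ℝ, 0 < x → x ≤ ζ2 * nu l →
    |Tf l x - dinf| ≤ C / nu l := by
  obtain ⟨C, hC, n0, hn0, H⟩ := asym ζ2 h0 h1
  set d := dinf with hdd
  refine ⟨C + 2, by positivity, max n0 2, by positivity, fun l hl x hx hxle => ?_⟩
  have hν := nu_pos l
  set ν := nu l with hνd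
  have hl2 : 2 ≤ ν := (le_max_right _ _).trans hl
  have hl1 : 1 ≤ l := by
    by_contra h; push Not at h
    have : l = 0 := by omega
    rw [hνd, this] at hl2; unfold nu at hl2; norm_num at hl2
  have hxν : ∀ t, t ≤ x → t < ν := fun t ht => by nlinarith
  have hder : ∀ t, 0 < t → t ≤ x → |2 * (Wf l t - Af l t) / t| ≤ 2 * C / ν ^ 3 * t := by
    intro t ht htx
    have h := (H l ((le_max_left _ _).trans hl) t ht (htx.trans hxle)).1
    rw [abs_div, abs_mul, abs_of_pos ht, div_le_iff₀ ht, abs_two]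
    calc 2 * |Wf l t - Af l t| ≤ 2 * (C * t ^ 2 / ν ^ 3) := by gcongr
      _ = _ := by ring
  have hcont := (Tf_cont l h1).mono (Set.Icc_subset_Icc_right hxle)
  have hT : |Tf l x - Tf l 0| ≤ C / ν ^ 3 * x ^ 2 := by
    have hm : ∀ σ : ℝ, |σ| = 1 → MonotoneOn (fun t => C / ν ^ 3 * t ^ 2 - σ * Tf l t) (Set.Icc 0 x) := by
      intro σ hσ
      have hd : ∀ t ∈ interior (Set.Icc 0 x), HasDerivAt (fun t => C / ν ^ 3 * t ^ 2 - σ * Tf l t) (2 * C / ν ^ 3 * t - σ * (2 * (Wf l t - Af l t) / t)) t := by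
        intro t ht
        rw [interior_Icc] at ht
        refine HasDerivAt.congr_deriv ((((hasDerivAt_id t).pow 2).const_mul _).sub ((Tf_hasDeriv l ht.1 (hxν t ht.2.le)).const_mul σ)) ?_
        simp; ring
      apply monotoneOn_of_deriv_nonneg (convex_Icc _ _)
      · exact (by fun_prop : Continuous fun t : ℝ => C / ν ^ 3 * t ^ 2).continuousOn.sub (continuousOn_const.mul hcont)
      · intro t ht; exact (hd t ht).differentiableAt.differentiableWithinAt
      · intro t ht
        rw [(hd t ht).deriv]
        rw [interior_Icc] at ht
        have h := hder t ht.1 ht.2.le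
        have h2 : |σ * (2 * (Wf l t - Af l t) / t)| ≤ 2 * C / ν ^ 3 * t := by rw [abs_mul, hσ, one_mul]; exact h
        linarith [le_abs_self (σ * (2 * (Wf l t - Af l t) / t))]
    have m1 := hm 1 (by simp) (Set.left_mem_Icc.2 hx.le) (Set.right_mem_Icc.2 hx.le) hx.le
    have m2 := hm (-1) (by simp) (Set.left_mem_Icc.2 hx.le) (Set.right_mem_Icc.2 hx.le) hx.le
    simp at m1 m2
    rw [abs_le]; constructor <;> linarith
  have h5 : C / ν ^ 3 * x ^ 2 ≤ C / ν := by
    have hx2 : x ^ 2 ≤ ν ^ 2 := pow_le_pow_left₀ hx.le (hxν x le_rfl).le 2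
    calc C / ν ^ 3 * x ^ 2 ≤ C / ν ^ 3 * ν ^ 2 := by gcongr
      _ = C / ν := by field_simp
  rw [Tf_zero] at hT
  obtain ⟨d1, d2⟩ := dinf_spec l hl1
  have hl0 : (1:ℝ) ≤ l := by exact_mod_cast hl1
  have h6 : 1 / (l:ℝ) ≤ 2 / ν := by
    rw [div_le_div_iff₀ (by positivity) hν, hνd]; unfold nu; linarith
  have h7 : |dl l - d| ≤ 2 / ν := by rw [abs_le]; constructor <;> linarith
  have h8 := abs_add_le (Tf l x - dl l) (dl l - d)
  have e : Tf l x - dl l + (dl l - d) = Tf l x - d := by ring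
  rw [e] at h8
  have e2 : (C + 2) / ν = C / ν + 2 / ν := by ring
  linarith
end Bub

open Complex
namespace Bub
open Polynomial

noncomputable def sg (ζ : ℝ) : ℝ := Real.sqrt (1 - ζ ^ 2)
noncomputable def et (ζ : ℝ) : ℝ := Real.log (1 + sg ζ) - Real.log ζ - sg ζ
noncomputable def gg (ζ : ℝ) : ℝ := et ζ - sg ζ ^ 3 / (2 - ζ ^ 2)
noncomputable def bb (ζ : ℝ) : ℝ := 2 * ζ ^ 2 * et ζ / sg ζ
noncomputable def Ll (ζ : ℝ) : ℝ := dinf + 3 * Real.log ζ + Real.log (sg ζ) - Real.log (2 - ζ ^ 2) - (et ζ / sg ζ) * (ζ ^ 2 / sg ζ ^ 2 - 1)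

lemma sg_sq {ζ : ℝ} (h0 : 0 ≤ ζ) (h1 : ζ ≤ 1) : sg ζ ^ 2 = 1 - ζ ^ 2 := Real.sq_sqrt (by nlinarith)
lemma sg_pos {ζ : ℝ} (h0 : 0 ≤ ζ) (h1 : ζ < 1) : 0 < sg ζ := Real.sqrt_pos.2 (by nlinarith)
lemma sg_nonneg (ζ : ℝ) : 0 ≤ sg ζ := Real.sqrt_nonneg _
lemma sg_le_one (ζ : ℝ) : sg ζ ≤ 1 := by
  exact Real.sqrt_le_iff.2 ⟨by norm_num, by nlinarith [sq_nonneg ζ]⟩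
lemma sg_cont : Continuous sg := by unfold sg; fun_prop
lemma sg_one : sg 1 = 0 := by unfold sg; simp

lemma sg_hasDeriv {ζ : ℝ} (h0 : 0 ≤ ζ) (h1 : ζ < 1) : HasDerivAt sg (-ζ / sg ζ) ζ := by
  have hz : 1 - ζ ^ 2 ≠ 0 := by nlinarith
  refine HasDerivAt.congr_deriv ((((hasDerivAt_id ζ).pow 2).const_sub 1).sqrt hz) ?_
  have := (sg_pos h0 h1).ne'
  unfold sg at this ⊢
  simp
  field_simp

lemma et_hasDeriv {ζ : ℝ} (h0 : 0 < ζ) (h1 : ζ < 1) : HasDerivAt et (-sg ζ / ζ) ζ := by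
  have hs := sg_hasDeriv h0.le h1
  have hp := sg_pos h0.le h1
  have hsq := sg_sq h0.le h1.le
  have h := (((hs.const_add 1).log (by positivity)).sub (Real.hasDerivAt_log h0.ne')).sub hs
  refine HasDerivAt.congr_deriv h ?_
  set s := sg ζ
  have h2 : ζ ^ 2 = 1 - s ^ 2 := by linarith
  have h3 : 1 + s ≠ 0 := by positivity
  field_simp
  linear_combination s * h2

lemma et_cont : ContinuousOn et (Set.Ioc 0 1) := by
  unfold et
  have h1 : ∀ x ∈ Set.Ioc (0:ℝ) 1, 1 + sg x ≠ 0 := fun x _ => by have := sg_nonneg x; positivity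
  have h2 : ∀ x ∈ Set.Ioc (0:ℝ) 1, x ≠ 0 := fun x hx => hx.1.ne'
  exact (((continuousOn_const.add sg_cont.continuousOn).log h1).sub (continuousOn_id.log h2)).sub sg_cont.continuousOn

lemma et_one : et 1 = 0 := by unfold et; simp [sg_one]

lemma sqrt_eq {t : ℝ} (h0 : 0 < t) (h1 : t ≤ 1) : Real.sqrt (1 / t ^ 2 - 1) = sg t / t := by
  have : 1 / t ^ 2 - 1 = (1 - t ^ 2) / t ^ 2 := by field_simp
  rw [this, Real.sqrt_div (by nlinarith), Real.sqrt_sq h0.le]; rfl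

lemma int_eq {ζ : ℝ} (h0 : 0 < ζ) (h1 : ζ < 1) : ∫ t in ζ..(1:ℝ), Real.sqrt (1 / t ^ 2 - 1) = et ζ := by
  have hcont : ContinuousOn (fun t => Real.sqrt (1 / t ^ 2 - 1)) (Set.Icc ζ 1) := by
    apply ContinuousOn.sqrt
    apply ContinuousOn.sub _ continuousOn_const
    apply continuousOn_const.div (by fun_prop)
    intro t ht; have : 0 < t := h0.trans_le ht.1
    positivity
  have h := intervalIntegral.integral_eq_sub_of_hasDerivAt_of_le (f := fun t => - et t) (f' := fun t => Real.sqrt (1 / t ^ 2 - 1)) h1.le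
    ((et_cont.mono (fun t ht => ⟨h0.trans_le ht.1, ht.2⟩)).neg) (fun t ht => by
      have ht0 : 0 < t := h0.trans ht.1
      refine HasDerivAt.congr_deriv (et_hasDeriv ht0 ht.2).neg ?_
      rw [sqrt_eq ht0 ht.2.le]; ring) (hcont.intervalIntegrable_of_Icc h1.le)
  rw [h, et_one]; simp

lemma g0_eq {ζ : ℝ} (h0 : 0 < ζ) (h1 : ζ < 1) : g0 ζ = gg ζ := by
  unfold g0 gg
  rw [int_eq h0 h1]
  have : (1 - ζ ^ 2) ^ ((3:ℝ)/2) = sg ζ ^ 3 := by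
    have hz : 0 ≤ 1 - ζ ^ 2 := by nlinarith
    unfold sg
    generalize 1 - ζ ^ 2 = u at hz ⊢
    rw [Real.sqrt_eq_rpow, ← Real.rpow_natCast, ← Real.rpow_mul hz]; norm_num
  rw [this]

lemma gg_hasDeriv {ζ : ℝ} (h0 : 0 < ζ) (h1 : ζ < 1) :
    HasDerivAt gg (-2 * sg ζ * (ζ ^ 4 - 4 * ζ ^ 2 + 2) / (ζ * (2 - ζ ^ 2) ^ 2)) ζ := by
  have hs := sg_hasDeriv h0.le h1
  have hp := sg_pos h0.le h1
  have hsq := sg_sq h0.le h1.le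
  have h2 : 2 - ζ ^ 2 ≠ 0 := by nlinarith
  have h := (et_hasDeriv h0 h1).sub ((hs.pow 3).div (((hasDerivAt_id ζ).pow 2).const_sub 2) h2)
  refine HasDerivAt.congr_deriv h ?_
  simp
  set s := sg ζ
  have h4 : s ^ 2 = 1 - ζ ^ 2 := by linarith
  field_simp
  linear_combination (-2 * ζ^2) * h4

lemma gg_cont : ContinuousOn gg (Set.Ioc 0 1) := by
  unfold gg
  apply et_cont.sub
  apply (sg_cont.pow 3).continuousOn.div (by fun_prop)
  intro x hx; nlinarith [hx.1, hx.2]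

lemma gg_one : gg 1 = 0 := by unfold gg; simp [sg_one, et_one]

lemma bb_hasDeriv {ζ : ℝ} (h0 : 0 < ζ) (h1 : ζ < 1) :
    HasDerivAt bb (2 * ζ * (2 - ζ ^ 2) / sg ζ ^ 3 * gg ζ) ζ := by
  have hs := sg_hasDeriv h0.le h1
  have hp := sg_pos h0.le h1
  have hsq := sg_sq h0.le h1.le
  have h2 : 2 - ζ ^ 2 ≠ 0 := by nlinarith
  have h := ((((hasDerivAt_id ζ).pow 2).const_mul 2).mul (et_hasDeriv h0 h1)).div hs hp.ne'
  refine HasDerivAt.congr_deriv h ?_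
  unfold gg
  simp
  set s := sg ζ
  have h4 : s ^ 2 = 1 - ζ ^ 2 := by linarith
  field_simp
  linear_combination (2 * et ζ) * h4

lemma Ll_hasDeriv {ζ : ℝ} (h0 : 0 < ζ) (h1 : ζ < 1) : DifferentiableAt ℝ Ll ζ := by
  have hs := (sg_hasDeriv h0.le h1).differentiableAt
  have he := (et_hasDeriv h0 h1).differentiableAt
  have hp := (sg_pos h0.le h1).ne'
  have h2 : 2 - ζ ^ 2 ≠ 0 := by nlinarith
  have h3 := h0.ne'
  have h4 : sg ζ ^ 2 ≠ 0 := by positivity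
  unfold Ll
  fun_prop (disch := assumption)

lemma et_pos {ζ : ℝ} (h0 : 0 < ζ) (h1 : ζ < 1) : 0 < et ζ := by
  have : StrictAntiOn et (Set.Ioc 0 1) := by
    apply strictAntiOn_of_deriv_neg (convex_Ioc _ _) et_cont
    intro x hx; rw [interior_Ioc] at hx; rw [(et_hasDeriv hx.1 hx.2).deriv]
    have := sg_pos hx.1.le hx.2
    have := hx.1
    rw [neg_div]; apply neg_neg_of_pos; positivity
  have h := this ⟨h0, h1.le⟩ ⟨one_pos, le_rfl⟩ h1
  rwa [et_one] at h

lemma et_anti : AntitoneOn et (Set.Ioc 0 1) := by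
    apply antitoneOn_of_deriv_nonpos (convex_Ioc _ _) et_cont
    · intro x hx; rw [interior_Ioc] at hx; exact (et_hasDeriv hx.1 hx.2).differentiableAt.differentiableWithinAt
    intro x hx; rw [interior_Ioc] at hx; rw [(et_hasDeriv hx.1 hx.2).deriv]
    have := sg_pos hx.1.le hx.2
    have := hx.1
    rw [neg_div]; apply neg_nonpos_of_nonneg; positivity

section crit
variable {ζ₀ : ℝ}

lemma r_lt_one : Real.sqrt (2 - Real.sqrt 2) < 1 := by
  rw [Real.sqrt_lt' one_pos]
  have : 1 < Real.sqrt 2 := by rw [Real.lt_sqrt one_pos.le]; norm_num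
  linarith

lemma r_sq : Real.sqrt (2 - Real.sqrt 2) ^ 2 = 2 - Real.sqrt 2 := by
  apply Real.sq_sqrt
  have : Real.sqrt 2 ≤ 2 := by rw [Real.sqrt_le_left]; norm_num; norm_num
  linarith

lemma quart_pos {ζ : ℝ} (h0 : 0 < ζ) (h : ζ < Real.sqrt (2 - Real.sqrt 2)) : 0 < ζ ^ 4 - 4 * ζ ^ 2 + 2 := by
  have h1 : ζ ^ 2 < 2 - Real.sqrt 2 := by rw [← r_sq]; exact pow_lt_pow_left₀ h h0.le (by norm_num)
  have h2 : Real.sqrt 2 ^ 2 = 2 := Real.sq_sqrt (by norm_num)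
  have h3 := Real.sqrt_nonneg 2
  nlinarith

lemma quart_neg {ζ : ℝ} (h0 : Real.sqrt (2 - Real.sqrt 2) < ζ) (h : ζ < 1) : ζ ^ 4 - 4 * ζ ^ 2 + 2 < 0 := by
  have h1 : 2 - Real.sqrt 2 < ζ ^ 2 := by rw [← r_sq]; exact pow_lt_pow_left₀ h0 (Real.sqrt_nonneg _) (by norm_num)
  have h2 : Real.sqrt 2 ^ 2 = 2 := Real.sq_sqrt (by norm_num)
  have h3 := Real.sqrt_nonneg 2
  have h4 : 0 < ζ := lt_of_le_of_lt (Real.sqrt_nonneg _) h0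
  have h5 : ζ ^ 2 < 1 := by nlinarith
  nlinarith

lemma gg_anti : StrictAntiOn gg (Set.Ioc 0 (Real.sqrt (2 - Real.sqrt 2))) := by
  apply strictAntiOn_of_deriv_neg (convex_Ioc _ _) (gg_cont.mono (Set.Ioc_subset_Ioc_right r_lt_one.le))
  intro x hx; rw [interior_Ioc] at hx
  have hx1 := hx.2.trans r_lt_one
  rw [(gg_hasDeriv hx.1 hx1).deriv]
  have h1 := sg_pos hx.1.le hx1
  have h2 := quart_pos hx.1 hx.2
  have h3 := hx.1
  have h4 : 0 < 2 - x ^ 2 := by nlinarith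
  rw [show -2 * sg x * (x ^ 4 - 4 * x ^ 2 + 2) = - (2 * sg x * (x ^ 4 - 4 * x ^ 2 + 2)) by ring, neg_div]
  apply neg_neg_of_pos; positivity

lemma gg_neg_right {ζ : ℝ} (h0 : Real.sqrt (2 - Real.sqrt 2) ≤ ζ) (h1 : ζ < 1) : gg ζ < 0 := by
  have hr : 0 < Real.sqrt (2 - Real.sqrt 2) := by
    apply Real.sqrt_pos.2
    have : Real.sqrt 2 < 2 := by rw [Real.sqrt_lt']; norm_num; norm_num
    linarith
  have : StrictMonoOn gg (Set.Icc (Real.sqrt (2 - Real.sqrt 2)) 1) := by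
    apply strictMonoOn_of_deriv_pos (convex_Icc _ _) (gg_cont.mono (fun t ht => ⟨hr.trans_le ht.1, ht.2⟩))
    intro x hx; rw [interior_Icc] at hx
    have hx0 := hr.trans hx.1
    rw [(gg_hasDeriv hx0 hx.2).deriv]
    have h1 := sg_pos hx0.le hx.2
    have h2 := quart_neg hx.1 hx.2
    have h4 : 0 < 2 - x ^ 2 := by nlinarith [hx.2]
    rw [show -2 * sg x * (x ^ 4 - 4 * x ^ 2 + 2) = (2 * sg x * (-(x ^ 4 - 4 * x ^ 2 + 2))) by ring]
    have h5 : 0 < -(x ^ 4 - 4 * x ^ 2 + 2) := by linarith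
    positivity
  have h := this ⟨h0, h1.le⟩ ⟨r_lt_one.le, le_rfl⟩ h1
  rwa [gg_one] at h

lemma gg_dslope (hz : ζ₀ ∈ Set.Ioo 0 (Real.sqrt (2 - Real.sqrt 2))) (hg : gg ζ₀ = 0) {ζ1 ζ2 : ℝ} (h1 : 0 < ζ1) (h2 : ζ2 < 1)
    (h12 : ζ1 ≤ ζ2) :
    ∃ c > 0, ∃ C > 0, ∀ ζ ∈ Set.Icc ζ1 ζ2, (ζ₀ ≤ ζ → -C * (ζ - ζ₀) ≤ gg ζ ∧ gg ζ ≤ -c * (ζ - ζ₀)) ∧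
      (ζ ≤ ζ₀ → c * (ζ₀ - ζ) ≤ gg ζ ∧ gg ζ ≤ C * (ζ₀ - ζ)) := by
  have hz1 := hz.2.trans r_lt_one
  have hmem : ∀ ζ ∈ Set.Icc ζ1 ζ2, 0 < ζ ∧ ζ < 1 := fun ζ h => ⟨h1.trans_le h.1, h.2.trans_lt h2⟩
  have hc : ContinuousOn (dslope gg ζ₀) (Set.Icc ζ1 ζ2) := by
    intro ζ hζ
    apply ContinuousAt.continuousWithinAt
    by_cases h : ζ = ζ₀
    · rw [h]; exact continuousAt_dslope_same.2 (gg_hasDeriv hz.1 hz1).differentiableAt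
    · rw [continuousAt_dslope_of_ne h]
      exact (gg_hasDeriv (hmem ζ hζ).1 (hmem ζ hζ).2).continuousAt
  have hneg : ∀ ζ ∈ Set.Icc ζ1 ζ2, dslope gg ζ₀ ζ < 0 := by
    intro ζ hζ
    by_cases h : ζ = ζ₀
    · rw [h, dslope_same, (gg_hasDeriv hz.1 hz1).deriv]
      have a1 := sg_pos hz.1.le hz1
      have a2 := quart_pos hz.1 hz.2
      have a3 := hz.1
      have a4 : 0 < 2 - ζ₀ ^ 2 := by nlinarith
      rw [show -2 * sg ζ₀ * (ζ₀ ^ 4 - 4 * ζ₀ ^ 2 + 2) = - (2 * sg ζ₀ * (ζ₀ ^ 4 - 4 * ζ₀ ^ 2 + 2)) by ring, neg_div]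
      apply neg_neg_of_pos; positivity
    · rw [dslope_of_ne _ h, slope_def_field, hg, sub_zero]
      rcases lt_or_gt_of_ne h with h' | h'
      · have := gg_anti ⟨(hmem ζ hζ).1, (h'.trans hz.2).le⟩ ⟨hz.1, hz.2.le⟩ h'
        rw [hg] at this
        apply div_neg_of_pos_of_neg this; linarith
      · apply div_neg_of_neg_of_pos _ (by linarith)
        by_cases hr : Real.sqrt (2 - Real.sqrt 2) ≤ ζ
        · exact gg_neg_right hr (hmem ζ hζ).2
        · push Not at hr
          have := gg_anti ⟨hz.1, hz.2.le⟩ ⟨(hmem ζ hζ).1, hr.le⟩ h'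
          rwa [hg] at this
  have hne : (Set.Icc ζ1 ζ2).Nonempty := Set.nonempty_Icc.2 h12
  obtain ⟨m, hm, hmax⟩ := isCompact_Icc.exists_isMaxOn hne hc
  obtain ⟨n, hn, hmin⟩ := isCompact_Icc.exists_isMinOn hne hc
  refine ⟨- dslope gg ζ₀ m, by have := hneg m hm; linarith, - dslope gg ζ₀ n, by have := hneg n hn; linarith, ?_⟩
  intro ζ hζ
  have e : gg ζ = (ζ - ζ₀) * dslope gg ζ₀ ζ := by
    have := sub_smul_dslope gg ζ₀ ζ
    rw [hg, sub_zero, smul_eq_mul] at this; exact this.symm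
  have a := hmax hζ
  have b := hmin hζ
  simp only [Set.mem_setOf_eq] at a b
  rw [e]
  constructor
  · intro h; constructor <;> nlinarith
  · intro h; constructor <;> nlinarith

lemma bb_quad (hz : ζ₀ ∈ Set.Ioo 0 (Real.sqrt (2 - Real.sqrt 2))) (hg : gg ζ₀ = 0) {ζ1 ζ2 : ℝ} (h1 : 0 < ζ1) (h2 : ζ2 < 1)
    (h01 : ζ1 ≤ ζ₀) (h02 : ζ₀ ≤ ζ2) :
    ∃ c > 0, ∃ C > 0, ∀ ζ ∈ Set.Icc ζ1 ζ2, c * (ζ - ζ₀) ^ 2 ≤ bb ζ₀ - bb ζ ∧ bb ζ₀ - bb ζ ≤ C * (ζ - ζ₀) ^ 2 := by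
  obtain ⟨c, hc, C, hC, H⟩ := gg_dslope hz hg h1 h2 (h01.trans h02)
  have hs2 : 0 < sg ζ2 := sg_pos (h1.le.trans (h01.trans h02)) h2
  set m := 2 * ζ1 with hm
  set M := 4 / sg ζ2 ^ 3 with hM
  have hm0 : 0 < m := by positivity
  have hM0 : 0 < M := by positivity
  have hmem : ∀ ζ ∈ Set.Icc ζ1 ζ2, 0 < ζ ∧ ζ < 1 := fun ζ h => ⟨h1.trans_le h.1, h.2.trans_lt h2⟩
  have hwt : ∀ ζ ∈ Set.Icc ζ1 ζ2, m ≤ 2 * ζ * (2 - ζ ^ 2) / sg ζ ^ 3 ∧ 2 * ζ * (2 - ζ ^ 2) / sg ζ ^ 3 ≤ M := by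
    intro ζ hζ
    obtain ⟨a, b⟩ := hmem ζ hζ
    have hs := sg_pos a.le b
    have hs1 := sg_le_one ζ
    have hss : sg ζ2 ≤ sg ζ := by
      apply Real.sqrt_le_sqrt; have := hζ.2; nlinarith
    have h3 : ζ ^ 2 < 1 := by nlinarith
    constructor
    · rw [le_div_iff₀ (by positivity)]
      have : sg ζ ^ 3 ≤ 1 := pow_le_one₀ hs.le hs1
      calc m * sg ζ ^ 3 ≤ 2 * ζ * 1 := by rw [hm]; gcongr; exact hζ.1
        _ ≤ _ := by gcongr; linarith
    · rw [hM]; gcongr; nlinarith [sq_nonneg ζ]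
  have hprod : ∀ ζ ∈ Set.Icc ζ1 ζ2, (ζ₀ ≤ ζ → -(M*C) * (ζ - ζ₀) ≤ 2 * ζ * (2 - ζ ^ 2) / sg ζ ^ 3 * gg ζ ∧ 2 * ζ * (2 - ζ ^ 2) / sg ζ ^ 3 * gg ζ ≤ -(m*c) * (ζ - ζ₀)) ∧
      (ζ ≤ ζ₀ → (m*c) * (ζ₀ - ζ) ≤ 2 * ζ * (2 - ζ ^ 2) / sg ζ ^ 3 * gg ζ ∧ 2 * ζ * (2 - ζ ^ 2) / sg ζ ^ 3 * gg ζ ≤ (M*C) * (ζ₀ - ζ)) := by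
    intro ζ hζ
    obtain ⟨w1, w2⟩ := hwt ζ hζ
    obtain ⟨g1, g2⟩ := H ζ hζ
    generalize 2 * ζ * (2 - ζ ^ 2) / sg ζ ^ 3 = w at *
    have hw0 : 0 < w := hm0.trans_le w1
    constructor
    · intro h
      obtain ⟨g3, g4⟩ := g1 h
      have p1 : 0 ≤ C * (ζ - ζ₀) := mul_nonneg hC.le (by linarith)
      have p2 : 0 ≤ c * (ζ - ζ₀) := mul_nonneg hc.le (by linarith)
      have q1 := mul_le_mul_of_nonneg_left g3 hw0.le
      have q2 := mul_le_mul_of_nonneg_left g4 hw0.le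
      have q3 := mul_le_mul_of_nonneg_right w2 p1
      have q4 := mul_le_mul_of_nonneg_right w1 p2
      constructor <;> linarith
    · intro h
      obtain ⟨g3, g4⟩ := g2 h
      have p1 : 0 ≤ C * (ζ₀ - ζ) := mul_nonneg hC.le (by linarith)
      have p2 : 0 ≤ c * (ζ₀ - ζ) := mul_nonneg hc.le (by linarith)
      have q1 := mul_le_mul_of_nonneg_left g3 hw0.le
      have q2 := mul_le_mul_of_nonneg_left g4 hw0.le
      have q3 := mul_le_mul_of_nonneg_right w2 p1
      have q4 := mul_le_mul_of_nonneg_right w1 p2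
      constructor <;> linarith
  have hqd : ∀ k t : ℝ, HasDerivAt (fun t => k * (t - ζ₀) ^ 2) (k * (2 * (t - ζ₀))) t := by
    intro k t
    refine HasDerivAt.congr_deriv ((((hasDerivAt_id t).sub_const ζ₀).pow 2).const_mul k) ?_
    simp
  refine ⟨m * c / 2, by positivity, M * C / 2, by positivity, fun ζ hζ => ?_⟩
  rcases le_total ζ₀ ζ with h | h
  · have hsub : ∀ t ∈ Set.Icc ζ₀ ζ, t ∈ Set.Icc ζ1 ζ2 := fun t ht => ⟨h01.trans ht.1, ht.2.trans hζ.2⟩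
    have a1 := le_of_deriv (f := fun t => -bb t - m * c / 2 * (t - ζ₀) ^ 2) h
      (fun t ht => (bb_hasDeriv (hmem t (hsub t ht)).1 (hmem t (hsub t ht)).2).neg.sub (hqd _ t))
      (fun t ht => by have := ((hprod t (hsub t ht)).1 ht.1).2; linarith)
    have a2 := le_of_deriv (f := fun t => bb t + M * C / 2 * (t - ζ₀) ^ 2) h
      (fun t ht => (bb_hasDeriv (hmem t (hsub t ht)).1 (hmem t (hsub t ht)).2).add (hqd _ t))
      (fun t ht => by have := ((hprod t (hsub t ht)).1 ht.1).1; linarith)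
    simp only [sub_self] at a1 a2
    constructor <;> linarith
  · have hsub : ∀ t ∈ Set.Icc ζ ζ₀, t ∈ Set.Icc ζ1 ζ2 := fun t ht => ⟨hζ.1.trans ht.1, ht.2.trans h02⟩
    have a1 := le_of_deriv (f := fun t => bb t + m * c / 2 * (t - ζ₀) ^ 2) h
      (fun t ht => (bb_hasDeriv (hmem t (hsub t ht)).1 (hmem t (hsub t ht)).2).add (hqd _ t))
      (fun t ht => by have := ((hprod t (hsub t ht)).2 ht.2).1; linarith)
    have a2 := le_of_deriv (f := fun t => -bb t - M * C / 2 * (t - ζ₀) ^ 2) h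
      (fun t ht => (bb_hasDeriv (hmem t (hsub t ht)).1 (hmem t (hsub t ht)).2).neg.sub (hqd _ t))
      (fun t ht => by have := ((hprod t (hsub t ht)).2 ht.2).2; linarith)
    simp only [sub_self] at a1 a2
    constructor <;> linarith

lemma Ll_lip {ζ1 ζ2 : ℝ} (h1 : 0 < ζ1) (h2 : ζ2 < 1) (h01 : ζ1 ≤ ζ₀) (h02 : ζ₀ ≤ ζ2) :
    ∃ K > 0, ∀ ζ ∈ Set.Icc ζ1 ζ2, |Ll ζ - Ll ζ₀| ≤ K * |ζ - ζ₀| := by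
  have hmem : ∀ ζ ∈ Set.Icc ζ1 ζ2, 0 < ζ ∧ ζ < 1 := fun ζ h => ⟨h1.trans_le h.1, h.2.trans_lt h2⟩
  have hc : ContinuousOn (dslope Ll ζ₀) (Set.Icc ζ1 ζ2) := by
    intro ζ hζ
    apply ContinuousAt.continuousWithinAt
    by_cases h : ζ = ζ₀
    · rw [h]; exact continuousAt_dslope_same.2 (Ll_hasDeriv (hmem _ ⟨h01, h02⟩).1 (hmem _ ⟨h01, h02⟩).2)
    · rw [continuousAt_dslope_of_ne h]
      exact (Ll_hasDeriv (hmem ζ hζ).1 (hmem ζ hζ).2).continuousAt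
  obtain ⟨K, hK⟩ := isCompact_Icc.exists_bound_of_continuousOn hc
  refine ⟨|K| + 1, by positivity, fun ζ hζ => ?_⟩
  have e : Ll ζ - Ll ζ₀ = (ζ - ζ₀) * dslope Ll ζ₀ ζ := by
    have := sub_smul_dslope Ll ζ₀ ζ
    rw [smul_eq_mul] at this; exact this.symm
  rw [e, abs_mul, mul_comm]
  have := hK ζ hζ
  rw [Real.norm_eq_abs] at this
  gcongr
  linarith [le_abs_self K]
end crit
end Bub

open Complex
namespace Bub
open Polynomial

lemma small_y (C β : ℝ) (hβ : 0 < β) (n : ℕ) : ∃ ε₀ > 0, ε₀ ≤ 1 ∧ ∀ ε : ℝ, 0 < ε → ε ≤ ε₀ → ∀ y : ℝ,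
    |y| ≤ Real.exp (-β / ε ^ 2) → C * |y| ≤ ε ^ n := by
  obtain ⟨e, he, he1, H⟩ := exp_beats |C| β hβ n
  refine ⟨e, he, he1, fun ε h0 h1 y hy => ?_⟩
  have h := H ε h0 h1
  rw [div_le_iff₀ (by positivity)] at h
  have e1 : Real.exp (-β / ε ^ 2) * Real.exp (β / ε ^ 2) = 1 := by
    rw [← Real.exp_add, neg_div, neg_add_cancel, Real.exp_zero]
  have hp := Real.exp_pos (-β / ε ^ 2)
  calc C * |y| ≤ |C| * |y| := by gcongr; exact le_abs_self C
    _ ≤ (Real.exp (β / ε ^ 2) * ε ^ n) * Real.exp (-β / ε ^ 2) := by gcongr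
    _ = (Real.exp (-β / ε ^ 2) * Real.exp (β / ε ^ 2)) * ε ^ n := by ring
    _ = ε ^ n := by rw [e1, one_mul]

lemma log_close {a b d : ℝ} (ha : 0 < a) (hd : d ≤ a / 2) (h : |b - a| ≤ d) : 0 < b ∧ |Real.log b - Real.log a| ≤ 2 * d / a := by
  have h' := abs_le.1 h
  have hb : 0 < b := by linarith [h'.1]
  have hd0 : 0 ≤ d := (abs_nonneg _).trans h
  refine ⟨hb, ?_⟩
  have e1 : Real.log b - Real.log a ≤ b / a - 1 := by
    rw [← Real.log_div hb.ne' ha.ne']; exact Real.log_le_sub_one_of_pos (by positivity)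
  have e2 : Real.log a - Real.log b ≤ a / b - 1 := by
    rw [← Real.log_div ha.ne' hb.ne']; exact Real.log_le_sub_one_of_pos (by positivity)
  have e3 : b / a - 1 ≤ 2 * d / a := by
    rw [div_sub_one ha.ne']; gcongr; linarith [h'.2]
  have e4 : a / b - 1 ≤ 2 * d / a := by
    rw [div_sub_one hb.ne', div_le_div_iff₀ hb ha]
    nlinarith [h'.1]
  rw [abs_le]; constructor <;> linarith

lemma sf_scale (l : ℕ) (ζ : ℝ) : sf l (ζ * nu l) = nu l * sg ζ := by
  unfold sf sg
  rw [show nu l ^ 2 - (ζ * nu l) ^ 2 = nu l ^ 2 * (1 - ζ ^ 2) by ring, Real.sqrt_mul (by positivity),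
    Real.sqrt_sq (nu_pos l).le]

lemma Af_scale (l : ℕ) (ζ : ℝ) : Af l (ζ * nu l) = nu l * sg ζ - ζ ^ 2 / (2 * sg ζ ^ 2) := by
  unfold Af
  rw [sf_scale]
  have := nu_pos l
  congr 1
  rw [show (ζ * nu l) ^ 2 = nu l ^ 2 * ζ ^ 2 by ring, show 2 * (nu l * sg ζ) ^ 2 = nu l ^ 2 * (2 * sg ζ ^ 2) by ring]
  exact mul_div_mul_left _ _ (by positivity)

lemma log_wf_scale (l : ℕ) {ζ : ℝ} (h0 : 0 < ζ) (h1 : ζ < 1) : Real.log (wf l (ζ * nu l)) =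
    Tf l (ζ * nu l) + Real.log (nu l) + Real.log (sg ζ) - 2 * nu l * et ζ := by
  have hν := nu_pos l
  have hs := sg_pos h0.le h1
  rw [log_wf l (by positivity)]
  unfold Tf et
  rw [sf_scale, show nu l + nu l * sg ζ = nu l * (1 + sg ζ) by ring, Real.log_mul hν.ne' (by positivity),
    Real.log_mul hν.ne' hs.ne', Real.log_mul h0.ne' hν.ne']
  ring

noncomputable def Mm (l : ℕ) (Q x : ℝ) : ℝ := x ^ 2 / Q + (Wf l x + 1/2) + (nu l ^ 2 - x ^ 2) - Wf l x ^ 2 + wf l x ^ 2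

lemma root_bds {ζ1 : ℝ} (h1 : 0 < ζ1) {l : ℕ} (hl : 2 ≤ l) {Q x y : ℝ} (hQ : 0 < Q) (hx1 : ζ1 * nu l ≤ x) (hx2 : x ≤ nu l) (hy : |y| ≤ 1/2)
    (h : IsRt l Q ((x:ℂ) - y * I)) :
    |x ^ 2 / Q - (Wf l x + 1/2)| ≤ |y| * (2 / ζ1 + 2) * nu l ∧
    |y * Mm l Q x - x * wf l x| ≤ y ^ 2 * (2 / ζ1 + 2) * nu l ^ 2 := by
  have hν := nu_ge hl
  have hν0 := nu_pos l
  have hx : 0 < x := lt_of_lt_of_le (by positivity) hx1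
  have hl1 : (l:ℝ) + 1 ≤ 2 * nu l := by unfold nu; linarith
  have a := (root_first hQ hx hy h).1
  have b := root_second hQ hx hy h
  have hlx : ((l:ℝ) + 1) / x ≤ 2 / ζ1 := by
    rw [div_le_div_iff₀ hx h1]; nlinarith
  have hz : 0 < 2 / ζ1 := by positivity
  constructor
  · have e : x ^ 2 / Q - (Wf l x + 1/2) = x * (x / Q - (Wf l x + 1/2) / x) := by field_simp
    rw [e, abs_mul, abs_of_pos hx]
    calc x * |x / Q - (Wf l x + 1/2) / x| ≤ x * (|y| * ((l + 1) / x ^ 2 + 2)) := by gcongr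
      _ = |y| * ((l+1)/x + 2 * x) := by field_simp
      _ ≤ |y| * ((2 / ζ1 + 2) * nu l) := by
        gcongr; nlinarith
      _ = _ := by ring
  · have e : y * Mm l Q x - x * wf l x = x ^ 2 * (y * (1 / Q + ((Wf l x + 1/2) - (Wf l x ^ 2 - wf l x ^ 2 - (nu l ^ 2 - x ^ 2))) / x ^ 2) - 1 / Nf l x) := by
      have hN := Nf_pos l x
      unfold Mm
      rw [show x * wf l x = x ^ 2 / Nf l x by unfold wf; ring]
      field_simp
      ring
    rw [e, abs_mul, abs_of_pos (by positivity : 0 < x ^ 2)]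
    calc x ^ 2 * _ ≤ x ^ 2 * (y ^ 2 * ((l + 1) / x ^ 3 + 2)) := by gcongr
      _ = y ^ 2 * ((l+1)/x + 2 * x ^ 2) := by field_simp
      _ ≤ y ^ 2 * ((2 / ζ1 + 2) * nu l ^ 2) := by
        gcongr; 
        have : x ^ 2 ≤ nu l ^ 2 := by gcongr
        nlinarith [mul_le_mul_of_nonneg_left (show 1 ≤ nu l ^ 2 by nlinarith) hz.le]
      _ = _ := by ring

end Bub

open Complex
namespace Bub
open Polynomial

set_option maxHeartbeats 1000000 in
lemma scales1 {ζ1 ζ2 : ℝ} (h1 : 0 < ζ1) (h12 : ζ1 ≤ ζ2) (h2 : ζ2 < 1) : ∃ C ≥ 1, ∃ ε₀ > 0, ε₀ ≤ 1 ∧ ∀ ε : ℝ, 0 < ε → ε ≤ ε₀ →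
    ∀ l : ℕ, 2 ≤ l → ∀ ζ ∈ Set.Icc ζ1 ζ2,
    |(ζ * nu l) ^ 2 / Qf l ε - (Wf l (ζ * nu l) + 1/2)| ≤ ε ^ 4 * nu l →
    1 ≤ C * (nu l * ε ^ 2) ∧ nu l * ε ^ 2 ≤ C ∧
    |Wf l (ζ * nu l) - (nu l * sg ζ - ζ ^ 2 / (2 * sg ζ ^ 2))| ≤ C * ε ^ 2 ∧
    wf l (ζ * nu l) ≤ C * ε ^ 2 ∧ |Tf l (ζ * nu l) - dinf| ≤ C * ε ^ 2 := by
  have h20 : 0 < ζ2 := h1.trans_le h12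
  obtain ⟨C1, hC1, n1, hn1, H1⟩ := asym ζ2 h20 h2
  obtain ⟨C2, hC2, n2, hn2, H2⟩ := T_asym ζ2 h20 h2
  set σ := sg ζ2 with hσ
  have hσ0 : 0 < σ := sg_pos h20.le h2
  have hσ1 : σ ≤ 1 := sg_le_one _
  set c := ζ1 ^ 2 / 3 with hc
  have hc0 : 0 < c := by positivity
  set D := 2 / σ * (2 + 1 / (2 * σ ^ 2) + C1) with hD
  have hD0 : 0 < D := by positivity
  set n0 := n1 + n2 with hn0
  refine ⟨1 + 1 / c + D + C1 / c + C2 / c, by have : 0 < 1/c + D + C1/c + C2/c := by positivity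
                                              linarith, min (σ / 2) (c / (n0 + 1)), by positivity, ?_, ?_⟩
  · exact (min_le_left _ _).trans (by linarith)
  intro ε h0 hε l hl ζ hζ hr
  have hεσ : ε ≤ σ / 2 := hε.trans (min_le_left _ _)
  have hεn : ε ≤ c / (n0 + 1) := hε.trans (min_le_right _ _)
  have hε1 : ε ≤ 1 := by linarith
  have hν := nu_ge hl
  set ν := nu l with hνd
  have hν0 : 0 < ν := by linarith
  have hQ := Qpos_aux hl h0
  have hQ0 := Qf_pos hl h0
  have hζ0 : 0 < ζ := h1.trans_le hζ.1
  have hζ2 : ζ < 1 := hζ.2.trans_lt h2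
  have hr' := abs_le.1 hr
  have hζsq : ζ ^ 2 ≤ 1 := by nlinarith only [hζ0, hζ2]
  have hε2 : ε ^ 2 ≤ ε := by nlinarith only [h0, hε1]
  have hε4 : ε ^ 4 ≤ ε := by
    calc ε ^ 4 ≤ ε ^ 1 := pow_le_pow_of_le_one h0.le hε1 (by norm_num)
      _ = ε := pow_one _
  -- lower bound
  have hlow : c ≤ ν * ε ^ 2 := by
    have a : ζ1 ^ 2 / ε ^ 2 ≤ (ζ * ν) ^ 2 / Qf l ε := by
      rw [div_le_div_iff₀ (by positivity) hQ0]
      calc ζ1 ^ 2 * Qf l ε ≤ ζ ^ 2 * (ν ^ 2 * ε ^ 2) := by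
            apply mul_le_mul (by gcongr; exact hζ.1) hQ.2.2.1 hQ0.le (by positivity)
        _ = _ := by ring
    have b := Wf_le l (ζ * ν)
    have : ε ^ 4 * ν ≤ 1 * ν := by gcongr; linarith
    have d : ζ1 ^ 2 / ε ^ 2 ≤ 3 * ν := by linarith only [a, b, this, hr'.2, hν, hνd]
    rw [div_le_iff₀ (by positivity)] at d
    rw [hc]; linarith
  have hnn : n0 + 1 ≤ ν := by
    have : (n0 + 1) * ε ≤ c := by rw [le_div_iff₀ (by positivity)] at hεn; linarith only [hεn]
    have : (n0 + 1) * ε ^ 2 ≤ ν * ε ^ 2 := by nlinarith only [this, hlow, hε2, h0, hn0, hn1, hn2]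
    exact le_of_mul_le_mul_right this (by positivity)
  have hx : 0 < ζ * ν := by positivity
  have hx2 : ζ * ν ≤ ζ2 * ν := by gcongr; exact hζ.2
  obtain ⟨a1, a2⟩ := H1 l (by linarith) (ζ * ν) hx hx2
  have a3 := H2 l (by linarith) (ζ * ν) hx hx2
  rw [Af_scale] at a1
  have hinv : 1 / ν ≤ ε ^ 2 / c := by
    rw [div_le_div_iff₀ hν0 hc0]; linarith
  have hC1ν : C1 * (ζ * ν) ^ 2 / ν ^ 3 ≤ C1 * (1 / ν) := by
    rw [show C1 * (ζ * ν) ^ 2 / ν ^ 3 = C1 * (ζ ^ 2 * (1 / ν)) by field_simp]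
    have : ζ ^ 2 * (1/ν) ≤ 1 * (1/ν) := by
      gcongr
    gcongr; linarith
  have hC1e : C1 * (1 / ν) ≤ C1 / c * ε ^ 2 := by
    calc C1 * (1 / ν) ≤ C1 * (ε ^ 2 / c) := by gcongr
      _ = _ := by ring
  have hC2e : C2 / ν ≤ C2 / c * ε ^ 2 := by
    calc C2 / ν = C2 * (1 / ν) := by ring
      _ ≤ C2 * (ε ^ 2 / c) := by gcongr
      _ = _ := by ring
  have hC1c : 0 < C1 / c := by positivity
  have hC2c : 0 < C2 / c := by positivity
  have h1c : 0 < 1 / c := by positivity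
  have he2 : 0 < ε ^ 2 := by positivity
  -- upper bound
  have hσσ : σ ≤ sg ζ := by
    apply Real.sqrt_le_sqrt; have := hζ.2; nlinarith only [this, hζ0]
  have hup : ν * ε ^ 2 ≤ D := by
    have a : (ζ * ν) ^ 2 / Qf l ε ≤ 2 / ε ^ 2 := by
      rw [div_le_div_iff₀ hQ0 (by positivity)]
      have := hQ.2.1
      have b : (ζ * ν) ^ 2 * ε ^ 2 ≤ 1 * (ν ^ 2 * ε ^ 2) := by
        rw [show (ζ * ν) ^ 2 * ε ^ 2 = ζ ^ 2 * (ν ^ 2 * ε ^ 2) by ring]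
        gcongr
      have e : Qf l ε = ((l:ℝ) + 2) * (l - 1) * ε ^ 2 := rfl
      have e2 : 0 ≤ ν ^ 2 * ε ^ 2 := by positivity
      nlinarith only [b, e, e2, this]
    have b1 := (abs_le.1 a1).1
    have b2 : C1 * (1 / ν) ≤ C1 := by
      have : 1 / ν ≤ 1 := by rw [div_le_one hν0]; linarith
      nlinarith only [this, hC1]
    have b3 : ζ ^ 2 / (2 * sg ζ ^ 2) ≤ 1 / (2 * σ ^ 2) := by
      apply div_le_div₀ (by norm_num) hζsq (by positivity)
      gcongr
    have b4 : ν * σ ≤ ν * sg ζ := by gcongr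
    have b5 : ε ^ 4 * ν ≤ σ / 2 * ν := by gcongr; linarith
    have b6 : ν * (σ / 2) ≤ 2 / ε ^ 2 + 1 / (2 * σ ^ 2) + C1 := by linarith [hr'.1]
    have b7 : ν * (σ / 2) * ε ^ 2 ≤ 2 + (1 / (2 * σ ^ 2) + C1) := by
      calc ν * (σ / 2) * ε ^ 2 ≤ (2 / ε ^ 2 + 1 / (2 * σ ^ 2) + C1) * ε ^ 2 := by gcongr
        _ = 2 + (1 / (2 * σ ^ 2) + C1) * ε ^ 2 := by field_simp; ring
        _ ≤ 2 + (1 / (2 * σ ^ 2) + C1) * 1 := by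
          have : 0 < 1 / (2 * σ ^ 2) + C1 := by positivity
          gcongr; linarith only [hε2, hε1]
        _ = _ := by ring
    rw [hD, div_mul_eq_mul_div, le_div_iff₀ hσ0]
    linarith
  refine ⟨?_, ?_, ?_, ?_, ?_⟩
  · have : 1 ≤ 1 / c * (ν * ε ^ 2) := by
      rw [div_mul_eq_mul_div, one_mul, le_div_iff₀ hc0]; linarith
    have : 0 < (1 + D + C1 / c + C2 / c) * (ν * ε ^ 2) := by positivity
    linarith
  · linarith
  · refine a1.trans (hC1ν.trans (hC1e.trans ?_)); gcongr; linarith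
  · refine a2.trans (hC1ν.trans (hC1e.trans ?_)); gcongr; linarith
  · refine a3.trans (hC2e.trans ?_); gcongr; linarith

set_option maxHeartbeats 1000000 in
lemma scales2 {ζ1 ζ2 : ℝ} (h1 : 0 < ζ1) (h12 : ζ1 ≤ ζ2) (h2 : ζ2 < 1) : ∃ C ≥ 1, ∃ ε₀ > 0, ε₀ ≤ 1 ∧ ∀ ε : ℝ, 0 < ε → ε ≤ ε₀ →
    ∀ l : ℕ, 2 ≤ l → ∀ ζ ∈ Set.Icc ζ1 ζ2,
    |(ζ * nu l) ^ 2 / Qf l ε - (Wf l (ζ * nu l) + 1/2)| ≤ ε ^ 4 * nu l →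
    1 ≤ C * (nu l * ε ^ 2) ∧ nu l * ε ^ 2 ≤ C ∧
    |nu l * sg ζ - (ζ ^ 2 / ε ^ 2 + ζ ^ 2 / (2 * sg ζ ^ 2) - 1/2)| ≤ C * ε ^ 2 ∧
    |Mm l (Qf l ε) (ζ * nu l) - nu l * (2 - ζ ^ 2) / sg ζ| ≤ C ∧ |Tf l (ζ * nu l) - dinf| ≤ C * ε ^ 2 := by
  obtain ⟨C, hC, ε₀, hε₀, hε₁, H⟩ := scales1 h1 h12 h2
  set k0 := 1 / (2 * sg ζ2 ^ 2) with hk0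
  have hσ0 : 0 < sg ζ2 := sg_pos (h1.trans_le h12).le h2
  have hk00 : 0 < k0 := by positivity
  have hC0 : 0 < C := by linarith
  refine ⟨2 * C + 4 * C ^ 2 + (2 * (k0 + C) + 1 + C + 2 * C ^ 2 + (k0 + C) ^ 2 + C ^ 2), ?_, ε₀, hε₀, hε₁, ?_⟩
  · have : 0 < C + 4 * C ^ 2 + (2 * (k0 + C) + 1 + C + 2 * C ^ 2 + (k0 + C) ^ 2 + C ^ 2) := by positivity
    linarith only [this, hC]
  intro ε h0 hε l hl ζ hζ hr
  obtain ⟨a1, a2, a3, a4, a5⟩ := H ε h0 hε l hl ζ hζ hr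
  have hε1 : ε ≤ 1 := hε.trans hε₁
  have hν := nu_ge hl
  have hζ0 : 0 < ζ := h1.trans_le hζ.1
  have hζ2 : ζ < 1 := hζ.2.trans_lt h2
  have hσ := sg_pos hζ0.le hζ2
  have hσ1 := sg_le_one ζ
  have hσsq := sg_sq hζ0.le hζ2.le
  have hσσ : sg ζ2 ≤ sg ζ := by
    apply Real.sqrt_le_sqrt; have := hζ.2; nlinarith only [this, hζ0]
  have hζsq : ζ ^ 2 ≤ 1 := by nlinarith only [hζ0, hζ2]
  have hQ := Qpos_aux hl h0
  have hQ0 := Qf_pos hl h0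
  have hw0 := wf_pos l (show 0 < ζ * nu l by positivity)
  have eQ : Qf l ε = (nu l ^ 2 - 9/4) * ε ^ 2 := by unfold Qf; rw [hQ.2.2.2]
  have hQ1 : (16/25) * nu l ^ 2 * ε ^ 2 ≤ Qf l ε := hQ.2.1
  have he2 : 0 < ε ^ 2 := by positivity
  have he21 : ε ^ 2 ≤ 1 := by nlinarith only [h0, hε1]
  set k := ζ ^ 2 / (2 * sg ζ ^ 2) with hk
  have hkk : k ≤ k0 := by
    apply div_le_div₀ (by norm_num) hζsq (by positivity)
    gcongr
  have hkp : 0 < k := by positivity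
  have ek : k * (2 * sg ζ ^ 2) = ζ ^ 2 := by rw [hk]; field_simp
  set r := (ζ * nu l) ^ 2 / Qf l ε with hrd
  have er : |r - ζ ^ 2 / ε ^ 2| ≤ 4 * C ^ 2 * ε ^ 2 := by
    have e : r - ζ ^ 2 / ε ^ 2 = ζ ^ 2 * (9/4) / Qf l ε := by
      have hne : nu l ^ 2 - 9 / 4 ≠ 0 := by nlinarith only [hν]
      obtain ⟨m, hm⟩ : ∃ m, m = nu l ^ 2 - 9 / 4 := ⟨_, rfl⟩
      rw [← hm] at hne
      rw [hrd, eQ, mul_pow, ← hm, show nu l ^ 2 = m + 9/4 by linarith only [hm]]; field_simp; ring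
    rw [e, abs_of_pos (by positivity), div_le_iff₀ hQ0]
    have b : 1 ≤ (C * (nu l * ε ^ 2)) ^ 2 := one_le_pow₀ a1
    calc ζ ^ 2 * (9/4) ≤ 1 * (9/4) := by gcongr
      _ ≤ 4 * (16/25) * (C * (nu l * ε ^ 2)) ^ 2 := by linarith only [b]
      _ = 4 * C ^ 2 * ε ^ 2 * ((16/25) * nu l ^ 2 * ε ^ 2) := by ring
      _ ≤ _ := by gcongr
  have e4 : ε ^ 4 * nu l ≤ C * ε ^ 2 := by nlinarith only [a2, he2]
  have hCe : C * ε ^ 2 ≤ C := by nlinarith only [hC0, he21]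
  set W := Wf l (ζ * nu l) with hW
  set w := wf l (ζ * nu l) with hw
  set σ := sg ζ with hσd
  set ν := nu l with hνd
  have hr' := abs_le.1 hr
  have er' := abs_le.1 er
  have a3' := abs_le.1 a3
  set K2 := 2 * (k0 + C) + 1 + C + 2 * C ^ 2 + (k0 + C) ^ 2 + C ^ 2 with hK2
  have hK20 : 0 < K2 := by positivity
  have hCC : 0 < C ^ 2 := by positivity
  refine ⟨?_, ?_, ?_, ?_, ?_⟩
  · have : 0 < (C + 4 * C ^ 2 + K2) * (ν * ε ^ 2) := by positivity
    linarith only [a1, this]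
  · linarith only [a2, hC0, hCC, hK20]
  · have : 0 < K2 * ε ^ 2 := by positivity
    rw [abs_le]; constructor <;> linarith only [hr'.1, hr'.2, er'.1, er'.2, a3'.1, a3'.2, e4, this]
  · have : Mm l (Qf l ε) (ζ * ν) - ν * (2 - ζ ^ 2) / σ = 2 * (-k + (W - (ν * σ - k))) + 1 + (r - (W + 1/2)) - 2 * (σ * (ν * (W - (ν * σ - k)))) - (k - (W - (ν * σ - k))) ^ 2 + w ^ 2 := by
      unfold Mm
      rw [← hW, ← hw, ← hrd, ← hνd, mul_div_assoc, show (2 - ζ ^ 2) / σ = 2 * σ + 2 * k * σ by rw [div_eq_iff hσ.ne']; linear_combination -ek - 2 * hσsq]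
      linear_combination (-ν ^ 2) * hσsq
    rw [this]
    set δ := W - (ν * σ - k) with hδ
    set δ2 := r - (W + 1/2) with hδ2
    have b1 : |δ2| ≤ C := by rw [abs_le]; constructor <;> linarith only [hr'.1, hr'.2, e4, hCe]
    have b2 : |δ| ≤ C := a3.trans hCe
    have b3 : |σ * (ν * δ)| ≤ C ^ 2 := by
      rw [abs_mul, abs_mul, abs_of_pos hσ, abs_of_pos (nu_pos l)]
      calc σ * (ν * |δ|) ≤ 1 * (ν * (C * ε ^ 2)) := by gcongr
        _ = C * (ν * ε ^ 2) := by ring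
        _ ≤ C * C := by gcongr
        _ = _ := by ring
    have b4 : (k - δ) ^ 2 ≤ (k0 + C) ^ 2 := by
      apply sq_le_sq'
      · linarith only [(abs_le.1 b2).2, hkp, hk00]
      · linarith only [(abs_le.1 b2).1, hkk]
    have b5 : w ^ 2 ≤ C ^ 2 := by
      apply pow_le_pow_left₀ hw0.le; linarith only [a4, hCe]
    have b6 := sq_nonneg (k - δ)
    have b7 := sq_nonneg w
    have b2' := abs_le.1 b2
    have b1' := abs_le.1 b1
    have b3' := abs_le.1 b3
    rw [abs_le]; constructor <;> linarith only [b6, b7, b2'.1, b2'.2, b1'.1, b1'.2, b3'.1, b3'.2, b4, b5, hkk, hkp, hC0, hCC, hk00, hK2]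
  · refine a5.trans ?_
    gcongr; linarith only [hC0, hCC, hK20]

end Bub

open Complex
namespace Bub
open Polynomial

set_option maxHeartbeats 1000000 in
lemma precise {ζ1 ζ2 : ℝ} (h1 : 0 < ζ1) (h12 : ζ1 ≤ ζ2) (h2 : ζ2 < 1) (β : ℝ) (hβ : 0 < β) :
    ∃ C > 0, ∃ ε₀ > 0, ε₀ ≤ 1 ∧ ∀ ε : ℝ, 0 < ε → ε ≤ ε₀ →
    ∀ l : ℕ, 2 ≤ l → ∀ ζ ∈ Set.Icc ζ1 ζ2, ∀ y : ℝ, |y| ≤ Real.exp (-β / ε ^ 2) →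
    IsRt l (Qf l ε) (((ζ * nu l : ℝ) : ℂ) - y * I) →
    0 < y ∧ |Real.log (ε ^ 2 * y) - (Ll ζ - bb ζ / ε ^ 2)| ≤ C * ε ^ 2 := by
  obtain ⟨C, hC, e1, he1, he11, H⟩ := scales2 h1 h12 h2
  obtain ⟨e2, he2, he21, Hy⟩ := small_y (2 / ζ1 + 2) β hβ 4
  have h20 : 0 < ζ2 := h1.trans_le h12
  set σm := sg ζ2 with hσm
  have hσm0 : 0 < σm := sg_pos h20.le h2
  set k0 := 1 / (2 * σm ^ 2) with hk0
  have hk00 : 0 < k0 := by positivity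
  have hC0 : 0 < C := by linarith
  set d := C + C ^ 2 with hd
  set d' := (C + k0 + 1/2) / σm with hd'
  have hd0 : 0 < d := by positivity
  have hd'0 : 0 < d' := by positivity
  have het1 : 0 < et ζ1 := et_pos h1 (h12.trans_lt h2)
  refine ⟨C + 2 * d' / ζ1 ^ 2 + 2 * d * C + 2 * et ζ1 / σm * C, by positivity, min (min e1 e2) (min (1 / (2 * C * d)) (ζ1 ^ 2 / (2 * d'))), by positivity, ?_, ?_⟩
  · exact (min_le_left _ _).trans ((min_le_left _ _).trans he11)
  intro ε h0 hε l hl ζ hζ y hy hroot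
  have hεe1 : ε ≤ e1 := hε.trans ((min_le_left _ _).trans (min_le_left _ _))
  have hεe2 : ε ≤ e2 := hε.trans ((min_le_left _ _).trans (min_le_right _ _))
  have hεd : ε ≤ 1 / (2 * C * d) := hε.trans ((min_le_right _ _).trans (min_le_left _ _))
  have hεd' : ε ≤ ζ1 ^ 2 / (2 * d') := hε.trans ((min_le_right _ _).trans (min_le_right _ _))
  have hε1 : ε ≤ 1 := hεe1.trans he11
  have hy4 := Hy ε h0 hεe2 y hy
  have hε2 : ε ^ 2 ≤ ε := by nlinarith only [h0, hε1]
  have hεp : 0 < ε ^ 2 := by positivity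
  have hε41 : ε ^ 4 ≤ 1 := pow_le_one₀ h0.le hε1
  have hy2 : |y| ≤ 1/2 := by
    have : 0 < 2 / ζ1 := by positivity
    nlinarith only [this, hy4, hε41, abs_nonneg y]
  have hν := nu_ge hl
  have hν0 := nu_pos l
  have hζ0 : 0 < ζ := h1.trans_le hζ.1
  have hζ2 : ζ < 1 := hζ.2.trans_lt h2
  have hσ := sg_pos hζ0.le hζ2
  have hσ1 := sg_le_one ζ
  have hζsq : ζ ^ 2 ≤ 1 := by nlinarith only [hζ0, hζ2]
  have hσσ : σm ≤ sg ζ := by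
    apply Real.sqrt_le_sqrt; have := hζ.2; nlinarith only [this, hζ0]
  have hx : 0 < ζ * nu l := by positivity
  have hw := wf_pos l hx
  obtain ⟨r1, r2⟩ := root_bds h1 hl (Qf_pos hl h0) (show ζ1 * nu l ≤ ζ * nu l by gcongr; exact hζ.1)
    (show ζ * nu l ≤ nu l by nlinarith only [hν0, hζ2]) hy2 hroot
  have r1' : |(ζ * nu l) ^ 2 / Qf l ε - (Wf l (ζ * nu l) + 1/2)| ≤ ε ^ 4 * nu l := by
    refine r1.trans ?_
    gcongr
    linarith only [hy4]
  obtain ⟨a1, a2, a3, a4, a5⟩ := H ε h0 hεe1 l hl ζ hζ r1'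
  have hy0 : y ≠ 0 := by
    intro h
    rw [h] at r2
    simp only [zero_mul, zero_sub, abs_neg, ne_eq, OfNat.ofNat_ne_zero, not_false_eq_true, zero_pow] at r2
    have : 0 < ζ * nu l * wf l (ζ * nu l) := by positivity
    rw [abs_of_pos this] at r2
    linarith only [r2, this]
  have hyp : 0 < |y| := abs_pos.2 hy0
  set P := ζ * nu l * wf l (ζ * nu l) with hP
  have hP0 : 0 < P := by positivity
  have hM' : |P / y - Mm l (Qf l ε) (ζ * nu l)| ≤ C ^ 2 := by
    have e : P / y - Mm l (Qf l ε) (ζ * nu l) = - (y * Mm l (Qf l ε) (ζ * nu l) - P) / y := by field_simp; ring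
    rw [e, abs_div, abs_neg, div_le_iff₀ hyp]
    refine r2.trans ?_
    calc y ^ 2 * (2 / ζ1 + 2) * nu l ^ 2 = ((2 / ζ1 + 2) * |y|) * nu l ^ 2 * |y| := by
          rw [← sq_abs y]; ring
      _ ≤ ε ^ 4 * nu l ^ 2 * |y| := by gcongr
      _ = (nu l * ε ^ 2) ^ 2 * |y| := by ring
      _ ≤ _ := by gcongr
  set a := nu l * (2 - ζ ^ 2) / sg ζ with ha
  have haν : nu l ≤ a := by
    rw [ha, le_div_iff₀ hσ]; nlinarith only [hν0, hσ1, hζsq]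
  have ha0 : 0 < a := by linarith only [haν, hν0]
  have hMa : |P / y - a| ≤ d := by
    have := abs_sub_le (P / y) (Mm l (Qf l ε) (ζ * nu l)) a
    linarith only [this, hM', a4, hd]
  have hda : d ≤ a / 2 := by
    rw [le_div_iff₀ (by positivity)] at hεd
    have : 2 * d * (C * ε ^ 2) ≤ nu l * (C * ε ^ 2) := by
      have : 2 * d * (C * ε ^ 2) ≤ 2 * d * (C * ε) := by gcongr
      linarith only [this, hεd, a1]
    have := le_of_mul_le_mul_right this (by positivity)
    linarith only [this, haν]
  obtain ⟨b1, b2⟩ := log_close ha0 hda hMa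
  have hypos : 0 < y := by
    by_contra hcon
    have : P / y ≤ 0 := div_nonpos_of_nonneg_of_nonpos hP0.le (not_lt.1 hcon)
    linarith only [this, b1]
  refine ⟨hypos, ?_⟩
  have b2' : 2 * d / a ≤ 2 * d * C * ε ^ 2 := by
    rw [div_le_iff₀ ha0]
    have : 1 ≤ C * (a * ε ^ 2) := a1.trans (by gcongr)
    calc 2 * d = 2 * d * 1 := by ring
      _ ≤ 2 * d * (C * (a * ε ^ 2)) := by gcongr
      _ = _ := by ring
  set a' := ζ ^ 2 / (sg ζ * ε ^ 2) with ha'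
  have ha'0 : 0 < a' := by positivity
  have ha'1 : ζ1 ^ 2 / ε ^ 2 ≤ a' := by
    rw [ha', div_le_div_iff₀ hεp (by positivity)]
    calc ζ1 ^ 2 * (sg ζ * ε ^ 2) ≤ ζ ^ 2 * (1 * ε ^ 2) := by gcongr; exact hζ.1
      _ = _ := by ring
  have hk : ζ ^ 2 / (2 * sg ζ ^ 2) ≤ k0 := by
    apply div_le_div₀ (by norm_num) hζsq (by positivity)
    gcongr
  have hkp : 0 < ζ ^ 2 / (2 * sg ζ ^ 2) := by positivity
  have hνa' : |nu l - a'| ≤ d' := by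
    have e : nu l - a' = (nu l * sg ζ - ζ ^ 2 / ε ^ 2) / sg ζ := by rw [ha']; field_simp
    rw [e, abs_div, abs_of_pos hσ, hd']
    apply div_le_div₀ (by positivity) _ hσm0 hσσ
    have : C * ε ^ 2 ≤ C := by nlinarith only [hC0, hε2, hε1]
    rw [abs_le] at a3 ⊢
    constructor <;> linarith only [a3.1, a3.2, this, hk, hkp, hk00]
  have hd'a : d' ≤ a' / 2 := by
    rw [le_div_iff₀ (by positivity)] at hεd'
    have : 2 * d' ≤ ζ1 ^ 2 / ε ^ 2 := by
      rw [le_div_iff₀ hεp]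
      have : 2 * d' * ε ^ 2 ≤ 2 * d' * ε := by gcongr
      linarith only [this, hεd']
    linarith only [this, ha'1]
  obtain ⟨-, c2⟩ := log_close ha'0 hd'a hνa'
  have c2' : 2 * d' / a' ≤ 2 * d' / ζ1 ^ 2 * ε ^ 2 := by
    rw [div_le_iff₀ ha'0]
    rw [div_le_iff₀ hεp] at ha'1
    calc 2 * d' = 2 * d' / ζ1 ^ 2 * ζ1 ^ 2 := by field_simp
      _ ≤ 2 * d' / ζ1 ^ 2 * (a' * ε ^ 2) := by gcongr
      _ = _ := by ring
  have hetl : et ζ ≤ et ζ1 := et_anti ⟨h1, (h12.trans h2.le)⟩ ⟨hζ0, hζ2.le⟩ hζ.1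
  have het0 := et_pos hζ0 hζ2
  set R := nu l * sg ζ - (ζ ^ 2 / ε ^ 2 + ζ ^ 2 / (2 * sg ζ ^ 2) - 1/2) with hR
  have f1 : |2 * et ζ / sg ζ * R| ≤ 2 * et ζ1 / σm * C * ε ^ 2 := by
    rw [abs_mul, abs_of_pos (by positivity : 0 < 2 * et ζ / sg ζ), mul_assoc]
    gcongr
  have key : Real.log (ε ^ 2 * y) - (Ll ζ - bb ζ / ε ^ 2) = (Tf l (ζ * nu l) - dinf) + (Real.log (nu l) - Real.log a')
      - (Real.log (P / y) - Real.log a) - 2 * et ζ / sg ζ * R := by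
    have hζ22 : 2 - ζ ^ 2 ≠ 0 := by linarith only [hζsq]
    rw [Real.log_div hP0.ne' hypos.ne', hP, Real.log_mul hx.ne' hw.ne', Real.log_mul hζ0.ne' hν0.ne', log_wf_scale l hζ0 hζ2,
      Real.log_mul hεp.ne' hypos.ne', ha, ha', Real.log_div (by positivity) hσ.ne', Real.log_mul hν0.ne' hζ22,
      Real.log_div (by positivity) (by positivity), Real.log_mul hσ.ne' hεp.ne', Real.log_pow ζ 2, hR]
    unfold Ll bb
    push_cast
    field_simp
    ring
  rw [key]
  rw [abs_le] at a5 b2 c2 f1 ⊢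
  constructor <;> linarith only [a5.1, a5.2, b2.1, b2.2, c2.1, c2.2, f1.1, f1.2, b2', c2']

end Bub

open Complex
namespace Bub
open Polynomial

lemma near_zero_poly (S : ℂ[X]) (t0 : ℂ) (hS : S.eval t0 ≠ 0) (n : ℕ) (hn : 0 < n) (hd : S.natDegree ≤ n) {A : ℝ} (hA : 0 < A)
    (h : A ≤ ‖(derivative S).eval t0 / S.eval t0‖) : ∃ τ : ℂ, S.eval τ = 0 ∧ ‖t0 - τ‖ ≤ 2 * n / A := by
  by_contra hcon
  push Not at hcon
  have hn' : (0:ℝ) < n := by exact_mod_cast hn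
  rw [(IsAlgClosed.splits S).eval_derivative_div_eval_of_ne_zero hS] at h
  have h1 := norm_multiset_sum_le (S.roots.map fun z ↦ 1 / (t0 - z))
  rw [Multiset.map_map] at h1
  have h2 : (Multiset.map ((fun x ↦ ‖x‖) ∘ fun z ↦ 1 / (t0 - z)) S.roots).sum ≤ (Multiset.map ((fun x ↦ ‖x‖) ∘ fun z ↦ 1 / (t0 - z)) S.roots).card • (A / (2 * n)) := by
    apply Multiset.sum_le_card_nsmul
    intro x hx
    rw [Multiset.mem_map] at hx
    obtain ⟨τ, hτ, rfl⟩ := hx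
    have h3 := hcon τ (mem_roots'.1 hτ).2
    have h4 : 0 < 2 * n / A := by positivity
    simp only [Function.comp, norm_div, norm_one]
    rw [div_le_div_iff₀ (by linarith) (by positivity)]
    rw [div_lt_iff₀ hA] at h3
    linarith
  rw [Multiset.card_map, nsmul_eq_mul] at h2
  have h5 : ((S.roots.card : ℕ) : ℝ) ≤ n := by exact_mod_cast (card_roots' S).trans hd
  have h6 : ((S.roots.card : ℕ) : ℝ) * (A / (2 * n)) ≤ n * (A / (2 * n)) := by gcongr
  have h7 : (n:ℝ) * (A / (2 * n)) = A / 2 := by field_simp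
  have h8 := h.trans h1
  linarith

noncomputable def Sp (l : ℕ) (Q : ℝ) : ℂ[X] :=
  qp l + C (Q:ℂ) * ((C I * X - X ^ 2) * qp l - X ^ 3 * derivative (qp l))

lemma Sp_natDegree (l : ℕ) (Q : ℝ) : (Sp l Q).natDegree ≤ l + 2 := by
  unfold Sp
  have hd : (derivative (qp l)).natDegree ≤ l - 1 := by
    have := natDegree_derivative_le (qp l); rwa [qp_natDegree] at this
  refine natDegree_add_le_of_le (m := l + 2) (n := l + 2) (by rw [qp_natDegree]; omega) ?_ |>.trans (by simp)
  refine (natDegree_C_mul_le _ _).trans ?_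
  refine (natDegree_sub_le_of_le (m := l + 2) (n := l + 2) ?_ ?_).trans (by simp)
  · refine natDegree_mul_le_of_le (m := 2) (n := l) ?_ (qp_natDegree l).le |>.trans (by omega)
    compute_degree
  · by_cases h : l = 0
    · subst h; rw [qp_zero]; simp
    · refine natDegree_mul_le_of_le (m := 3) (n := l - 1) (by simp) hd |>.trans (by omega)

lemma Sp_root {l : ℕ} {Q : ℝ} (hQ : 0 < Q) {τ : ℂ} (hτ : τ ≠ 0) (h : (Sp l Q).eval τ = 0) : IsRt l Q τ⁻¹ := by
  unfold Sp at h
  simp only [eval_add, eval_mul, eval_sub, eval_C, eval_X, eval_pow] at h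
  have hQ' : (Q:ℂ) ≠ 0 := by exact_mod_cast hQ.ne'
  have hq : (qp l).eval τ ≠ 0 := by
    intro h0
    have := qp_simple l τ h0
    rw [h0] at h
    apply this
    have h3 : (Q:ℂ) * τ * (τ ^ 2 * (derivative (qp l)).eval τ) = 0 := by linear_combination -h
    rcases mul_eq_zero.1 h3 with h3 | h3
    · exact absurd h3 (mul_ne_zero hQ' hτ)
    · exact h3
  refine ⟨by rwa [inv_inv], ?_⟩
  unfold Rc
  rw [inv_inv]
  field_simp
  linear_combination h

set_option maxHeartbeats 1000000 in
lemma Sp_logder {l : ℕ} {Q x : ℝ} (hQ : 0 < Q) (hx : 0 < x) (hx0 : x ^ 2 / Q = Wf l x + 1/2) (hxν : x ≤ nu l) (hN : 2 * nu l ^ 2 ≤ Nf l x) :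
    (Sp l Q).eval ((x⁻¹ : ℝ) : ℂ) ≠ 0 ∧ Nf l x ≤ ‖(derivative (Sp l Q)).eval ((x⁻¹ : ℝ) : ℂ) / (Sp l Q).eval ((x⁻¹ : ℝ) : ℂ)‖ := by
  have hq := qp_real_ne l x⁻¹
  have hR := Rc_real l hx.ne'
  have hode := congrArg (fun p => p.eval ((x⁻¹ : ℝ) : ℂ)) (qp_ode l)
  simp only [eval_add, eval_mul, eval_sub, eval_C, eval_X, eval_pow] at hode
  have hNp := Nf_pos l x
  have hN1 := Nf_one_le l x
  have hW1 := Wf_ge l x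
  have hW2 := Wf_le l x
  have hsq := Wf_sq_le l hx
  have hν : nu l ^ 2 = (l:ℝ) * (l + 1) + 1/4 := by unfold nu; ring
  have hν0 := nu_pos l
  have hwf : wf l x = x * (1 / Nf l x) := by unfold wf; ring
  have hr : Q * x⁻¹ * (-(Wf l x + 1/2) / x) = -1 := by rw [← hx0]; field_simp
  have hP : x⁻¹ + -(Wf l x + 1/2) / x = - ((Wf l x - 1/2) / x) := by field_simp; ring
  have hQ' : (Q:ℂ) ≠ 0 := by exact_mod_cast hQ.ne'
  have hN' : (Nf l x:ℂ) ≠ 0 := by exact_mod_cast hNp.ne'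
  have ht' : ((x⁻¹ : ℝ) : ℂ) ≠ 0 := by exact_mod_cast (inv_pos.2 hx).ne'
  have ht0 : 0 < x⁻¹ := inv_pos.2 hx
  unfold Rc at hR
  rw [← ofReal_inv] at hR
  set r : ℝ := -(Wf l x + 1/2) / x with hrd
  set N := Nf l x with hNd
  set n : ℝ := 1 / N with hn
  have hrC : (Q:ℂ) * (x⁻¹ : ℝ) * r = -1 := by exact_mod_cast hr
  have hnN : (n:ℂ) * N = 1 := by rw [hn]; push_cast; field_simp
  have hxx : x * x⁻¹ = 1 := mul_inv_cancel₀ hx.ne'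
  have hSe : (Sp l Q).eval ((x⁻¹ : ℝ) : ℂ) = (qp l).eval ((x⁻¹ : ℝ) : ℂ) + (Q:ℂ) * ((I * ((x⁻¹ : ℝ) : ℂ) - ((x⁻¹ : ℝ) : ℂ) ^ 2) * (qp l).eval ((x⁻¹ : ℝ) : ℂ) - ((x⁻¹ : ℝ) : ℂ) ^ 3 * (derivative (qp l)).eval ((x⁻¹ : ℝ) : ℂ)) := by
    unfold Sp
    simp only [eval_add, eval_mul, eval_sub, eval_C, eval_X, eval_pow]
  have hSd : (derivative (Sp l Q)).eval ((x⁻¹ : ℝ) : ℂ) = (derivative (qp l)).eval ((x⁻¹ : ℝ) : ℂ) + (Q:ℂ) * ((I - 2 * ((x⁻¹ : ℝ) : ℂ)) * (qp l).eval ((x⁻¹ : ℝ) : ℂ) + (I * ((x⁻¹ : ℝ) : ℂ) - ((x⁻¹ : ℝ) : ℂ) ^ 2) * (derivative (qp l)).eval ((x⁻¹ : ℝ) : ℂ) - 3 * ((x⁻¹ : ℝ) : ℂ) ^ 2 * (derivative (qp l)).eval ((x⁻¹ : ℝ) : ℂ) - ((x⁻¹ : ℝ) : ℂ) ^ 3 *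 (derivative (derivative (qp l))).eval ((x⁻¹ : ℝ) : ℂ)) := by
    unfold Sp
    simp only [derivative_add, derivative_mul, derivative_sub, derivative_C, derivative_X, derivative_X_pow, eval_add, eval_mul, eval_sub, eval_C, eval_X, eval_pow, eval_zero, eval_one]
    push_cast
    ring
  generalize (Sp l Q).eval ((x⁻¹ : ℝ) : ℂ) = S at *
  generalize (derivative (Sp l Q)).eval ((x⁻¹ : ℝ) : ℂ) = S' at *
  generalize (qp l).eval ((x⁻¹ : ℝ) : ℂ) = q at *
  generalize (derivative (derivative (qp l))).eval ((x⁻¹ : ℝ) : ℂ) = q2 at *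
  generalize (derivative (qp l)).eval ((x⁻¹ : ℝ) : ℂ) = q1 at *
  set t : ℂ := ((x⁻¹ : ℝ) : ℂ) with ht
  set P : ℂ := t + r + n * I with hPd
  have h1 : t ^ 2 * q1 = (I - P) * q := by
    have : t ^ 2 * q1 / q = I - P := by rw [hPd]; linear_combination -hR
    rw [← this]; field_simp
  have hS : S = q * (Q * t * n * I) := by
    rw [hSe]
    have hPt : P - t = r + n * I := by rw [hPd]; ring
    linear_combination (-Q * t) * h1 + Q * q * t * hPt + q * hrC
  have hn' : (n:ℂ) ≠ 0 := by exact_mod_cast (show n ≠ 0 by positivity)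
  have hS0 : S ≠ 0 := by
    rw [hS]
    exact mul_ne_zero hq (mul_ne_zero (mul_ne_zero (mul_ne_zero hQ' ht') hn') I_ne_zero)
  refine ⟨hS0, ?_⟩
  set G : ℂ := 1 + P ^ 2 - ((l:ℂ) * (l + 1)) * t ^ 2 + t * P - 2 * t ^ 2 with hG
  have hD : t ^ 2 * S' = (I - P) * S + q * Q * t * G := by
    rw [hSd, hSe, hG]
    linear_combination (-Q * t ^ 3) * hode + (1 + Q * (-I * t - 2 * t ^ 2) + Q * t * (I - P)) * h1 + (-q * Q * t) * I_sq
  have hD2 : S' / S = x ^ 2 * ((I - P) - I * (N * G)) := by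
    have hxt : (x:ℂ) * t = 1 := by rw [ht]; exact_mod_cast hxx
    have e1 : S' = x ^ 2 * (t ^ 2 * S') := by linear_combination (-S' * (x * t + 1)) * hxt
    have e2 : q * Q * t = - I * N * S := by
      rw [hS]
      linear_combination (-q * Q * t) * hnN + (q * Q * t * (n * N)) * I_sq
    rw [e1, hD, e2]; field_simp; ring
  have hGre : 2 * x⁻¹ ^ 2 ≤ ‖G‖ := by
    have e : G.re = 1 + (x⁻¹ + r) ^ 2 - n ^ 2 - ((l:ℝ) * (l + 1)) * x⁻¹ ^ 2 + x⁻¹ * (x⁻¹ + r) - 2 * x⁻¹ ^ 2 := by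
      rw [hG, hPd, ht]
      simp [pow_two]
      ring
    have e2 : G.re = - (2 * (Wf l x + 1/2) + (nu l ^ 2 - x ^ 2 + wf l x ^ 2 - Wf l x ^ 2)) * x⁻¹ ^ 2 := by
      rw [e, hP, hwf, hν]
      field_simp
      ring
    have e3 : G.re ≤ - (2 * x⁻¹ ^ 2) := by
      rw [e2]
      have : 0 < x⁻¹ ^ 2 := by positivity
      nlinarith only [this, hsq, hW1]
    have := Complex.abs_re_le_norm G
    have := neg_le_abs G.re
    linarith
  have hIP : ‖I - P‖ ≤ nu l * x⁻¹ + 1 := by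
    have e : I - P = ((-(x⁻¹ + r) : ℝ) : ℂ) + ((1 - n : ℝ) : ℂ) * I := by rw [hPd, ht]; push_cast; ring
    rw [e]
    refine (norm_add_le _ _).trans ?_
    rw [norm_mul, norm_I, mul_one, norm_real, norm_real, hP, Real.norm_eq_abs, Real.norm_eq_abs, neg_neg]
    have a1 : |(Wf l x - 1/2) / x| ≤ nu l * x⁻¹ := by
      rw [abs_of_nonneg (div_nonneg (by linarith) hx.le), ← div_eq_mul_inv]; gcongr; linarith
    have hn1 : n ≤ 1 := by rw [hn, div_le_one hNp]; exact hN1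
    have hn0 : 0 < n := by positivity
    have a2 : |1 - n| ≤ 1 := by rw [abs_le]; constructor <;> linarith
    linarith
  rw [hD2, norm_mul, norm_pow, norm_real, Real.norm_eq_abs, abs_of_pos hx]
  have h2 : ‖I * (N * G)‖ - ‖I - P‖ ≤ ‖(I - P) - I * (N * G)‖ := by
    rw [norm_sub_rev (I - P)]; exact norm_sub_norm_le _ _
  rw [norm_mul, norm_I, one_mul, norm_mul, norm_real, Real.norm_eq_abs, abs_of_pos hNp] at h2
  have h3 : N * (2 * x⁻¹ ^ 2) ≤ N * ‖G‖ := by gcongr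
  calc N ≤ x ^ 2 * (N * (2 * x⁻¹ ^ 2) - (nu l * x⁻¹ + 1)) := by
        have : x ^ 2 * (N * (2 * x⁻¹ ^ 2) - (nu l * x⁻¹ + 1)) = 2 * N - (nu l * x + x ^ 2) := by field_simp
        rw [this]; nlinarith only [hN, hxν, hx, hν0]
    _ ≤ _ := by gcongr; linarith

lemma near_root {l : ℕ} (hl : 2 ≤ l) {Q x : ℝ} (hQ : 0 < Q) (hx : 0 < x) (hx0 : x ^ 2 / Q = Wf l x + 1/2) (hxν : x ≤ nu l) (hN : 8 * nu l ^ 2 ≤ Nf l x) :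
    ∃ z : ℂ, IsRt l Q z ∧ ‖z - x‖ ≤ 8 * nu l ^ 3 / Nf l x := by
  have hNp := Nf_pos l x
  have hν0 := nu_pos l
  obtain ⟨h1, h2⟩ := Sp_logder hQ hx hx0 hxν (by nlinarith)
  obtain ⟨τ, h3, h4⟩ := near_zero_poly _ _ h1 (l+2) (by omega) (Sp_natDegree l Q) hNp h2
  have hl2 : ((l + 2 : ℕ) : ℝ) ≤ 2 * nu l := by
    have : (2:ℝ) ≤ l := by exact_mod_cast hl
    push_cast; unfold nu; linarith
  have h5 : ‖((x⁻¹:ℝ):ℂ) - τ‖ ≤ 4 * nu l / Nf l x := by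
    refine h4.trans (div_le_div_of_nonneg_right (by linarith) hNp.le)
  have h6 : 4 * nu l / Nf l x ≤ x⁻¹ / 2 := by
    rw [div_le_div_iff₀ hNp (by norm_num), ← mul_le_mul_iff_left₀ hx]
    have : x⁻¹ * Nf l x * x = Nf l x := by field_simp
    rw [this]; nlinarith
  have h7 : x⁻¹ / 2 ≤ ‖τ‖ := by
    have := norm_sub_norm_le ((x⁻¹:ℝ):ℂ) τ
    rw [norm_real, Real.norm_eq_abs, abs_of_pos (inv_pos.2 hx)] at this
    linarith
  have hx' : 0 < x⁻¹ := inv_pos.2 hx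
  have hτ : τ ≠ 0 := by
    intro h; rw [h, norm_zero] at h7; linarith
  refine ⟨τ⁻¹, Sp_root hQ hτ h3, ?_⟩
  have hxC : (x:ℂ) ≠ 0 := by exact_mod_cast hx.ne'
  have e : τ⁻¹ - x = (((x⁻¹:ℝ):ℂ) - τ) * x * τ⁻¹ := by
    push_cast; field_simp
  rw [e, norm_mul, norm_mul, norm_inv, norm_real, Real.norm_eq_abs, abs_of_pos hx]
  have h8 : ‖τ‖⁻¹ ≤ 2 * x := by
    have := inv_anti₀ (by positivity) h7
    refine this.trans (le_of_eq ?_)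
    field_simp
  calc ‖((x⁻¹:ℝ):ℂ) - τ‖ * x * ‖τ‖⁻¹ ≤ (4 * nu l / Nf l x) * nu l * (2 * nu l) := by
        gcongr; linarith
    _ = _ := by ring

end Bub

open Complex
namespace Bub
open Polynomial

set_option maxHeartbeats 1000000 in
lemma ivt_root {ζ1 ζ₀ ζ2 : ℝ} (h1 : 0 < ζ1) (h10 : ζ1 < ζ₀) (h02 : ζ₀ < ζ2) (h2 : ζ2 < 1) (m0 : ℝ) :
    ∃ K > 0, ∃ c > 0, ∃ D > 0, ∃ ε₀ > 0, ε₀ ≤ 1 ∧ ∀ ε : ℝ, 0 < ε → ε ≤ ε₀ →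
    ∃ l : ℕ, 2 ≤ l ∧ m0 ≤ nu l ∧ c ≤ nu l * ε ^ 2 ∧ nu l * ε ^ 2 ≤ D ∧ ∃ ζ ∈ Set.Icc ζ1 ζ2, |ζ - ζ₀| ≤ K * ε ^ 2 ∧
      (ζ * nu l) ^ 2 / Qf l ε = Wf l (ζ * nu l) + 1/2 := by
  have h0p : 0 < ζ₀ := h1.trans h10
  have h01 : ζ₀ < 1 := h02.trans h2
  have h20 : 0 < ζ2 := h0p.trans h02
  obtain ⟨C1, hC1, n1, hn1, H1⟩ := asym ζ2 h20 h2
  set σ₀ := sg ζ₀ with hσ₀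
  have hσ₀p : 0 < σ₀ := sg_pos h0p.le h01
  set σm := sg ζ2 with hσm
  have hσm0 : 0 < σm := sg_pos h20.le h2
  set k0 := 1 / (2 * σm ^ 2) with hk0
  have hk00 : 0 < k0 := by positivity
  set E := 5 + k0 + C1 with hE
  have hE0 : 0 < E := by positivity
  set K := E / ζ₀ with hK
  have hK0 : 0 < K := by positivity
  set c0 := ζ₀ ^ 2 / σ₀ with hc0
  have hc00 : 0 < c0 := by positivity
  set n0 := n1 + |m0| + 2 / c0 + 2 with hn0
  have hn00 : 0 < n0 := by positivity
  set ε₀ := min (min 1 (c0 / (2 * n0 + 4))) (min ((ζ₀ - ζ1) / K) ((ζ2 - ζ₀) / K)) with hε₀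
  have hε₀p : 0 < ε₀ := by
    have a := sub_pos.2 h10
    have b := sub_pos.2 h02
    positivity
  refine ⟨K, hK0, c0 / 2, by positivity, 2 * c0, by positivity, ε₀, hε₀p, (min_le_left _ _).trans (min_le_left _ _), ?_⟩
  intro ε h0 hε
  have hε1 : ε ≤ 1 := hε.trans ((min_le_left _ _).trans (min_le_left _ _))
  have hεn : ε ≤ c0 / (2 * n0 + 4) := hε.trans ((min_le_left _ _).trans (min_le_right _ _))
  have hεa : ε ≤ (ζ₀ - ζ1) / K := hε.trans ((min_le_right _ _).trans (min_le_left _ _))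
  have hεb : ε ≤ (ζ2 - ζ₀) / K := hε.trans ((min_le_right _ _).trans (min_le_right _ _))
  rw [le_div_iff₀ (by positivity)] at hεn hεa hεb
  have hε2 : ε ^ 2 ≤ ε := by nlinarith only [h0, hε1]
  have hεp : 0 < ε ^ 2 := by positivity
  set νs := c0 / ε ^ 2 with hνs
  have eνs : νs * ε ^ 2 = c0 := by rw [hνs]; field_simp
  have hνs1 : 2 * n0 + 4 ≤ νs := by
    rw [hνs, le_div_iff₀ hεp]
    have : (2 * n0 + 4) * ε ^ 2 ≤ (2 * n0 + 4) * ε := by gcongr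
    linarith only [this, hεn]
  have hνs0 : 0 < νs := by linarith only [hνs1, hn00]
  set l := ⌊νs⌋₊ with hl
  have hl1 : (l:ℝ) ≤ νs := Nat.floor_le hνs0.le
  have hl2 : νs < l + 1 := Nat.lt_floor_add_one νs
  have hl3 : 2 ≤ l := by
    have : (2:ℝ) < (l:ℝ) + 1 := by linarith only [hl2, hνs1, hn00]
    have : 2 < l + 1 := by exact_mod_cast this
    omega
  have hν1 : nu l ≤ νs + 1/2 := by unfold nu; linarith only [hl1]
  have hν2 : νs - 1/2 ≤ nu l := by unfold nu; linarith only [hl2]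
  have hν0 := nu_pos l
  have hνn : n0 ≤ nu l := by linarith only [hν2, hνs1, hn00]
  have hm0 : m0 ≤ nu l := by
    have : 0 < 2 / c0 := by positivity
    linarith only [this, hνn, le_abs_self m0, hn1, hn0]
  have hc1 : c0 / 2 ≤ nu l * ε ^ 2 := by
    have : νs / 2 ≤ nu l := by linarith only [hν2, hνs1, hn00]
    calc c0 / 2 = νs / 2 * ε ^ 2 := by linarith only [eνs]
      _ ≤ _ := by gcongr
  have hc2 : nu l * ε ^ 2 ≤ 2 * c0 := by
    have : nu l ≤ 2 * νs := by linarith only [hν1, hνs1, hn00]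
    calc nu l * ε ^ 2 ≤ 2 * νs * ε ^ 2 := by gcongr
      _ = _ := by linarith only [eνs]
  refine ⟨l, hl3, hm0, hc1, hc2, ?_⟩
  have hνν : 1 ≤ nu l ^ 2 * ε ^ 2 := by
    have : 2 / c0 ≤ nu l := by
      linarith only [hνn, abs_nonneg m0, hn1, hn0]
    have e : 2 / c0 * (c0 / 2) = 1 := by field_simp
    calc 1 = 2 / c0 * (c0 / 2) := e.symm
      _ ≤ nu l * (nu l * ε ^ 2) := by gcongr
      _ = _ := by ring
  have hQ0 := Qf_pos hl3 h0
  have hQ := Qpos_aux hl3 h0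
  have eQ : Qf l ε = (nu l ^ 2 - 9/4) * ε ^ 2 := by unfold Qf; rw [hQ.2.2.2]
  have hQ1 : (16/25) * nu l ^ 2 * ε ^ 2 ≤ Qf l ε := hQ.2.1
  have hνg := nu_ge hl3
  set φ : ℝ → ℝ := fun ζ => (ζ * nu l) ^ 2 / Qf l ε - (Wf l (ζ * nu l) + 1/2) with hφ
  have hφe : ∀ ζ ∈ Set.Icc ζ1 ζ2, |φ ζ - (ζ ^ 2 - ζ₀ ^ 2 * (sg ζ / σ₀)) / ε ^ 2| ≤ E := by
    intro ζ hζ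
    have hζ0 : 0 < ζ := h1.trans_le hζ.1
    have hζ2 : ζ < 1 := hζ.2.trans_lt h2
    have hσ := sg_pos hζ0.le hζ2
    have hσ1 := sg_le_one ζ
    have hζsq : ζ ^ 2 ≤ 1 := by nlinarith only [hζ0, hζ2]
    have hσσ : σm ≤ sg ζ := by
      apply Real.sqrt_le_sqrt; have := hζ.2; nlinarith only [this, hζ0]
    have hk : ζ ^ 2 / (2 * sg ζ ^ 2) ≤ k0 := by
      apply div_le_div₀ (by norm_num) hζsq (by positivity)
      gcongr
    have hkp : 0 < ζ ^ 2 / (2 * sg ζ ^ 2) := by positivity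
    have a1 := (H1 l (by have : 0 < 2 / c0 := by positivity
                         linarith only [hνn, abs_nonneg m0, hn0, this]) (ζ * nu l) (by positivity) (by gcongr; exact hζ.2)).1
    rw [Af_scale] at a1
    have a2 : C1 * (ζ * nu l) ^ 2 / nu l ^ 3 ≤ C1 := by
      rw [div_le_iff₀ (by positivity)]
      have : ζ ^ 2 * nu l ^ 2 ≤ 1 * (nu l ^ 2 * nu l) := by
        apply mul_le_mul hζsq _ (by positivity) (by norm_num)
        nlinarith only [hνg, sq_nonneg (nu l)]
      calc C1 * (ζ * nu l) ^ 2 = C1 * (ζ ^ 2 * nu l ^ 2) := by ring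
        _ ≤ C1 * (1 * (nu l ^ 2 * nu l)) := by gcongr
        _ = _ := by ring
    have a3 : |(ζ * nu l) ^ 2 / Qf l ε - ζ ^ 2 / ε ^ 2| ≤ 4 := by
      have hne : nu l ^ 2 - 9 / 4 ≠ 0 := by nlinarith only [hνg]
      have e : (ζ * nu l) ^ 2 / Qf l ε - ζ ^ 2 / ε ^ 2 = ζ ^ 2 * (9/4) / Qf l ε := by
        obtain ⟨m, hm⟩ : ∃ m, m = nu l ^ 2 - 9 / 4 := ⟨_, rfl⟩
        rw [← hm] at hne
        rw [eQ, mul_pow, ← hm, show nu l ^ 2 = m + 9/4 by linarith only [hm]]; field_simp; ring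
      rw [e, abs_of_pos (by positivity), div_le_iff₀ hQ0]
      linarith only [hζsq, hνν, hQ1]
    have a4 : |νs * sg ζ - nu l * sg ζ| ≤ 1/2 := by
      rw [← sub_mul, abs_mul, abs_of_pos hσ]
      have : |νs - nu l| ≤ 1/2 := by rw [abs_le]; constructor <;> linarith only [hν1, hν2]
      calc |νs - nu l| * sg ζ ≤ 1/2 * 1 := by gcongr
        _ = _ := by ring
    have e5 : (ζ ^ 2 - ζ₀ ^ 2 * (sg ζ / σ₀)) / ε ^ 2 = ζ ^ 2 / ε ^ 2 - νs * sg ζ := by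
      rw [hνs, hc0]; field_simp
    rw [e5, hφ]
    rw [abs_le] at a1 a3 a4 ⊢
    constructor <;> linarith only [a1.1, a1.2, a3.1, a3.2, a4.1, a4.2, a2, hk, hkp, hE, hk00]
  set za := ζ₀ - K * ε ^ 2 with hza
  set zb := ζ₀ + K * ε ^ 2 with hzb
  have hKe : 0 < K * ε ^ 2 := by positivity
  have hKε : K * ε ^ 2 ≤ K * ε := by gcongr
  have hza1 : ζ1 ≤ za := by linarith only [hza, hKε, hεa]
  have hzb2 : zb ≤ ζ2 := by linarith only [hzb, hKε, hεb]
  have hKζ : K * ζ₀ = E := by rw [hK]; field_simp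
  have hfa : φ za ≤ 0 := by
    have b := (abs_le.1 (hφe za ⟨hza1, by linarith only [hza, hKe, h02]⟩)).2
    have s : σ₀ ≤ sg za := by
      apply Real.sqrt_le_sqrt; nlinarith only [hza, hKe, hza1, h1]
    have s1 : 1 ≤ sg za / σ₀ := by rwa [one_le_div hσ₀p]
    have s2 : (za ^ 2 - ζ₀ ^ 2 * (sg za / σ₀)) / ε ^ 2 ≤ - E := by
      rw [div_le_iff₀ hεp]
      have : ζ₀ ^ 2 * 1 ≤ ζ₀ ^ 2 * (sg za / σ₀) := by gcongr
      have e : za ^ 2 - ζ₀ ^ 2 = - (K * ε ^ 2) * (za + ζ₀) := by rw [hza]; ring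
      have : K * ε ^ 2 * ζ₀ = E * ε ^ 2 := by rw [← hKζ]; ring
      have : 0 < K * ε ^ 2 * za := mul_pos hKe (by linarith only [hza1, h1])
      linarith
    linarith only [b, s2]
  have hfb : 0 ≤ φ zb := by
    have b := (abs_le.1 (hφe zb ⟨by linarith only [hzb, hKe, h10], hzb2⟩)).1
    have s : sg zb ≤ σ₀ := by
      apply Real.sqrt_le_sqrt; nlinarith only [hzb, hKe, h0p]
    have s1 : sg zb / σ₀ ≤ 1 := by rwa [div_le_one hσ₀p]
    have s2 : E ≤ (zb ^ 2 - ζ₀ ^ 2 * (sg zb / σ₀)) / ε ^ 2 := by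
      rw [le_div_iff₀ hεp]
      have : ζ₀ ^ 2 * (sg zb / σ₀) ≤ ζ₀ ^ 2 * 1 := by gcongr
      have e : zb ^ 2 - ζ₀ ^ 2 = (K * ε ^ 2) * (zb + ζ₀) := by rw [hzb]; ring
      have : K * ε ^ 2 * ζ₀ = E * ε ^ 2 := by rw [← hKζ]; ring
      have : 0 < K * ε ^ 2 * zb := mul_pos hKe (by linarith only [hzb, hKe, h0p])
      linarith
    linarith only [b, s2]
  have hcont : ContinuousOn φ (Set.Icc za zb) := by
    intro ζ hζ
    have hζ0 : 0 < ζ * nu l := mul_pos (h1.trans_le (hza1.trans hζ.1)) hν0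
    have hc := (Wf_hasDeriv l hζ0).continuousAt
    have : ContinuousAt (fun ζ => Wf l (ζ * nu l)) ζ :=
      ContinuousAt.comp (f := fun ζ => ζ * nu l) (g := Wf l) hc (by fun_prop)
    apply ContinuousAt.continuousWithinAt
    rw [hφ]
    fun_prop
  obtain ⟨ζ, hζ, hζe⟩ := intermediate_value_Icc (by linarith only [hza, hzb, hKe]) hcont ⟨hfa, hfb⟩
  refine ⟨ζ, ⟨hza1.trans hζ.1, hζ.2.trans hzb2⟩, ?_, ?_⟩
  · rw [abs_le]; constructor <;> linarith only [hζ.1, hζ.2, hza, hzb]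
  · simp only [hφ] at hζe; linarith only [hζe]

set_option maxHeartbeats 1000000 in
lemma exists_root {ζ1 ζ₀ ζ2 : ℝ} (h1 : 0 < ζ1) (h10 : ζ1 < ζ₀) (h02 : ζ₀ < ζ2) (h2 : ζ2 < 1) :
    ∃ β > 0, ∃ K > 0, ∃ ε₀ > 0, ε₀ ≤ 1 ∧ ∀ ε : ℝ, 0 < ε → ε ≤ ε₀ →
    ∃ l : ℕ, 2 ≤ l ∧ ∃ ζ ∈ Set.Icc ζ1 ζ2, |ζ - ζ₀| ≤ K * ε ^ 2 ∧ ∃ y : ℝ, |y| ≤ Real.exp (-β / ε ^ 2) ∧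
      IsRt l (Qf l ε) (((ζ * nu l : ℝ) : ℂ) - y * I) := by
  have h0p : 0 < ζ₀ := h1.trans h10
  have h20 : 0 < ζ2 := h0p.trans h02
  obtain ⟨C2, hC2, n2, hn2, H2⟩ := T_asym ζ2 h20 h2
  obtain ⟨K, hK, c, hc, D, hD, e1, he1, he11, H⟩ := ivt_root h1 h10 h02 h2 n2
  have het := et_pos h20 h2
  set β := c * et ζ2 with hβ
  have hβ0 : 0 < β := by positivity
  set C4 := 8 / ζ1 * D ^ 3 * Real.exp (dinf + C2) with hC4
  have hC40 : 0 < C4 := by positivity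
  obtain ⟨e2, he2, he21, H3⟩ := exp_beats C4 β hβ0 6
  obtain ⟨e3, he3, he31, H4⟩ := small_y 1 β hβ0 2
  set K' := K + 1 with hK'
  refine ⟨β, hβ0, K', by positivity, min (min e1 (min e2 e3)) (min ((ζ₀ - ζ1) / K') ((ζ2 - ζ₀) / K')), ?_, ?_, ?_⟩
  · have a := sub_pos.2 h10
    have b := sub_pos.2 h02
    positivity
  · exact (min_le_left _ _).trans ((min_le_left _ _).trans he11)
  intro ε h0 hε
  have hεa := hε.trans ((min_le_right _ _).trans (min_le_left _ _))
  have hεb := hε.trans ((min_le_right _ _).trans (min_le_right _ _))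
  have hε1 := hε.trans ((min_le_left _ _).trans (min_le_left _ _))
  have hε2 := hε.trans ((min_le_left _ _).trans ((min_le_right _ _).trans (min_le_left _ _)))
  have hε3 := hε.trans ((min_le_left _ _).trans ((min_le_right _ _).trans (min_le_right _ _)))
  rw [le_div_iff₀ (by positivity)] at hεa hεb
  have hεone : ε ≤ 1 := hε1.trans he11
  have hεsq : ε ^ 2 ≤ ε := by nlinarith only [h0, hεone]
  have hεp : 0 < ε ^ 2 := by positivity
  obtain ⟨l, hl, hn, hνc, hνD, ζ, hζ, hζK, hζe⟩ := H ε h0 hε1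
  have hν0 := nu_pos l
  have hνg := nu_ge hl
  have hζ0 : 0 < ζ := h1.trans_le hζ.1
  have hζ1 : ζ < 1 := hζ.2.trans_lt h2
  have hx : 0 < ζ * nu l := by positivity
  have hxν : ζ * nu l ≤ nu l := by nlinarith only [hν0, hζ1]
  have hT := H2 l hn (ζ * nu l) hx (by gcongr; exact hζ.2)
  have hw := wf_pos l hx
  have hN := Nf_pos l (ζ * nu l)
  have hwle : wf l (ζ * nu l) ≤ Real.exp (dinf + C2) * nu l * Real.exp (- (2 * (β / ε ^ 2))) := by
    have hl' := log_wf_scale l hζ0 hζ1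
    have hC2' : C2 / nu l ≤ C2 := div_le_self hC2.le (by linarith only [hνg])
    have hlog : Real.log (sg ζ) ≤ 0 := Real.log_nonpos (sg_nonneg _) (sg_le_one _)
    have heta : et ζ2 ≤ et ζ := et_anti ⟨hζ0, hζ1.le⟩ ⟨h20, h2.le⟩ hζ.2
    have hb : β / ε ^ 2 ≤ nu l * et ζ := by
      rw [div_le_iff₀ hεp, hβ]
      calc c * et ζ2 ≤ (nu l * ε ^ 2) * et ζ := by gcongr
        _ = _ := by ring
    rw [← Real.log_le_log_iff hw (by positivity), Real.log_mul (by positivity) (Real.exp_pos _).ne', Real.log_mul (Real.exp_pos _).ne' hν0.ne',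
      Real.log_exp, Real.log_exp, hl']
    linarith only [(abs_le.1 hT).2, hC2', hlog, hb]
  have hbd : 8 * nu l ^ 3 / Nf l (ζ * nu l) ≤ Real.exp (-β / ε ^ 2) := by
    have e : 8 * nu l ^ 3 / Nf l (ζ * nu l) = 8 / ζ * nu l ^ 2 * wf l (ζ * nu l) := by
      unfold wf; field_simp
    have hnu : nu l ≤ D / ε ^ 2 := by rwa [le_div_iff₀ hεp]
    have h3 := H3 ε h0 hε2
    rw [e]
    calc 8 / ζ * nu l ^ 2 * wf l (ζ * nu l) ≤ 8 / ζ1 * nu l ^ 2 * (Real.exp (dinf + C2) * nu l * Real.exp (- (2 * (β / ε ^ 2)))) := by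
          gcongr; exact hζ.1
      _ = 8 / ζ1 * nu l ^ 3 * Real.exp (dinf + C2) * Real.exp (- (2 * (β / ε ^ 2))) := by ring
      _ ≤ 8 / ζ1 * (D / ε ^ 2) ^ 3 * Real.exp (dinf + C2) * Real.exp (- (2 * (β / ε ^ 2))) := by gcongr
      _ = C4 / ε ^ 6 * Real.exp (- (2 * (β / ε ^ 2))) := by rw [hC4]; field_simp
      _ ≤ Real.exp (β / ε ^ 2) * Real.exp (- (2 * (β / ε ^ 2))) := by gcongr
      _ = _ := by rw [← Real.exp_add]; congr 1; ring
  have hexp1 : Real.exp (-β / ε ^ 2) ≤ 1 := by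
    rw [Real.exp_le_one_iff, neg_div]; have : 0 < β / ε ^ 2 := by positivity
    linarith
  have hN8 : 8 * nu l ^ 2 ≤ Nf l (ζ * nu l) := by
    have := hbd.trans hexp1
    rw [div_le_one hN] at this
    nlinarith only [this, hνg, sq_nonneg (nu l)]
  obtain ⟨z, hz, hzd⟩ := near_root hl (Qf_pos hl h0) hx hζe hxν hN8
  have hzd' := hzd.trans hbd
  have hre : |z.re - ζ * nu l| ≤ Real.exp (-β / ε ^ 2) := by
    have := (abs_re_le_norm (z - (ζ * nu l : ℝ))).trans hzd'
    simpa using this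
  have him : |z.im| ≤ Real.exp (-β / ε ^ 2) := by
    have := (abs_im_le_norm (z - (ζ * nu l : ℝ))).trans hzd'
    simpa using this
  have hre2 : |z.re - ζ * nu l| ≤ ε ^ 2 := by
    have := H4 ε h0 hε3 _ hre
    linarith only [this]
  have hzz : |z.re / nu l - ζ₀| ≤ K' * ε ^ 2 := by
    have a : |z.re / nu l - ζ| ≤ ε ^ 2 := by
      rw [show z.re / nu l - ζ = (z.re - ζ * nu l) / nu l by field_simp, abs_div, abs_of_pos hν0, div_le_iff₀ hν0]
      nlinarith only [hre2, hνg, hεp]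
    have := abs_sub_le (z.re / nu l) ζ ζ₀
    rw [hK']; linarith only [this, a, hζK]
  have hKε : K' * ε ^ 2 ≤ K' * ε := by gcongr
  refine ⟨l, hl, z.re / nu l, ⟨?_, ?_⟩, hzz, - z.im, by rwa [abs_neg], ?_⟩
  · linarith only [(abs_le.1 hzz).1, hKε, hεa]
  · linarith only [(abs_le.1 hzz).2, hKε, hεb]
  · rw [div_mul_cancel₀ _ hν0.ne']
    have : ((z.re : ℝ) : ℂ) - ((-z.im : ℝ) : ℂ) * I = z := by
      push_cast; rw [neg_mul, sub_neg_eq_add, re_add_im]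
    rwa [this]

end Bub

open Complex
namespace Bub
open Polynomial

lemma exp_form {ε y B : ℝ} (hε : 0 < ε) (hy : 0 < y) :
    ε ^ 2 * Real.exp (B / ε ^ 2) * y = Real.exp (Real.log (ε ^ 2 * y) + B / ε ^ 2) := by
  rw [Real.exp_add, Real.exp_log (by positivity)]; ring

lemma lowerAux {ζ₀ : ℝ} (hz : ζ₀ ∈ Set.Ioo (0 : ℝ) (Real.sqrt (2 - Real.sqrt 2))) (hg : gg ζ₀ = 0)
    (hB : 0 < bb ζ₀) :
    ∃ C > 0, ∃ ε₀ > 0, ε₀ ≤ 1 ∧ ∀ ε : ℝ, 0 < ε → ε ≤ ε₀ → ∀ l : ℕ, 2 ≤ l → ∀ x y : ℝ, 0 ≤ x →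
      0 < y → IsRt l (Qf l ε) ((x:ℂ) - y * I) →
      Real.exp (Ll ζ₀ - C * ε ^ 2) ≤ ε ^ 2 * Real.exp (bb ζ₀ / ε ^ 2) * y := by
  have hz1 : ζ₀ < 1 := hz.2.trans r_lt_one
  have hz0 : 0 < ζ₀ := hz.1
  set β := bb ζ₀ / 2 with hβd
  have hβ : 0 < β := by positivity
  obtain ⟨ζa, ha0, ha4, ea, hea, -, hA⟩ := caseA β hβ
  obtain ⟨ζc, hc2, hc1, ec, hec, -, hC⟩ := caseC β hβ
  set ζ1 := min ζa (ζ₀/2) with h1d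
  set ζ2 := max ζc ((1+ζ₀)/2) with h2d
  have h1 : 0 < ζ1 := lt_min ha0 (by positivity)
  have h2 : ζ2 < 1 := max_lt hc1 (by linarith)
  have h01 : ζ1 ≤ ζ₀ := (min_le_right _ _).trans (by linarith)
  have h02 : ζ₀ ≤ ζ2 := le_trans (by linarith) (le_max_right _ _)
  have h1a : ζ1 ≤ ζa := min_le_left _ _
  have h2c : ζc ≤ ζ2 := le_max_left _ _
  obtain ⟨Cp, hCp, ep, hep, hep1, hP⟩ := precise h1 (h01.trans h02) h2 β hβ
  obtain ⟨c, hc, C', hC', hq⟩ := bb_quad hz hg h1 h2 h01 h02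
  obtain ⟨K, hK, hL⟩ := Ll_lip h1 h2 h01 h02
  obtain ⟨ee, hee, hee1, hE⟩ := exp_beats (Real.exp (Ll ζ₀)) β hβ 2
  refine ⟨K^2/(4*c) + Cp, by positivity, min (min ea ec) (min ep ee), by positivity,
    (min_le_right _ _).trans ((min_le_left _ _).trans hep1), ?_⟩
  intro ε hε hεs l hl x y hx hy hR
  have l1 : ε ≤ ea := hεs.trans ((min_le_left _ _).trans (min_le_left _ _))
  have l2 : ε ≤ ec := hεs.trans ((min_le_left _ _).trans (min_le_right _ _))
  have l3 : ε ≤ ep := hεs.trans ((min_le_right _ _).trans (min_le_left _ _))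
  have l4 : ε ≤ ee := hεs.trans ((min_le_right _ _).trans (min_le_right _ _))
  have hε2 : 0 < ε ^ 2 := by positivity
  have hνp := nu_pos l
  rcases le_or_gt (Real.exp (-β/ε^2)) y with hy1 | hy1
  · have e1 := hE ε hε l4
    rw [div_le_iff₀ hε2] at e1
    have e2 : Real.exp (bb ζ₀ / ε ^ 2) * Real.exp (-β/ε^2) = Real.exp (β/ε^2) := by
      rw [← Real.exp_add]; congr 1; rw [hβd]; ring
    calc Real.exp (Ll ζ₀ - (K^2/(4*c) + Cp) * ε ^ 2) ≤ Real.exp (Ll ζ₀) := by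
          apply Real.exp_le_exp.2
          have : 0 ≤ (K^2/(4*c) + Cp) * ε ^ 2 := by positivity
          linarith
      _ ≤ ε ^ 2 * Real.exp (bb ζ₀ / ε ^ 2) * Real.exp (-β/ε^2) := by
          rw [mul_assoc, e2]; linarith
      _ ≤ _ := by gcongr
  · have hxa : ζ1 * nu l ≤ x := by
      by_contra hcon
      push Not at hcon
      have : x ≤ ζa * nu l := hcon.le.trans (by gcongr)
      have := hA ε hε l1 l hl x y hx this hy hR
      linarith
    have hxc : x ≤ ζ2 * nu l := by
      by_contra hcon
      push Not at hcon
      have : ζc * nu l ≤ x := le_trans (by gcongr) hcon.le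
      have := hC ε hε l2 l hl x y this hy hR
      linarith
    obtain ⟨ζ, hζ⟩ : ∃ ζ, ζ = x / nu l := ⟨_, rfl⟩
    have hxz : x = ζ * nu l := by rw [hζ]; field_simp
    have hm : ζ ∈ Set.Icc ζ1 ζ2 := by
      rw [hζ]; exact ⟨by rwa [le_div_iff₀ hνp], by rwa [div_le_iff₀ hνp]⟩
    rw [hxz] at hR
    obtain ⟨-, hp⟩ := hP ε hε l3 l hl ζ hm y (by rw [abs_of_pos hy]; exact hy1.le) hR
    rw [exp_form hε hy]
    apply Real.exp_le_exp.2
    have a1 := (abs_le.1 hp).1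
    have a2 := (abs_le.1 (hL ζ hm)).1
    have a3 : c * |ζ - ζ₀|^2 ≤ bb ζ₀ - bb ζ := by rw [sq_abs]; exact (hq ζ hm).1
    set d := |ζ - ζ₀|
    have a4 : c * d^2 / ε^2 ≤ bb ζ₀ / ε^2 - bb ζ / ε^2 := by rw [← sub_div]; gcongr
    have a5 : 0 ≤ c * d^2 / ε^2 - K * d + K^2/(4*c) * ε^2 := by
      have : c * d^2 / ε^2 - K * d + K^2/(4*c) * ε^2 = c * (d/ε - K*ε/(2*c))^2 := by
        field_simp; ring
      rw [this]; positivity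
    linarith

lemma lowerB {ζ₀ : ℝ} (hz : ζ₀ ∈ Set.Ioo (0 : ℝ) (Real.sqrt (2 - Real.sqrt 2))) (hg : gg ζ₀ = 0)
    (hB : 0 < bb ζ₀) :
    ∃ C > 0, ∃ ε₀ > 0, ε₀ ≤ 1 ∧ ∀ ε : ℝ, 0 < ε → ε ≤ ε₀ → ∀ l : ℕ, 2 ≤ l → ∀ z : ℂ,
      z.im < 0 → IsRt l (Qf l ε) z →
      Real.exp (Ll ζ₀ - C * ε ^ 2) ≤ ε ^ 2 * Real.exp (bb ζ₀ / ε ^ 2) * (-z.im) := by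
  obtain ⟨C, hC, e, he, he1, h⟩ := lowerAux hz hg hB
  refine ⟨C, hC, e, he, he1, fun ε hε hεe l hl z hzi hR => ?_⟩
  rcases le_total 0 z.re with h0 | h0
  · refine h ε hε hεe l hl z.re (-z.im) h0 (by linarith) ?_
    have : ((z.re : ℝ) : ℂ) - ((-z.im : ℝ) : ℂ) * I = z := by
      push_cast; rw [neg_mul, sub_neg_eq_add, re_add_im]
    rwa [this]
  · refine h ε hε hεe l hl (-z.re) (-z.im) (by linarith) (by linarith) ?_
    have : ((-z.re : ℝ) : ℂ) - ((-z.im : ℝ) : ℂ) * I = -(starRingEnd ℂ) z := by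
      apply Complex.ext <;> simp
    rw [this]; exact IsRt_symm hR

lemma upperB {ζ₀ : ℝ} (hz : ζ₀ ∈ Set.Ioo (0 : ℝ) (Real.sqrt (2 - Real.sqrt 2))) (hg : gg ζ₀ = 0) :
    ∃ C > 0, ∃ ε₀ > 0, ε₀ ≤ 1 ∧ ∀ ε : ℝ, 0 < ε → ε ≤ ε₀ → ∃ l : ℕ, 2 ≤ l ∧ ∃ z : ℂ,
      z.im < 0 ∧ IsRt l (Qf l ε) z ∧
      ε ^ 2 * Real.exp (bb ζ₀ / ε ^ 2) * (-z.im) ≤ Real.exp (Ll ζ₀ + C * ε ^ 2) := by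
  have hz1 : ζ₀ < 1 := hz.2.trans r_lt_one
  have hz0 : 0 < ζ₀ := hz.1
  have h1 : 0 < ζ₀/2 := by positivity
  have h10 : ζ₀/2 < ζ₀ := by linarith
  have h02 : ζ₀ < (1+ζ₀)/2 := by linarith
  have h2 : (1+ζ₀)/2 < 1 := by linarith
  obtain ⟨β, hβ, K, hK, e1, he1, he11, hE⟩ := exists_root h1 h10 h02 h2
  obtain ⟨Cp, hCp, ep, hep, hep1, hP⟩ := precise h1 (h10.trans h02).le h2 β hβ
  obtain ⟨c, hc, C', hC', hq⟩ := bb_quad hz hg h1 h2 h10.le h02.le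
  obtain ⟨KL, hKL, hL⟩ := Ll_lip h1 h2 h10.le h02.le
  refine ⟨KL * K + C' * K^2 + Cp, by positivity, min e1 ep, by positivity,
    (min_le_left _ _).trans he11, ?_⟩
  intro ε hε hεs
  have hε2 : 0 < ε ^ 2 := by positivity
  obtain ⟨l, hl, ζ, hm, hd, y, hy, hR⟩ := hE ε hε (hεs.trans (min_le_left _ _))
  obtain ⟨hy0, hp⟩ := hP ε hε (hεs.trans (min_le_right _ _)) l hl ζ hm y hy hR
  refine ⟨l, hl, _, ?_, hR, ?_⟩
  · simpa using hy0
  · have : -((((ζ * nu l : ℝ)) : ℂ) - y * I).im = y := by simp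
    rw [this, exp_form hε hy0]
    apply Real.exp_le_exp.2
    have a1 := (abs_le.1 hp).2
    have a2 := (abs_le.1 (hL ζ hm)).2
    have a3 : bb ζ₀ - bb ζ ≤ C' * |ζ - ζ₀|^2 := by rw [sq_abs]; exact (hq ζ hm).2
    have a4 : bb ζ₀ / ε^2 - bb ζ / ε^2 ≤ C' * K^2 * ε^2 := by
      rw [← sub_div, div_le_iff₀ hε2]
      calc _ ≤ C' * |ζ - ζ₀|^2 := a3
        _ ≤ C' * (K*ε^2)^2 := by gcongr
        _ = _ := by ring
    have a5 : KL * |ζ - ζ₀| ≤ KL * (K * ε^2) := by gcongr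
    linarith

lemma arg_of_im_neg {z : ℂ} (h : z.im < 0) : -Real.pi < z.arg ∧ z.arg < Real.pi := by
  refine ⟨neg_pi_lt_arg z, ?_⟩
  have := Complex.arg_neg_iff.2 h
  linarith [Real.pi_pos]

lemma Qf_cast (l : ℕ) (ε : ℝ) :
    (((l : ℂ) + 2) * ((l : ℂ) - 1) * (ε : ℂ) ^ 2) = ((Qf l ε : ℝ) : ℂ) := by
  unfold Qf; push_cast; ring

lemma main {ζ₀ : ℝ} (hz : ζ₀ ∈ Set.Ioo (0 : ℝ) (Real.sqrt (2 - Real.sqrt 2))) (hg : gg ζ₀ = 0)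
    (hB : 0 < bb ζ₀) :
    ∃ A₀ > (0 : ℝ), ∃ C > (0 : ℝ), ∃ ε₀ > (0 : ℝ), ∀ ε : ℝ, 0 < ε → ε ≤ ε₀ →
          |ε ^ 2 * Real.exp (bb ζ₀ / ε ^ 2) * GammaRate ε - A₀| ≤ C * ε ^ 2 := by
  obtain ⟨C1, hC1, e1, he1, -, hLo⟩ := lowerB hz hg hB
  obtain ⟨C2, hC2, e2, he2, -, hUp⟩ := upperB hz hg
  refine ⟨Real.exp (Ll ζ₀), Real.exp_pos _, Real.exp (Ll ζ₀) * (C1 + 2 * C2), by positivity,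
    min (min e1 e2) (min 1 (1/C2)), by positivity, ?_⟩
  intro ε hε hεs
  have l1 : ε ≤ e1 := hεs.trans ((min_le_left _ _).trans (min_le_left _ _))
  have l2 : ε ≤ e2 := hεs.trans ((min_le_left _ _).trans (min_le_right _ _))
  have l3 : ε ≤ 1 := hεs.trans ((min_le_right _ _).trans (min_le_left _ _))
  have l4 : ε ≤ 1/C2 := hεs.trans ((min_le_right _ _).trans (min_le_right _ _))
  have hε2 : 0 < ε ^ 2 := by positivity
  have hM : 0 < ε ^ 2 * Real.exp (bb ζ₀ / ε ^ 2) := by positivity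
  have hlo : Real.exp (Ll ζ₀ - C1 * ε ^ 2) ≤ ε ^ 2 * Real.exp (bb ζ₀ / ε ^ 2) * GammaRate ε := by
    rw [← div_le_iff₀' hM]
    obtain ⟨l, hl, z, hzi, hR, -⟩ := hUp ε hε l2
    have hz0 : z ≠ 0 := by rintro rfl; simp at hzi
    unfold GammaRate
    apply le_csInf
    · refine ⟨-z.im, l, z, hl, hz0, (arg_of_im_neg hzi).1, (arg_of_im_neg hzi).2, hzi, ?_, rfl⟩
      rw [Qf_cast]
      exact (root_iff l (Qf_pos hl hε) hz0).2 hR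
    · rintro y ⟨l', z', hl', hz0', -, -, hzi', hR', rfl⟩
      rw [Qf_cast] at hR'
      rw [div_le_iff₀' hM]
      exact hLo ε hε l1 l' hl' z' hzi' ((root_iff l' (Qf_pos hl' hε) hz0').1 hR')
  have hup : ε ^ 2 * Real.exp (bb ζ₀ / ε ^ 2) * GammaRate ε ≤ Real.exp (Ll ζ₀ + C2 * ε ^ 2) := by
    obtain ⟨l, hl, z, hzi, hR, hb⟩ := hUp ε hε l2
    have hz0 : z ≠ 0 := by rintro rfl; simp at hzi
    refine le_trans (mul_le_mul_of_nonneg_left ?_ hM.le) hb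
    unfold GammaRate
    apply csInf_le
    · refine ⟨0, ?_⟩
      rintro y ⟨l', z', -, -, -, -, hzi', -, rfl⟩
      linarith
    · refine ⟨l, z, hl, hz0, (arg_of_im_neg hzi).1, (arg_of_im_neg hzi).2, hzi, ?_, rfl⟩
      rw [Qf_cast]
      exact (root_iff l (Qf_pos hl hε) hz0).2 hR
  set A := Real.exp (Ll ζ₀)
  have hA : 0 < A := Real.exp_pos _
  have b1 : A * (1 - C1 * ε^2) ≤ Real.exp (Ll ζ₀ - C1 * ε ^ 2) := by
    rw [sub_eq_add_neg (Ll ζ₀), Real.exp_add]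
    have := Real.add_one_le_exp (-(C1 * ε^2))
    exact mul_le_mul_of_nonneg_left (by linarith) hA.le
  have hu : C2 * ε^2 ≤ 1 := by
    rw [le_div_iff₀ hC2] at l4
    have : ε^2 ≤ ε := by nlinarith only [hε, l3]
    calc C2 * ε^2 ≤ C2 * ε := by gcongr
      _ ≤ 1 := by linarith
  have hu0 : 0 < C2 * ε^2 := by positivity
  have b2 : Real.exp (Ll ζ₀ + C2 * ε ^ 2) ≤ A * (1 + 2 * (C2 * ε^2)) := by
    rw [Real.exp_add]
    have := Real.abs_exp_sub_one_le (x := C2 * ε^2) (by rw [abs_of_pos hu0]; exact hu)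
    rw [abs_of_pos hu0] at this
    have := (abs_le.1 this).2
    exact mul_le_mul_of_nonneg_left (by linarith) hA.le
  have p1 : 0 < A * (C1 * ε^2) := by positivity
  have p2 : 0 < A * (C2 * ε^2) := by positivity
  rw [abs_le]
  constructor <;> nlinarith only [hlo, hup, b1, b2, p1, p2]

end Bub

theorem stmt15 :
    ∀ ζ₀ ∈ Set.Ioo (0 : ℝ) (Real.sqrt (2 - Real.sqrt 2)), g0 ζ₀ = 0 →
      ∀ B : ℝ, B = 2 * (ζ₀ ^ 2 / Real.sqrt (1 - ζ₀ ^ 2))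
          * ∫ t in ζ₀..(1 : ℝ), Real.sqrt (1 / t ^ 2 - 1) →
        ∃ A₀ > (0 : ℝ), ∃ C > (0 : ℝ), ∃ ε₀ > (0 : ℝ), ∀ ε : ℝ, 0 < ε → ε ≤ ε₀ →
          |ε ^ 2 * Real.exp (B / ε ^ 2) * GammaRate ε - A₀| ≤ C * ε ^ 2 := by
  intro ζ₀ hz hg B hB
  have h0 : 0 < ζ₀ := hz.1
  have h1 : ζ₀ < 1 := hz.2.trans Bub.r_lt_one
  rw [Bub.int_eq h0 h1] at hB
  rw [Bub.g0_eq h0 h1] at hg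
  have hBb : B = Bub.bb ζ₀ := by rw [hB]; unfold Bub.bb Bub.sg; ring
  have het := Bub.et_pos h0 h1
  have hsg := Bub.sg_pos h0.le h1
  have hpos : 0 < Bub.bb ζ₀ := by unfold Bub.bb; positivity
  rw [hBb]
  exact Bub.main hz hg hpos
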